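/- Let Ω ⊆ ℂ be a bounded open connected set with C^∞ smooth boundary, and let w₀ ∈ Ω. Then for every m ∈ ℕ and every δ > 0 there exists a function g, C^∞ on an open neighborhood of closure(Ω), holomorphic on Ω, injective on closure(Ω), and (m, δ)-close to the identity on closure(Ω), such that g(Ω) is a quadrature domain whose quadrature identity has w₀ as its only node: w₀ ∈ g(Ω) and there exist M ∈ ℕ and complex numbers c_0, …, c_M such that ∫_{g(Ω)} f dA = Σ_{k=0}^{M} c_k f^{(k)}(w₀) for every f ∈ A²(g(Ω)). -/

import Mathlib

open MeasureTheory Complex ComplexConjugate Metric Set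

noncomputable section

/-- `f` belongs to the Bergman space `A²(Ω)`. -/
def BergmanFun (Ω : Set ℂ) (f : ℂ → ℂ) : Prop :=
  DifferentiableOn ℂ f Ω ∧ IntegrableOn (fun z => ‖f z‖ ^ 2) Ω volume

/-- `Ω` is a finitely connected domain none of whose complementary components is a point. -/
def IsFinConnDomain (Ω : Set ℂ) : Prop :=
  IsOpen Ω ∧ IsConnected Ω ∧
  {C : Set ℂ | ∃ x ∈ Ωᶜ, C = connectedComponentIn Ωᶜ x}.Finite ∧
  ∀ x ∈ Ωᶜ, ¬ (connectedComponentIn Ωᶜ x).Subsingleton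

/-- `Ω` is a quadrature domain. -/
def IsQuadratureDomain (Ω : Set ℂ) : Prop :=
  ∃ N : ℕ, 0 < N ∧ ∃ (w : Fin N → ℂ) (n : Fin N → ℕ) (c : Fin N → ℕ → ℂ),
    (∀ j, w j ∈ Ω) ∧
    ∀ f : ℂ → ℂ, BergmanFun Ω f →
      (∫ z in Ω, f z) =
        ∑ j, ∑ k ∈ Finset.range (n j + 1), c j k * iteratedDerivWithin k f Ω (w j)

/-- `fa` is an Ahlfors map of `Ω` at `a`. -/
def IsAhlforsMap (Ω : Set ℂ) (a : ℂ) (fa : ℂ → ℂ) : Prop :=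
  DifferentiableOn ℂ fa Ω ∧ (∀ z ∈ Ω, ‖fa z‖ < 1) ∧
  (deriv fa a).im = 0 ∧ 0 < (deriv fa a).re ∧
  ∀ g : ℂ → ℂ, DifferentiableOn ℂ g Ω → (∀ z ∈ Ω, ‖g z‖ < 1) →
    ‖deriv g a‖ ≤ (deriv fa a).re

/-- `Ω` is bounded with `C^∞` smooth boundary consisting of finitely many disjoint
simple closed curves. -/
def HasSmoothBoundary (Ω : Set ℂ) : Prop :=
  Bornology.IsBounded Ω ∧
  ∃ (n : ℕ) (γ : Fin n → ℝ → ℂ),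
    (∀ i, ContDiff ℝ (⊤ : ℕ∞) (γ i)) ∧
    (∀ i, Function.Periodic (γ i) (2 * Real.pi)) ∧
    (∀ i, InjOn (γ i) (Ico 0 (2 * Real.pi))) ∧
    (∀ i t, deriv (γ i) t ≠ 0) ∧
    (Pairwise fun i j => Disjoint (range (γ i)) (range (γ j))) ∧
    frontier Ω = ⋃ i, range (γ i)

/-- Partial derivative in the `x`-direction of a real-valued function on `ℂ`. -/
def pdx (u : ℂ → ℝ) (z : ℂ) : ℝ := deriv (fun t : ℝ => u (z + (t : ℂ))) 0

/-- Partial derivative in the `y`-direction of a real-valued function on `ℂ`. -/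
def pdy (u : ℂ → ℝ) (z : ℂ) : ℝ := deriv (fun t : ℝ => u (z + (t : ℂ) * Complex.I)) 0

/-- `f` is a proper holomorphic map of `Ω` onto the open unit disc. -/
def IsProperOntoDisc (Ω : Set ℂ) (f : ℂ → ℂ) : Prop :=
  DifferentiableOn ℂ f Ω ∧ f '' Ω = ball (0 : ℂ) 1 ∧
  ∀ L : Set ℂ, L ⊆ ball (0 : ℂ) 1 → IsCompact L → IsCompact (Ω ∩ f ⁻¹' L)

/-- `g` is `(m, δ)`-close to the identity on `closure Ω`. -/
def CloseToId (Ω : Set ℂ) (m : ℕ) (δ : ℝ) (g : ℂ → ℂ) : Prop :=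
  ∀ k ≤ m, ∀ z ∈ closure Ω, ‖iteratedFDeriv ℝ k (fun w => g w - w) z‖ ≤ δ

/-- `σ : [0,1] → ℂ` is a piecewise continuously differentiable curve. -/
def PiecewiseC1On01 (σ : ℝ → ℂ) : Prop :=
  ContinuousOn σ (Icc 0 1) ∧ ∃ s : Finset ℝ, ContDiffOn ℝ 1 σ (Icc (0 : ℝ) 1 \ s)

/-- `Ω` is a generalized quadrature domain. -/
def IsGenQuadratureDomain (Ω : Set ℂ) : Prop :=
  ∃ (N M : ℕ) (w : Fin N → ℂ) (n : Fin N → ℕ) (c : Fin N → ℕ → ℂ)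
    (b : Fin M → ℂ) (σ : Fin M → ℝ → ℂ),
    (∀ j, w j ∈ Ω) ∧
    (∀ m, PiecewiseC1On01 (σ m)) ∧
    (∀ m, ∀ t ∈ Icc (0 : ℝ) 1, σ m t ∈ Ω) ∧
    ∀ f : ℂ → ℂ, BergmanFun Ω f →
      (∫ z in Ω, f z) =
        (∑ j, ∑ k ∈ Finset.range (n j + 1), c j k * iteratedDerivWithin k f Ω (w j)) +
        ∑ m, b m * ∫ t in (0 : ℝ)..1, f (σ m t) * deriv (σ m) t

open scoped ContDiff Topology

/-- The Wirtinger derivative `∂u/∂z`. -/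
def dz (u : ℂ → ℂ) (z : ℂ) : ℂ := (1 / 2) * (fderiv ℝ u z 1 - I * fderiv ℝ u z I)

/-- The Wirtinger derivative `∂u/∂z̄`. -/
def dbar (u : ℂ → ℂ) (z : ℂ) : ℂ := (1 / 2) * (fderiv ℝ u z 1 + I * fderiv ℝ u z I)

/-- The real-linear map `v ↦ a v + b v̄`. -/
def wirt (a b : ℂ) : ℂ →L[ℝ] ℂ :=
  a • ContinuousLinearMap.id ℝ ℂ + b • (conjCLE : ℂ ≃L[ℝ] ℂ).toContinuousLinearMap

@[simp] lemma wirt_apply (a b v : ℂ) : wirt a b v = a * v + b * conj v := by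
  simp [wirt]

lemma wirt_decomp (L : ℂ →L[ℝ] ℂ) :
    L = wirt ((1 / 2) * (L 1 - I * L I)) ((1 / 2) * (L 1 + I * L I)) := by
  ext v
  have h : L v = v.re * L 1 + v.im * L I := by
    conv_lhs => rw [← re_add_im v]
    have h1 : ((v.re : ℂ) + v.im * I) = v.re • (1 : ℂ) + v.im • I := by simp
    rw [h1, map_add, map_smul, map_smul]; simp
  rw [wirt_apply, h]
  have hc : conj v = v.re - v.im * I := by
    apply Complex.ext <;> simp
  rw [hc]
  nth_rewrite 3 [← re_add_im v]
  linear_combination (v.im : ℂ) * L I * I_sq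

lemma wirt_inj {a b c d : ℂ} (h : wirt a b = wirt c d) : a = c ∧ b = d := by
  have h1 := DFunLike.congr_fun h 1
  have h2 := DFunLike.congr_fun h I
  simp only [wirt_apply, map_one, mul_one, conj_I] at h1 h2
  have h3 : a - b = c - d := by
    have : I * (a - b) = I * (c - d) := by linear_combination h2
    exact mul_left_cancel₀ I_ne_zero this
  constructor
  · linear_combination (1 / 2) * h1 + (1 / 2) * h3
  · linear_combination (1 / 2) * h1 - (1 / 2) * h3

lemma fderiv_eq_wirt (u : ℂ → ℂ) (z : ℂ) : fderiv ℝ u z = wirt (dz u z) (dbar u z) :=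
  wirt_decomp _

lemma DifferentiableAt.hasWirt {u : ℂ → ℂ} {z : ℂ} (h : DifferentiableAt ℝ u z) :
    HasFDerivAt u (wirt (dz u z) (dbar u z)) z := by
  rw [← fderiv_eq_wirt]; exact h.hasFDerivAt

lemma HasFDerivAt.wirt_eq {u : ℂ → ℂ} {z a b : ℂ} (h : HasFDerivAt u (wirt a b) z) :
    dz u z = a ∧ dbar u z = b :=
  wirt_inj (by rw [← fderiv_eq_wirt, h.fderiv])

lemma wirt_comp (a b c d : ℂ) :
    (wirt a b).comp (wirt c d) = wirt (a * c + b * conj d) (a * d + b * conj c) := by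
  ext v; simp; ring

lemma HasFDerivAt.to_wirt {u : ℂ → ℂ} {z a b : ℂ} {L : ℂ →L[ℝ] ℂ} (h : HasFDerivAt u L z)
    (hL : ∀ v, L v = a * v + b * conj v) : HasFDerivAt u (wirt a b) z :=
  h.congr_fderiv (by ext v; simp [hL])

lemma HasDerivAt.hasWirt {u : ℂ → ℂ} {z a : ℂ} (h : HasDerivAt u a z) :
    HasFDerivAt u (wirt a 0) z := by
  refine (h.hasFDerivAt.restrictScalars ℝ).to_wirt fun v => ?_
  simp [mul_comm]

lemma HasFDerivAt.hasDerivAt_of_wirt {u : ℂ → ℂ} {z a : ℂ} (h : HasFDerivAt u (wirt a 0) z) :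
    HasDerivAt u a z := by
  rw [hasDerivAt_iff_isLittleO] 
  have := h.isLittleO
  simpa [mul_comm] using this

lemma hasFDerivAt_conj (z : ℂ) : HasFDerivAt (fun z : ℂ => conj z) (wirt 0 1) z := by
  refine HasFDerivAt.to_wirt ((conjCLE : ℂ ≃L[ℝ] ℂ).toContinuousLinearMap.hasFDerivAt) fun v => ?_
  simp

lemma hasFDerivAt_id' (z : ℂ) : HasFDerivAt (fun z : ℂ => z) (wirt 1 0) z :=
  (hasDerivAt_id z).hasWirt

lemma HasFDerivAt.wirt_conj {u : ℂ → ℂ} {z a b : ℂ} (h : HasFDerivAt u (wirt a b) z) :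
    HasFDerivAt (fun z => conj (u z)) (wirt (conj b) (conj a)) z := by
  have := (hasFDerivAt_conj (u z)).comp z h
  rw [wirt_comp] at this
  simpa [Function.comp_def] using this

lemma HasFDerivAt.wirt_comp {u v : ℂ → ℂ} {z a b c d : ℂ}
    (hu : HasFDerivAt u (wirt a b) (v z)) (hv : HasFDerivAt v (wirt c d) z) :
    HasFDerivAt (fun z => u (v z)) (wirt (a * c + b * conj d) (a * d + b * conj c)) z := by
  have := hu.comp z hv
  rwa [_root_.wirt_comp] at this

lemma HasFDerivAt.wirt_mul {u v : ℂ → ℂ} {z a b c d : ℂ}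
    (hu : HasFDerivAt u (wirt a b) z) (hv : HasFDerivAt v (wirt c d) z) :
    HasFDerivAt (fun z => u z * v z) (wirt (a * v z + u z * c) (b * v z + u z * d)) z := by
  refine (hu.mul hv).to_wirt fun v => ?_
  simp; ring

lemma HasFDerivAt.wirt_add {u v : ℂ → ℂ} {z a b c d : ℂ}
    (hu : HasFDerivAt u (wirt a b) z) (hv : HasFDerivAt v (wirt c d) z) :
    HasFDerivAt (fun z => u z + v z) (wirt (a + c) (b + d)) z := by
  refine (hu.add hv).to_wirt fun v => ?_
  simp; ring

lemma HasFDerivAt.wirt_sub {u v : ℂ → ℂ} {z a b c d : ℂ}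
    (hu : HasFDerivAt u (wirt a b) z) (hv : HasFDerivAt v (wirt c d) z) :
    HasFDerivAt (fun z => u z - v z) (wirt (a - c) (b - d)) z := by
  refine (hu.sub hv).to_wirt fun v => ?_
  simp; ring

section rules
variable {u v : ℂ → ℂ} {z : ℂ}

lemma dz_mul (hu : DifferentiableAt ℝ u z) (hv : DifferentiableAt ℝ v z) :
    dz (fun z => u z * v z) z = dz u z * v z + u z * dz v z :=
  (hu.hasWirt.wirt_mul hv.hasWirt).wirt_eq.1

lemma dbar_mul (hu : DifferentiableAt ℝ u z) (hv : DifferentiableAt ℝ v z) :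
    dbar (fun z => u z * v z) z = dbar u z * v z + u z * dbar v z :=
  (hu.hasWirt.wirt_mul hv.hasWirt).wirt_eq.2

lemma dbar_add (hu : DifferentiableAt ℝ u z) (hv : DifferentiableAt ℝ v z) :
    dbar (fun z => u z + v z) z = dbar u z + dbar v z :=
  (hu.hasWirt.wirt_add hv.hasWirt).wirt_eq.2

lemma dbar_sub (hu : DifferentiableAt ℝ u z) (hv : DifferentiableAt ℝ v z) :
    dbar (fun z => u z - v z) z = dbar u z - dbar v z :=
  (hu.hasWirt.wirt_sub hv.hasWirt).wirt_eq.2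

lemma dz_conj (hu : DifferentiableAt ℝ u z) : dz (fun z => conj (u z)) z = conj (dbar u z) :=
  hu.hasWirt.wirt_conj.wirt_eq.1

lemma dbar_conj (hu : DifferentiableAt ℝ u z) : dbar (fun z => conj (u z)) z = conj (dz u z) :=
  hu.hasWirt.wirt_conj.wirt_eq.2

lemma DifferentiableAt.dbar_eq_zero (hu : DifferentiableAt ℂ u z) : dbar u z = 0 :=
  hu.hasDerivAt.hasWirt.wirt_eq.2

lemma DifferentiableAt.dz_eq_deriv (hu : DifferentiableAt ℂ u z) : dz u z = deriv u z :=
  hu.hasDerivAt.hasWirt.wirt_eq.1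

lemma differentiableAt_of_dbar (hu : DifferentiableAt ℝ u z) (h : dbar u z = 0) :
    DifferentiableAt ℂ u z := by
  have := hu.hasWirt
  rw [h] at this
  exact this.hasDerivAt_of_wirt.differentiableAt

lemma dz_congr (h : u =ᶠ[𝓝 z] v) : dz u z = dz v z := by
  simp only [dz, h.fderiv_eq]

lemma dbar_congr (h : u =ᶠ[𝓝 z] v) : dbar u z = dbar v z := by
  simp only [dbar, h.fderiv_eq]

lemma norm_dbar_le : ‖dbar u z‖ ≤ ‖fderiv ℝ u z‖ := by
  have h1 := (fderiv ℝ u z).le_opNorm 1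
  have h2 := (fderiv ℝ u z).le_opNorm I
  simp only [norm_one, norm_I, mul_one] at h1 h2
  have h3 := norm_add_le (fderiv ℝ u z 1) (I * fderiv ℝ u z I)
  rw [norm_mul, norm_I, one_mul] at h3
  rw [dbar, norm_mul]; norm_num; linarith

lemma det_wirt (a b : ℂ) : (wirt a b).det = ‖a‖ ^ 2 - ‖b‖ ^ 2 := by
  have : (wirt a b).det = LinearMap.det (wirt a b : ℂ →ₗ[ℝ] ℂ) := rfl
  rw [this, ← LinearMap.det_toMatrix Complex.basisOneI, Matrix.det_fin_two]
  simp [LinearMap.toMatrix_apply, Complex.sq_norm, normSq_apply]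
  ring

end rules

section smooth
variable {u v : ℂ → ℂ} {s : Set ℂ}

lemma ContDiffOn.dz (hs : IsOpen s) (hu : ContDiffOn ℝ ∞ u s) : ContDiffOn ℝ ∞ (dz u) s := by
  have h : ContDiffOn ℝ ∞ (fderiv ℝ u) s := hu.fderiv_of_isOpen hs le_rfl
  exact contDiffOn_const.mul ((h.clm_apply contDiffOn_const).sub
    (contDiffOn_const.mul (h.clm_apply contDiffOn_const)))

lemma ContDiffOn.dbar (hs : IsOpen s) (hu : ContDiffOn ℝ ∞ u s) : ContDiffOn ℝ ∞ (dbar u) s := by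
  have h : ContDiffOn ℝ ∞ (fderiv ℝ u) s := hu.fderiv_of_isOpen hs le_rfl
  exact contDiffOn_const.mul ((h.clm_apply contDiffOn_const).add
    (contDiffOn_const.mul (h.clm_apply contDiffOn_const)))

lemma ContDiff.dz (hu : ContDiff ℝ ∞ u) : ContDiff ℝ ∞ (dz u) := by
  rw [← contDiffOn_univ] at *; exact hu.dz isOpen_univ

lemma ContDiff.dbar (hu : ContDiff ℝ ∞ u) : ContDiff ℝ ∞ (dbar u) := by
  rw [← contDiffOn_univ] at *; exact hu.dbar isOpen_univ

lemma ContDiff.diffAt (hu : ContDiff ℝ ∞ u) (z : ℂ) : DifferentiableAt ℝ u z :=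
  hu.differentiable (by simp) z

lemma ContDiffOn.diffAt (hs : IsOpen s) (hu : ContDiffOn ℝ ∞ u s) {z : ℂ} (hz : z ∈ s) :
    DifferentiableAt ℝ u z :=
  (hu.differentiableOn (by simp)).differentiableAt (hs.mem_nhds hz)

lemma HasCompactSupport.dz (hu : HasCompactSupport u) : HasCompactSupport (dz u) := by
  have h := hu.fderiv (𝕜 := ℝ)
  refine h.mono' ?_
  intro z hz
  refine subset_tsupport _ ?_
  intro h0
  apply hz
  simp [_root_.dz, h0]

lemma HasCompactSupport.dbar (hu : HasCompactSupport u) : HasCompactSupport (dbar u) := by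
  have h := hu.fderiv (𝕜 := ℝ)
  refine h.mono' ?_
  intro z hz
  refine subset_tsupport _ ?_
  intro h0
  apply hz
  simp [_root_.dbar, h0]

lemma tsupport_dz_subset (u : ℂ → ℂ) : tsupport (dz u) ⊆ tsupport u := by
  refine (closure_mono ?_).trans (tsupport_fderiv_subset ℝ (f := u))
  intro z hz h0
  apply hz
  simp [dz, h0]

lemma tsupport_dbar_subset (u : ℂ → ℂ) : tsupport (dbar u) ⊆ tsupport u := by
  refine (closure_mono ?_).trans (tsupport_fderiv_subset ℝ (f := u))
  intro z hz h0
  apply hz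
  simp [dbar, h0]

lemma dz_dbar_comm (hu : ContDiff ℝ ∞ u) (z : ℂ) : dz (dbar u) z = dbar (dz u) z := by
  have h2 : DifferentiableAt ℝ (fderiv ℝ u) z :=
    ((hu.fderiv_right (m := ∞) le_rfl).differentiable (by simp)) z
  have hsym : ∀ v w, fderiv ℝ (fderiv ℝ u) z v w = fderiv ℝ (fderiv ℝ u) z w v := by
    have : IsSymmSndFDerivAt ℝ u z := by
      apply (hu.contDiffAt (x := z)).isSymmSndFDerivAt
      simpa using WithTop.coe_le_coe.2 (le_top : (2 : ℕ∞) ≤ ⊤)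
    exact this
  have key : ∀ w v, fderiv ℝ (fun x => fderiv ℝ u x w) z v = fderiv ℝ (fderiv ℝ u) z v w := by
    intro w v
    rw [fderiv_clm_apply h2 (differentiableAt_const w)]; simp
  have hd : ∀ w, DifferentiableAt ℝ (fun x => fderiv ℝ u x w) z := fun w =>
    h2.clm_apply (differentiableAt_const w)
  have e1 : ∀ v, fderiv ℝ (dbar u) z v = (1 / 2) * (fderiv ℝ (fderiv ℝ u) z v 1
      + I * fderiv ℝ (fderiv ℝ u) z v I) := by
    intro v
    have : dbar u = fun z => (1 / 2 : ℂ) * (fderiv ℝ u z 1 + I * fderiv ℝ u z I) := rfl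
    have h := ((hd 1).hasFDerivAt.fun_add ((hd I).hasFDerivAt.const_mul I)).const_mul (1 / 2)
    rw [this, h.fderiv]
    simp [key]; try ring
  have e2 : ∀ v, fderiv ℝ (dz u) z v = (1 / 2) * (fderiv ℝ (fderiv ℝ u) z v 1
      - I * fderiv ℝ (fderiv ℝ u) z v I) := by
    intro v
    have : dz u = fun z => (1 / 2 : ℂ) * (fderiv ℝ u z 1 - I * fderiv ℝ u z I) := rfl
    have h := ((hd 1).hasFDerivAt.fun_sub ((hd I).hasFDerivAt.const_mul I)).const_mul (1 / 2)
    rw [this, h.fderiv]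
    simp [key]; try ring
  rw [dz, dbar, e1, e1, e2, e2, hsym I 1]
  ring

end smooth

section ibp
variable {u v : ℂ → ℂ}

lemma integral_dbar_eq_zero (hu : ContDiff ℝ ∞ u) (hc : HasCompactSupport u) :
    ∫ z, dbar u z = 0 ∧ ∫ z, dz u z = 0 := by
  have hcont : Continuous (fderiv ℝ u) := hu.continuous_fderiv (by simp)
  have hintg : ∀ v, Integrable (fun z => fderiv ℝ u z v) := fun v =>
    (hcont.clm_apply continuous_const).integrable_of_hasCompactSupport (hc.fderiv_apply (𝕜 := ℝ) v)
  have h0 : ∀ v, ∫ z, fderiv ℝ u z v = 0 := by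
    intro v
    have := integral_smul_fderiv_eq_neg_fderiv_smul_of_integrable (μ := volume) (𝕜 := ℝ) (v := v)
      (f := fun _ : ℂ => (1 : ℝ)) (g := u) (by simp) (by simpa using hintg v)
      (by simpa using hu.continuous.integrable_of_hasCompactSupport hc)
      (fun x _ => differentiableAt_const _) (fun x _ => hu.diffAt x)
    simpa using this
  constructor
  · simp only [dbar]
    rw [integral_const_mul, integral_add (hintg _) ((hintg _).const_mul _), integral_const_mul,
      h0, h0]; simp
  · simp only [dz]
    rw [integral_const_mul, integral_sub (hintg _) ((hintg _).const_mul _), integral_const_mul,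
      h0, h0]; simp

lemma integral_mul_dbar (hu : ContDiff ℝ ∞ u) (hv : ContDiff ℝ ∞ v) (hc : HasCompactSupport v) :
    ∫ z, u z * dbar v z = -∫ z, dbar u z * v z := by
  have h := (integral_dbar_eq_zero (hu.mul hv) (hc.mul_left)).1
  have e : dbar (fun x => u x * v x) = fun z => dbar u z * v z + u z * dbar v z :=
    funext fun z => dbar_mul (hu.diffAt z) (hv.diffAt z)
  have i1 : Integrable (fun z => dbar u z * v z) :=
    (hu.dbar.continuous.mul hv.continuous).integrable_of_hasCompactSupport hc.mul_left
  have i2 : Integrable (fun z => u z * dbar v z) :=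
    (hu.continuous.mul hv.dbar.continuous).integrable_of_hasCompactSupport hc.dbar.mul_left
  have h' := integral_add i1 i2
  rw [e] at h
  linear_combination -h' + h

lemma integral_mul_dz (hu : ContDiff ℝ ∞ u) (hv : ContDiff ℝ ∞ v) (hc : HasCompactSupport v) :
    ∫ z, u z * dz v z = -∫ z, dz u z * v z := by
  have h := (integral_dbar_eq_zero (hu.mul hv) (hc.mul_left)).2
  have e : dz (fun x => u x * v x) = fun z => dz u z * v z + u z * dz v z :=
    funext fun z => dz_mul (hu.diffAt z) (hv.diffAt z)
  have i1 : Integrable (fun z => dz u z * v z) :=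
    (hu.dz.continuous.mul hv.continuous).integrable_of_hasCompactSupport hc.mul_left
  have i2 : Integrable (fun z => u z * dz v z) :=
    (hu.continuous.mul hv.dz.continuous).integrable_of_hasCompactSupport hc.dz.mul_left
  have h' := integral_add i1 i2
  rw [e] at h
  linear_combination -h' + h

/-- The Beurling-type identity `∫ ∂̄u ∂v = ∫ ∂u ∂̄v`. -/
lemma integral_dbar_mul_dz (hu : ContDiff ℝ ∞ u) (hv : ContDiff ℝ ∞ v)
    (hc : HasCompactSupport v) :
    ∫ z, dbar u z * dz v z = ∫ z, dz u z * dbar v z := by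
  rw [integral_mul_dz hu.dbar hv hc, integral_mul_dbar hu.dz hv hc]
  simp only [dz_dbar_comm hu]

end ibp

/-- A smooth radial probability kernel supported in a disc of given radius; it reproduces
holomorphic functions. -/
lemma exists_meanValue_kernel {r : ℝ} (hr : 0 < r) :
    ∃ η : ℂ → ℂ, ContDiff ℝ ∞ η ∧ HasCompactSupport η ∧ tsupport η ⊆ ball 0 r ∧
      (∀ w, conj (η w) = η w) ∧ (∀ w, η (-w) = η w) ∧
      ∀ (h : ℂ → ℂ) (z : ℂ), DifferentiableOn ℂ h (ball z r) →
        ∫ w, η (z - w) * h w = h z := by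
  set e : ℂ → ℝ := fun w => Real.smoothTransition (1 - 4 / r ^ 2 * ‖w‖ ^ 2) with he
  have hes : ContDiff ℝ ∞ e := Real.smoothTransition.contDiff.comp
    (contDiff_const.sub (contDiff_const.mul (contDiff_norm_sq ℝ)))
  have he0 : ∀ w, 0 ≤ e w := fun w => Real.smoothTransition.nonneg _
  have hsupp : tsupport e ⊆ closedBall 0 (r / 2) := by
    refine closure_minimal ?_ isClosed_closedBall
    intro w hw
    by_contra hcon
    apply hw
    simp only [mem_closedBall, dist_zero_right, not_le] at hcon
    apply Real.smoothTransition.zero_of_nonpos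
    have : (r / 2) ^ 2 ≤ ‖w‖ ^ 2 := by gcongr
    have h2 : 4 / r ^ 2 * (r / 2) ^ 2 = 1 := by field_simp; norm_num
    have h3 : 4 / r ^ 2 * (r / 2) ^ 2 ≤ 4 / r ^ 2 * ‖w‖ ^ 2 := by gcongr
    linarith
  have hec : HasCompactSupport e := HasCompactSupport.of_support_subset_isCompact
    (isCompact_closedBall 0 (r / 2)) ((subset_tsupport e).trans hsupp)
  have hpos : 0 < ∫ w, e w := by
    rw [integral_pos_iff_support_of_nonneg he0 (hes.continuous.integrable_of_hasCompactSupport hec)]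
    exact (hes.continuous.isOpen_support).measure_pos volume ⟨0, by simp [he]⟩
  set c : ℝ := (∫ w, e w)⁻¹
  set η : ℂ → ℂ := fun w => ((c * e w : ℝ) : ℂ) with hη
  have hηs : ContDiff ℝ ∞ η := ofRealCLM.contDiff.comp (contDiff_const.mul hes)
  have hsub : Function.support η ⊆ Function.support e := by
    intro w hw h0
    apply hw
    simp [hη, h0]
  have hηsupp : tsupport η ⊆ closedBall 0 (r / 2) := (closure_mono hsub).trans hsupp
  have hηc : HasCompactSupport η := HasCompactSupport.of_support_subset_isCompact
    (isCompact_closedBall 0 (r / 2)) ((subset_tsupport η).trans hηsupp)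
  have hintg : ∫ w, η w = 1 := by
    rw [hη, integral_complex_ofReal, integral_const_mul, inv_mul_cancel₀ hpos.ne']; simp
  have hrad : ∀ w v : ℂ, ‖w‖ = ‖v‖ → η w = η v := by
    intro w v h; simp [hη, he, h]
  have hball : closedBall (0 : ℂ) (r / 2) ⊆ ball 0 r := closedBall_subset_ball (by linarith)
  refine ⟨η, hηs, hηc, hηsupp.trans hball, fun w => by simp [hη], fun w => hrad _ _ (norm_neg _),
    fun h z hh => ?_⟩
  set g : ℂ → ℂ := fun w => h (z - w) with hg
  have hgd : DifferentiableOn ℂ g (ball 0 r) := by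
    refine hh.comp ((differentiable_const z).sub differentiable_id).differentiableOn ?_
    intro w hw
    simpa [dist_eq] using hw
  have h1 : ∫ w, η (z - w) * h w = ∫ w, η w * g w := by
    rw [← integral_sub_left_eq_self (fun w => η w * g w) volume z]
    simp [hg]
  have hrot : ∀ θ : ℝ, ∫ w, η w * g (circleMap 0 1 θ * w) = ∫ w, η w * g w := by
    intro θ
    set a : Circle := Circle.exp θ
    have hmp := (rotation a).measurePreserving
    have := hmp.integral_comp (rotation a).toHomeomorph.measurableEmbedding (fun w => η w * g w)
    rw [← this]
    congr 1; ext w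
    rw [rotation_apply]
    congr 1
    · apply hrad; rw [norm_mul, Circle.norm_coe, one_mul]
    · simp [a, circleMap]
  have hzero : ∀ w, w ∉ closedBall (0 : ℂ) (r / 2) → η w = 0 := fun w hw =>
    image_eq_zero_of_notMem_tsupport fun h => hw (hηsupp h)
  have hset : ∀ F : ℂ → ℂ, ∫ w, η w * F w = ∫ w in closedBall (0 : ℂ) (r / 2), η w * F w := by
    intro F
    rw [setIntegral_eq_integral_of_forall_compl_eq_zero]
    intro w hw
    simp [hzero w hw]
  have hmean : ∀ w ∈ closedBall (0 : ℂ) (r / 2),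
      ∫ θ in (0 : ℝ)..2 * Real.pi, η w * g (circleMap 0 1 θ * w) = 2 * Real.pi * (η w * g 0) := by
    intro w hw
    rw [intervalIntegral.integral_const_mul]
    have hd : DifferentiableOn ℂ (fun ζ => g (ζ * w)) (closedBall 0 1) := by
      refine hgd.comp (differentiable_id.mul_const w).differentiableOn ?_
      intro ζ hζ
      apply hball
      simp only [mem_closedBall, dist_zero_right] at hζ hw ⊢
      rw [norm_mul]
      nlinarith [norm_nonneg w]
    have := DiffContOnCl.circleAverage (f := fun ζ => g (ζ * w)) (c := 0) (R := 1)
      (DifferentiableOn.diffContOnCl (by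
        rw [abs_one, closure_ball (0 : ℂ) one_ne_zero]; exact hd))
    rw [Real.circleAverage_def] at this
    simp only [zero_mul] at this
    have hp : (2 * Real.pi : ℝ) ≠ 0 := by positivity
    have hp' : (2 * Real.pi : ℂ) ≠ 0 := by exact_mod_cast hp
    rw [← this, Complex.real_smul]
    push_cast
    rw [mul_left_comm (η w), mul_inv_cancel_left₀ hp']
  have hcont : ContinuousOn (fun p : ℝ × ℂ => η p.2 * g (circleMap 0 1 p.1 * p.2))
      (Icc 0 (2 * Real.pi) ×ˢ closedBall (0 : ℂ) (r / 2)) := by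
    refine (hηs.continuous.comp continuous_snd).continuousOn.mul ?_
    refine hgd.continuousOn.comp ?_ ?_
    · exact (((continuous_circleMap 0 1).comp continuous_fst).mul continuous_snd).continuousOn
    · rintro ⟨θ, w⟩ ⟨-, hw⟩
      apply hball
      simpa using hw
  have hfub : ∫ θ in Icc 0 (2 * Real.pi), ∫ w in closedBall (0 : ℂ) (r / 2),
        η w * g (circleMap 0 1 θ * w) =
      ∫ w in closedBall (0 : ℂ) (r / 2), ∫ θ in Icc 0 (2 * Real.pi),
        η w * g (circleMap 0 1 θ * w) := by
    apply integral_integral_swap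
    rw [Measure.prod_restrict]
    exact hcont.integrableOn_compact (isCompact_Icc.prod (isCompact_closedBall _ _))
  have hpi : (0 : ℝ) ≤ 2 * Real.pi := by positivity
  have hL : ∫ θ in Icc 0 (2 * Real.pi), ∫ w in closedBall (0 : ℂ) (r / 2),
        η w * g (circleMap 0 1 θ * w) = 2 * Real.pi * ∫ w, η w * g w := by
    simp_rw [← hset (fun w => g (circleMap 0 1 _ * w)), hrot]
    rw [setIntegral_const]
    simp [hpi]
  have hR : ∫ w in closedBall (0 : ℂ) (r / 2), ∫ θ in Icc 0 (2 * Real.pi),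
        η w * g (circleMap 0 1 θ * w) = 2 * Real.pi * g 0 := by
    have : ∀ w ∈ closedBall (0 : ℂ) (r / 2), ∫ θ in Icc 0 (2 * Real.pi),
        η w * g (circleMap 0 1 θ * w) = 2 * Real.pi * (η w * g 0) := by
      intro w hw
      rw [← hmean w hw, intervalIntegral.integral_of_le hpi, integral_Icc_eq_integral_Ioc]
    rw [setIntegral_congr_fun measurableSet_closedBall this, integral_const_mul,
      ← hset (fun _ => g 0), integral_mul_const, hintg, one_mul]
  rw [hL, hR] at hfub
  have hp' : (2 * Real.pi : ℂ) ≠ 0 := by simp [Real.pi_ne_zero]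
  rw [h1, mul_left_cancel₀ hp' hfub]
  simp [hg]

/-- Convolution of an integrable function with a smooth kernel. -/
def smear (f φ : ℂ → ℂ) (z : ℂ) : ℂ := ∫ w, f w * φ (z - w)

section smear
open scoped Convolution
variable {f φ : ℂ → ℂ}

lemma smear_eq : smear f φ = (f ⋆[ContinuousLinearMap.mul ℝ ℂ] φ) := rfl

lemma contDiff_smear (hf : LocallyIntegrable f) (hφ : ContDiff ℝ ∞ φ) (hc : HasCompactSupport φ) :
    ContDiff ℝ ∞ (smear f φ) :=
  hc.contDiff_convolution_right (n := ⊤) (ContinuousLinearMap.mul ℝ ℂ) hf hφ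

lemma dbar_smear (hf : LocallyIntegrable f) (hφ : ContDiff ℝ ∞ φ) (hc : HasCompactSupport φ)
    (z : ℂ) : dbar (smear f φ) z = ∫ w, f w * dbar φ (z - w) := by
  have h := hc.hasFDerivAt_convolution_right (ContinuousLinearMap.mul ℝ ℂ) hf
    (hφ.of_le (by simp)) z
  have key : ∀ v, fderiv ℝ (smear f φ) z v = ∫ w, f w * fderiv ℝ φ (z - w) v := by
    intro v
    rw [smear_eq, h.fderiv, convolution_precompR_apply _ hf (hc.fderiv (𝕜 := ℝ))
      (hφ.continuous_fderiv (by simp))]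
    rfl
  have hi : ∀ v, Integrable (fun w => f w * fderiv ℝ φ (z - w) v) := by
    intro v
    have hcv : HasCompactSupport (fun a => fderiv ℝ φ a v) := hc.fderiv_apply (𝕜 := ℝ) v
    exact (hcv.convolutionExists_right (ContinuousLinearMap.mul ℝ ℂ) hf
      ((hφ.continuous_fderiv (by simp)).clm_apply continuous_const) z)
  rw [dbar, key, key, ← integral_const_mul, ← integral_add (hi _) ((hi _).const_mul _),
    ← integral_const_mul]
  congr 1; ext w
  rw [dbar]; ring

lemma dbar_comp_sub (hφ : ContDiff ℝ ∞ φ) (z w : ℂ) :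
    dbar (fun w => φ (z - w)) w = -dbar φ (z - w) := by
  have h1 : HasFDerivAt (fun w : ℂ => z - w) (wirt (-1) 0) w :=
    ((hasDerivAt_id w).const_sub z).hasWirt
  have h2 := ((hφ.diffAt (z - w)).hasWirt (u := φ)).wirt_comp (v := fun w => z - w) h1
  rw [h2.wirt_eq.2]; simp

lemma hasCompactSupport_comp_sub (hc : HasCompactSupport φ) (z : ℂ) :
    HasCompactSupport (fun w => φ (z - w)) :=
  hc.comp_homeomorph (Homeomorph.subLeft z)

lemma tsupport_comp_sub_subset {r : ℝ} (hs : tsupport φ ⊆ ball 0 r) (z : ℂ) :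
    tsupport (fun w => φ (z - w)) ⊆ ball z r := by
  have : tsupport (φ ∘ Homeomorph.subLeft z) = Homeomorph.subLeft z ⁻¹' tsupport φ :=
    tsupport_comp_eq_preimage φ (Homeomorph.subLeft z)
  intro w hw
  have hw' : w ∈ tsupport (φ ∘ Homeomorph.subLeft z) := hw
  rw [this] at hw'
  have := hs hw'
  simpa [dist_eq, norm_sub_rev] using this

/-- `f` is weakly holomorphic on `U`. -/
def WeakHolo (f : ℂ → ℂ) (U : Set ℂ) : Prop :=
  ∀ ψ : ℂ → ℂ, ContDiff ℝ ∞ ψ → HasCompactSupport ψ → tsupport ψ ⊆ U → ∫ z, f z * dbar ψ z = 0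

lemma WeakHolo.mono {U V : Set ℂ} (h : WeakHolo f U) (hVU : V ⊆ U) : WeakHolo f V :=
  fun ψ h1 h2 h3 => h ψ h1 h2 (h3.trans hVU)

lemma WeakHolo.dbar_smear {U : Set ℂ} (h : WeakHolo f U) (hf : LocallyIntegrable f)
    (hφ : ContDiff ℝ ∞ φ) (hc : HasCompactSupport φ) {r : ℝ} (hs : tsupport φ ⊆ ball 0 r) {z : ℂ}
    (hz : ball z r ⊆ U) : dbar (smear f φ) z = 0 := by
  rw [_root_.dbar_smear hf hφ hc]
  have := h (fun w => φ (z - w)) (hφ.comp (contDiff_const.sub contDiff_id))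
    (hasCompactSupport_comp_sub hc z) ((tsupport_comp_sub_subset hs z).trans hz)
  simp only [dbar_comp_sub hφ, mul_neg, integral_neg, neg_eq_zero] at this
  exact this

lemma WeakHolo.differentiableAt_smear {U : Set ℂ} (h : WeakHolo f U) (hf : LocallyIntegrable f)
    (hφ : ContDiff ℝ ∞ φ) (hc : HasCompactSupport φ) {r : ℝ} (hs : tsupport φ ⊆ ball 0 r) {z : ℂ}
    (hz : ball z r ⊆ U) : DifferentiableAt ℂ (smear f φ) z :=
  differentiableAt_of_dbar ((contDiff_smear hf hφ hc).diffAt z) (h.dbar_smear hf hφ hc hs hz)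

lemma smear_smear_bump (hf : Integrable f) (hφ : ContDiff ℝ ∞ φ) (hc : HasCompactSupport φ)
    (b : ContDiffBump (0 : ℂ)) (x : ℂ) :
    ∫ w, φ (x - w) * (b.normed volume ⋆[ContinuousLinearMap.lsmul ℝ ℝ] f) w =
      (b.normed volume ⋆[ContinuousLinearMap.lsmul ℝ ℝ] smear f φ) x := by
  have hb : Integrable (b.normed volume) := b.integrable_normed
  have h1 := Integrable.convolution_integrand (ContinuousLinearMap.lsmul ℝ ℝ) hb hf
  obtain ⟨C, hC⟩ := hc.exists_bound_of_continuous hφ.continuous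
  have h2 : Integrable (fun p : ℂ × ℂ => φ (x - p.1) *
      (ContinuousLinearMap.lsmul ℝ ℝ (b.normed volume p.2) (f (p.1 - p.2))))
      (volume.prod volume) := by
    refine h1.bdd_mul (c := C) ?_ ?_
    · exact (hφ.continuous.comp (continuous_const.sub continuous_fst)).aestronglyMeasurable
    · exact Filter.Eventually.of_forall fun p => hC _
  have h3 := integral_integral_swap (f := fun w t => φ (x - w) *
      (ContinuousLinearMap.lsmul ℝ ℝ (b.normed volume t) (f (w - t)))) h2
  simp only [convolution_def]
  simp only [integral_const_mul] at h3
  rw [h3]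
  congr 1; ext t
  simp only [ContinuousLinearMap.lsmul_apply, smear]
  simp only [mul_smul_comm]
  rw [integral_smul, ← integral_add_right_eq_self _ t]
  congr 2; ext w
  rw [mul_comm]; congr 2 <;> ring_nf

/-- Local form of Weyl's lemma. -/
lemma WeakHolo.ae_eq_smear {U : Set ℂ} (h : WeakHolo f U) (hf : Integrable f) {r : ℝ} {η : ℂ → ℂ}
    (hη : ContDiff ℝ ∞ η) (hc : HasCompactSupport η)
    (hm : ∀ (h : ℂ → ℂ) (z : ℂ), DifferentiableOn ℂ h (ball z r) → ∫ w, η (z - w) * h w = h z)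
    (hr : 0 < r) :
    ∀ᵐ x, ball x (2 * r) ⊆ U → f x = smear f η x := by
  let φ : ℕ → ContDiffBump (0 : ℂ) := fun n =>
    ⟨r / (n + 2) / 2, r / (n + 2), by positivity, half_lt_self (by positivity)⟩
  have hφ : Filter.Tendsto (fun n => (φ n).rOut) Filter.atTop (𝓝 0) := by
    have := tendsto_const_div_atTop_nhds_zero_nat r
    exact ((Filter.tendsto_add_atTop_iff_nat 2).2 this).congr fun n => by simp [φ]
  have hae := ContDiffBump.ae_convolution_tendsto_right_of_locallyIntegrable (μ := volume) (K := 2)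
    hφ (Filter.Eventually.of_forall fun n => by simp only [φ]; linarith) hf.locallyIntegrable
  filter_upwards [hae] with x hx hxU
  have h2 := ContDiffBump.convolution_tendsto_right_of_continuous (μ := volume)
    hφ (contDiff_smear hf.locallyIntegrable hη hc).continuous x
  refine tendsto_nhds_unique hx (h2.congr fun n => ?_)
  rw [← smear_smear_bump hf hη hc]
  apply hm
  have hsm : ((φ n).normed volume ⋆[ContinuousLinearMap.lsmul ℝ ℝ] f) =
      smear f (fun w => (((φ n).normed volume w : ℝ) : ℂ)) := by
    ext z
    rw [convolution_def, smear, ← integral_sub_left_eq_self _ volume z]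
    congr 1; ext w
    simp [mul_comm]
  have hsub : Function.support (fun w => (((φ n).normed volume w : ℝ) : ℂ)) ⊆
      Function.support ((φ n).normed volume) := by
    intro w hw h0; apply hw; simp [h0]
  have hts : tsupport (fun w => (((φ n).normed volume w : ℝ) : ℂ)) ⊆
      tsupport ((φ n).normed volume) := closure_mono hsub
  rw [hsm]
  intro z hz
  refine (h.differentiableAt_smear (r := r) hf.locallyIntegrable
    (ofRealCLM.contDiff.comp (φ n).contDiff_normed)
    ((φ n).hasCompactSupport_normed.mono hsub) ?_ ?_).differentiableWithinAt
  · refine hts.trans ?_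
    rw [(φ n).tsupport_normed_eq]
    apply closedBall_subset_ball
    simp only [φ]
    rw [div_lt_iff₀ (by positivity)]
    nlinarith [(Nat.cast_nonneg n : (0 : ℝ) ≤ n)]
  · refine subset_trans ?_ hxU
    apply ball_subset
    rw [mem_ball] at hz
    rw [dist_comm] at hz
    rw [dist_comm]
    linarith

/-- Weyl's lemma for the Cauchy-Riemann operator. -/
theorem WeakHolo.exists_holo {U : Set ℂ} (h : WeakHolo f U) (hU : IsOpen U) (hf : Integrable f) :
    ∃ g : ℂ → ℂ, DifferentiableOn ℂ g U ∧ ∀ᵐ z, z ∈ U → f z = g z := by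
  have hloc : ∀ x : ℂ, x ∈ U → ∃ (ε : ℝ) (g : ℂ → ℂ), 0 < ε ∧ ball x ε ⊆ U ∧
      DifferentiableOn ℂ g (ball x ε) ∧ ∀ᵐ z, z ∈ ball x ε → f z = g z := by
    intro x hx
    obtain ⟨r, hr, hrU⟩ := Metric.isOpen_iff.1 hU x hx
    obtain ⟨η, h1, h2, h3, -, -, h4⟩ := exists_meanValue_kernel (r := r / 4) (by positivity)
    have hb : ∀ z ∈ ball x (r / 2), ball z (r / 2) ⊆ ball x r := by
      intro z hz
      apply ball_subset
      rw [mem_ball] at hz; linarith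
    refine ⟨r / 2, smear f η, by positivity, (ball_subset_ball (by linarith)).trans hrU, ?_, ?_⟩
    · intro z hz
      refine (h.differentiableAt_smear hf.locallyIntegrable h1 h2 h3
        (((ball_subset_ball (by linarith)).trans (hb z hz)).trans hrU)).differentiableWithinAt
    · filter_upwards [h.ae_eq_smear hf h1 h2 h4 (by positivity)] with z hz hzx
      apply hz
      refine subset_trans ?_ ((hb z hzx).trans hrU)
      apply ball_subset_ball; linarith
  choose! ε G hε hεU hG hae using hloc
  have heq : ∀ x ∈ U, EqOn (fun z => G z z) (G x) (ball x (ε x)) := by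
    intro x hx z hz
    have hzU := hεU x hx hz
    have : EqOn (G z) (G x) (ball x (ε x) ∩ ball z (ε z)) := by
      refine Measure.eqOn_open_of_ae_eq (μ := volume) ?_ (isOpen_ball.inter isOpen_ball)
        ((hG z hzU).continuousOn.mono inter_subset_right)
        ((hG x hx).continuousOn.mono inter_subset_left)
      rw [Filter.EventuallyEq, ae_restrict_iff' (isOpen_ball.inter isOpen_ball).measurableSet]
      filter_upwards [hae x hx, hae z hzU] with w h1 h2 hw
      rw [← h1 hw.1, ← h2 hw.2]
    exact this ⟨hz, mem_ball_self (hε z hzU)⟩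
  refine ⟨fun z => G z z, ?_, ?_⟩
  · intro x hx
    refine DifferentiableAt.differentiableWithinAt ?_
    have h1 : ball x (ε x) ∈ 𝓝 x := ball_mem_nhds x (hε x hx)
    refine ((hG x hx).differentiableAt h1).congr_of_eventuallyEq ?_
    filter_upwards [h1] with z hz using heq x hx hz
  · have : volume {z | z ∈ U ∧ f z ≠ G z z} = 0 := by
      refine measure_null_of_locally_null _ fun x hx => ?_
      refine ⟨ball x (ε x) ∩ {z | z ∈ U ∧ f z ≠ G z z}, ?_, ?_⟩
      · rw [inter_comm]
        exact inter_mem_nhdsWithin _ (ball_mem_nhds x (hε x hx.1))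
      · have := hae x hx.1
        rw [ae_iff] at this
        refine measure_mono_null ?_ this
        rintro z ⟨hz, -, hne⟩ hcon
        apply hne
        rw [hcon hz]; exact (heq x hx.1 hz).symm
    rw [ae_iff]
    convert this using 2
    ext z; simp

end smear

/-- Point evaluations on the Bergman space are bounded. -/
lemma exists_norm_sq_le_integral {r : ℝ} (hr : 0 < r) : ∃ C : ℝ, 0 < C ∧ ∀ (h : ℂ → ℂ) (z : ℂ),
    DifferentiableOn ℂ h (ball z r) → IntegrableOn (fun w => ‖h w‖ ^ 2) (ball z r) →
    ‖h z‖ ^ 2 ≤ C * ∫ w in ball z r, ‖h w‖ ^ 2 := by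
  obtain ⟨η, h1, h2, h3, -, -, h4⟩ := exists_meanValue_kernel hr
  obtain ⟨C, hC⟩ := h2.exists_bound_of_continuous h1.continuous
  refine ⟨|C| + 1, by positivity, fun h z hd hi => ?_⟩
  have hm := h4 (fun w => h w ^ 2) z (hd.pow 2)
  have hz : ∫ w, η (z - w) * h w ^ 2 = ∫ w in ball z r, η (z - w) * h w ^ 2 := by
    rw [setIntegral_eq_integral_of_forall_compl_eq_zero]
    intro w hw
    rw [image_eq_zero_of_notMem_tsupport (f := η), zero_mul]
    intro hh
    apply hw
    simpa [dist_eq, norm_sub_rev] using h3 hh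
  rw [← norm_pow, ← hm, hz, ← integral_const_mul]
  refine norm_integral_le_of_norm_le (hi.const_mul _) (Filter.Eventually.of_forall fun w => ?_)
  rw [norm_mul, norm_pow]
  gcongr
  exact (hC _).trans (by linarith [le_abs_self C])

/-! ### Series of dilates of a smooth function with bounded derivatives -/

/-- The functional `L ↦ (L 1 - i L i) / 2`, extracting `dz` from a Fréchet derivative. -/
def dzCLM : (ℂ →L[ℝ] ℂ) →L[ℝ] ℂ :=
  (1 / 2 : ℝ) • (ContinuousLinearMap.apply ℝ ℂ (1 : ℂ) -
    (ContinuousLinearMap.mul ℝ ℂ I).comp (ContinuousLinearMap.apply ℝ ℂ I))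

/-- The functional `L ↦ (L 1 + i L i) / 2`, extracting `dbar` from a Fréchet derivative. -/
def dbarCLM : (ℂ →L[ℝ] ℂ) →L[ℝ] ℂ :=
  (1 / 2 : ℝ) • (ContinuousLinearMap.apply ℝ ℂ (1 : ℂ) +
    (ContinuousLinearMap.mul ℝ ℂ I).comp (ContinuousLinearMap.apply ℝ ℂ I))

lemma dzCLM_fderiv (u : ℂ → ℂ) (z : ℂ) : dzCLM (fderiv ℝ u z) = dz u z := by
  simp [dzCLM, dz]

lemma dbarCLM_fderiv (u : ℂ → ℂ) (z : ℂ) : dbarCLM (fderiv ℝ u z) = dbar u z := by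
  simp [dbarCLM, dbar, mul_add]

/-- `u` is smooth with all derivatives bounded; `C j` bounds the `j`-th one. -/
def BddDerivs (u : ℂ → ℂ) (C : ℕ → ℝ) : Prop :=
  ContDiff ℝ ∞ u ∧ ∀ j z, ‖iteratedFDeriv ℝ j u z‖ ≤ C j

section series
variable {ι : Type*} {a b : ι → ℂ} {l : ι → ℂ} {Φ : ℂ → ℂ} {C : ℕ → ℝ}

/-- The series `∑ aᵢ Φ(lᵢ z)`. -/
def dser (a l : ι → ℂ) (Φ : ℂ → ℂ) (z : ℂ) : ℂ := ∑' i, a i * Φ (l i * z)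

/-- Decay of coefficients faster than every power of the frequencies. -/
def Rapid (a l : ι → ℂ) : Prop := ∀ k : ℕ, Summable fun i => ‖a i‖ * ‖l i‖ ^ k

lemma Rapid.mul_freq (h : Rapid a l) : Rapid (fun i => a i * l i) l := fun k => by
  refine (h (k + 1)).congr fun i => ?_
  rw [norm_mul]; ring

lemma contDiff_dil (hΦ : ContDiff ℝ ∞ Φ) (a l : ℂ) : ContDiff ℝ ∞ fun z => a * Φ (l * z) :=
  contDiff_const.mul (hΦ.comp (contDiff_const.mul contDiff_id))

lemma norm_iteratedFDeriv_dil (hΦ : ContDiff ℝ ∞ Φ) (a l : ℂ) (j : ℕ) (z : ℂ) :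
    ‖iteratedFDeriv ℝ j (fun z => a * Φ (l * z)) z‖ ≤
      ‖a‖ * ‖l‖ ^ j * ‖iteratedFDeriv ℝ j Φ (l * z)‖ := by
  have h1 : (fun z => a * Φ (l * z)) = a • (Φ ∘ (ContinuousLinearMap.mul ℝ ℂ l)) := by
    ext z; simp
  have hj : ((j : ℕ) : ℕ∞ω) ≤ ∞ := by exact_mod_cast le_top
  rw [h1, iteratedFDeriv_const_smul_apply, norm_smul,
    ContinuousLinearMap.iteratedFDeriv_comp_right _ hΦ z hj, mul_assoc]
  · gcongr
    refine (ContinuousMultilinearMap.norm_compContinuousLinearMap_le _ _).trans ?_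
    rw [Finset.prod_const, Finset.card_univ, Fintype.card_fin, mul_comm]
    have : ‖ContinuousLinearMap.mul ℝ ℂ l‖ ≤ ‖l‖ := ContinuousLinearMap.opNorm_mul_apply_le ℝ ℂ l
    gcongr
    simp
  · exact ((hΦ.comp (ContinuousLinearMap.contDiff _)).of_le hj).contDiffAt

lemma dser_term_bound (hΦ : BddDerivs Φ C) (j : ℕ) (i : ι) (z : ℂ) :
    ‖iteratedFDeriv ℝ j (fun z => a i * Φ (l i * z)) z‖ ≤ ‖a i‖ * ‖l i‖ ^ j * C j :=
  (norm_iteratedFDeriv_dil hΦ.1 _ _ _ _).trans (by gcongr; exact hΦ.2 _ _)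

lemma contDiff_dser (h : Rapid a l) (hΦ : BddDerivs Φ C) : ContDiff ℝ ∞ (dser a l Φ) :=
  contDiff_tsum (N := ⊤) (fun _ => contDiff_dil hΦ.1 _ _) (fun k _ => (h k).mul_right (C k))
    (fun k i z _ => dser_term_bound hΦ k i z)

lemma norm_iteratedFDeriv_dser (h : Rapid a l) (hΦ : BddDerivs Φ C) (j : ℕ) (z : ℂ) :
    ‖iteratedFDeriv ℝ j (dser a l Φ) z‖ ≤ (∑' i, ‖a i‖ * ‖l i‖ ^ j) * C j := by
  have := iteratedFDeriv_tsum_apply (𝕜 := ℝ) (N := ⊤) (fun i => contDiff_dil hΦ.1 (a i) (l i))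
    (fun k _ => (h k).mul_right (C k)) (fun k i z _ => dser_term_bound hΦ k i z) (k := j) le_top z
  unfold dser
  rw [this, ← tsum_mul_right]
  exact tsum_of_norm_bounded ((h j).mul_right (C j)).hasSum (fun i => dser_term_bound hΦ j i z)

lemma summable_dser (h : Rapid a l) (hΦ : BddDerivs Φ C) (z : ℂ) : Summable fun i => a i * Φ (l i * z) :=
  .of_norm_bounded ((h 0).mul_right (C 0)) fun i => by
    simpa using dser_term_bound hΦ 0 i z

lemma fderiv_dser (h : Rapid a l) (hΦ : BddDerivs Φ C) (z : ℂ) :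
    HasSum (fun i => fderiv ℝ (fun z => a i * Φ (l i * z)) z) (fderiv ℝ (dser a l Φ) z) := by
  have hb : ∀ i z, ‖fderiv ℝ (fun z => a i * Φ (l i * z)) z‖ ≤ ‖a i‖ * ‖l i‖ ^ 1 * C 1 := fun i z => by
    rw [← norm_iteratedFDeriv_one]; exact dser_term_bound hΦ 1 i z
  have hs := (h 1).mul_right (C 1)
  have := fderiv_tsum_apply (𝕜 := ℝ) hs
    (fun i => (contDiff_dil hΦ.1 (a i) (l i)).differentiable (by simp)) hb
    (summable_dser h hΦ 0) z
  unfold dser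
  rw [this]
  exact (Summable.of_norm_bounded hs fun i => hb i z).hasSum

lemma dz_dser (h : Rapid a l) (hΦ : BddDerivs Φ C) (z : ℂ) : dz (dser a l Φ) z = dser (fun i => a i * l i) l (dz Φ) z := by
  have := ((fderiv_dser h hΦ z).mapL dzCLM).tsum_eq
  rw [dzCLM_fderiv] at this
  rw [← this]
  refine tsum_congr fun i => ?_
  rw [dzCLM_fderiv]
  have h1 := (((hΦ.1.diffAt (l i * z)).hasWirt.wirt_comp
    (((hasDerivAt_id z).const_mul (l i)).hasWirt)))
  have h2 := (hasDerivAt_const z (a i)).hasWirt.wirt_mul h1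
  rw [h2.wirt_eq.1]
  simp; ring

lemma dbar_dser (h : Rapid a l) (hΦ : BddDerivs Φ C) (z : ℂ) : dbar (dser a l Φ) z = dser (fun i => a i * conj (l i)) l (dbar Φ) z := by
  have := ((fderiv_dser h hΦ z).mapL dbarCLM).tsum_eq
  rw [dbarCLM_fderiv] at this
  rw [← this]
  refine tsum_congr fun i => ?_
  rw [dbarCLM_fderiv]
  have h1 := (((hΦ.1.diffAt (l i * z)).hasWirt.wirt_comp
    (((hasDerivAt_id z).const_mul (l i)).hasWirt)))
  have h2 := (hasDerivAt_const z (a i)).hasWirt.wirt_mul h1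
  rw [h2.wirt_eq.2]
  simp; ring

end series

/-! ### Exponentials -/

/-- `e^{i Re z}`. -/
def expRe (z : ℂ) : ℂ := cexp (I * z.re)

lemma expRe_add (z w : ℂ) : expRe (z + w) = expRe z * expRe w := by
  simp only [expRe, ← Complex.exp_add]; congr 1; push_cast [add_re]; ring

lemma expRe_zero : expRe 0 = 1 := by simp [expRe]

lemma norm_expRe (z : ℂ) : ‖expRe z‖ = 1 := by
  rw [expRe, mul_comm]; exact Complex.norm_exp_ofReal_mul_I _

lemma contDiff_cexp_I : ContDiff ℝ ∞ fun t : ℝ => cexp (I * t) :=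
  (contDiff_const.mul ofRealCLM.contDiff).cexp

lemma iteratedDeriv_cexp_I (j : ℕ) :
    iteratedDeriv j (fun t : ℝ => cexp (I * t)) = fun t : ℝ => I ^ j * cexp (I * t) := by
  induction j with
  | zero => simp
  | succ j ih =>
    rw [iteratedDeriv_succ, ih]
    ext t
    have := (((hasDerivAt_id (t : ℂ)).const_mul I).cexp.const_mul (I ^ j)).comp_ofReal
    simp only [id] at this
    rw [this.deriv]; ring

lemma bddDerivs_expRe : BddDerivs expRe fun _ => 1 := by
  have he : expRe = (fun t : ℝ => cexp (I * t)) ∘ reCLM := rfl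
  refine ⟨he ▸ contDiff_cexp_I.comp reCLM.contDiff, fun j z => ?_⟩
  have hj : ((j : ℕ) : ℕ∞ω) ≤ ∞ := by exact_mod_cast le_top
  rw [he, ContinuousLinearMap.iteratedFDeriv_comp_right _ contDiff_cexp_I z hj]
  refine (ContinuousMultilinearMap.norm_compContinuousLinearMap_le _ _).trans ?_
  rw [norm_iteratedFDeriv_eq_norm_iteratedDeriv, iteratedDeriv_cexp_I]
  simp only [norm_mul, norm_pow, norm_I, one_pow, one_mul, reCLM_norm, Finset.prod_const_one, mul_one]
  rw [mul_comm]; exact (Complex.norm_exp_ofReal_mul_I _).le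

lemma expRe_wirt (z : ℂ) : HasFDerivAt expRe (wirt (I / 2 * expRe z) (I / 2 * expRe z)) z := by
  have h1 : HasDerivAt (fun t : ℝ => cexp (I * t)) (cexp (I * z.re) * I) z.re := by
    have := ((hasDerivAt_id ((z.re : ℝ) : ℂ)).const_mul I).cexp.comp_ofReal
    simpa using this
  have h2 : HasFDerivAt expRe _ z := h1.hasFDerivAt.comp z reCLM.hasFDerivAt
  refine h2.to_wirt fun v => ?_
  have : (v.re : ℂ) = (v + conj v) / 2 := by
    rw [add_conj]; push_cast; ring
  simp [this, expRe]; ring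

lemma dz_expRe (z : ℂ) : dz expRe z = I / 2 * expRe z := (expRe_wirt z).wirt_eq.1
lemma dbar_expRe (z : ℂ) : dbar expRe z = I / 2 * expRe z := (expRe_wirt z).wirt_eq.2

/-! ### Sums over words -/

lemma hasSum_list {ι M : Type*} [AddCommMonoid M] [TopologicalSpace M] [ContinuousAdd M]
    {f : List ι → M} {s : M} (h : HasSum (fun p : ι × List ι => f (p.1 :: p.2)) s) :
    HasSum f (f [] + s) := by
  classical
  let g : List ι → M := fun L => if L = [] then 0 else f L
  have hinj : Function.Injective fun p : ι × List ι => p.1 :: p.2 := by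
    rintro ⟨a, L⟩ ⟨b, L'⟩ h; simpa using h
  have hg : HasSum g s := by
    refine (hinj.hasSum_iff ?_).1 (h.congr_fun ?_)
    · rintro (_ | ⟨a, L⟩) hL
      · simp [g]
      · exact absurd ⟨(a, L), rfl⟩ hL
    · intro p; simp [g]
  have := (hasSum_ite_eq ([] : List ι) (f [])).add hg
  refine this.congr_fun ?_
  intro L
  by_cases hL : L = [] <;> simp [g, hL]

lemma hasSum_mul_of_nonneg {ι κ : Type*} {f : ι → ℝ} {g : κ → ℝ} {s t : ℝ} (hf : HasSum f s)
    (hg : HasSum g t) (hf0 : ∀ i, 0 ≤ f i) (hg0 : ∀ i, 0 ≤ g i) :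
    HasSum (fun x : ι × κ => f x.1 * g x.2) (s * t) :=
  HasSum.mul hf hg (Summable.mul_of_nonneg hf.summable hg.summable hf0 hg0)

lemma hasSum_mul_of_norm {ι κ : Type*} {f : ι → ℂ} {g : κ → ℂ} (hf : Summable f)
    (hg : Summable g) :
    HasSum (fun x : ι × κ => f x.1 * g x.2) ((∑' i, f i) * ∑' j, g j) :=
  HasSum.mul hf.hasSum hg.hasSum (summable_mul_of_summable_norm hf.norm hg.norm)

section words
variable {ι : Type*} {g : ι → ℝ}

lemma hasSum_words_trunc (hg : ∀ a, 0 ≤ g a) {q : ℝ} (hq : HasSum g q) (N : ℕ) :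
    HasSum (fun L : List ι => if L.length ≤ N then (L.map g).prod else 0)
      (∑ k ∈ Finset.range (N + 1), q ^ k) := by
  induction N with
  | zero =>
    have := hasSum_list (f := fun L : List ι => if L.length ≤ 0 then (L.map g).prod else 0) (s := 0)
      (by simp [hasSum_zero])
    simpa using this
  | succ N ih =>
    have h0 : ∀ L : List ι, 0 ≤ (if L.length ≤ N then (L.map g).prod else 0) := fun L => by
      split_ifs
      · exact List.prod_nonneg (by simpa using fun a _ => hg a)
      · rfl
    have h1 := hasSum_mul_of_nonneg hq ih hg h0
    have h2 : HasSum (fun p : ι × List ι =>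
        if (p.1 :: p.2).length ≤ N + 1 then ((p.1 :: p.2).map g).prod else 0)
        (q * ∑ k ∈ Finset.range (N + 1), q ^ k) := by
      convert h1 using 2 with p
      simp
    have := hasSum_list (f := fun L : List ι => if L.length ≤ N + 1 then (L.map g).prod else 0) h2
    rw [Finset.sum_range_succ', add_comm (∑ k ∈ Finset.range (N + 1), q ^ (k + 1))]
    simpa [Finset.mul_sum, pow_succ'] using this

lemma summable_words (hg : ∀ a, 0 ≤ g a) {q : ℝ} (hq : HasSum g q) (hq1 : q < 1) :
    HasSum (fun L : List ι => (L.map g).prod) (1 / (1 - q)) := by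
  have hq0 : 0 ≤ q := hq.nonneg hg
  have hp : ∀ L : List ι, 0 ≤ (L.map g).prod := fun L =>
    List.prod_nonneg (by simpa using fun a _ => hg a)
  have hs : Summable (fun L : List ι => (L.map g).prod) := by
    refine summable_of_sum_le hp (c := 1 / (1 - q)) fun u => ?_
    obtain ⟨N, hN⟩ : ∃ N, ∀ L ∈ u, L.length ≤ N := ⟨u.sup List.length, fun L hL => Finset.le_sup hL⟩
    have h := hasSum_words_trunc hg hq N
    calc ∑ L ∈ u, (L.map g).prod = ∑ L ∈ u, (if L.length ≤ N then (L.map g).prod else 0) :=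
          Finset.sum_congr rfl fun L hL => by rw [if_pos (hN L hL)]
      _ ≤ ∑ k ∈ Finset.range (N + 1), q ^ k := sum_le_hasSum _ (fun L _ => by
          split_ifs
          · exact hp L
          · rfl) h
      _ ≤ ∑' k, q ^ k := (summable_geometric_of_lt_one hq0 hq1).sum_le_tsum _ fun k _ => by positivity
      _ = 1 / (1 - q) := by rw [tsum_geometric_of_lt_one hq0 hq1, one_div]
  have h0 : HasSum (fun p : ι × List ι => ((p.1 :: p.2).map g).prod)
      (q * ∑' L : List ι, (L.map g).prod) := by
    convert hasSum_mul_of_nonneg hq hs.hasSum hg hp using 2 with p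
    simp
  have h1 := hasSum_list (f := fun L : List ι => (L.map g).prod) h0
  have := h1.unique hs.hasSum
  have h2 : ∑' L : List ι, (L.map g).prod = 1 / (1 - q) := by
    have : (1 - q) ≠ 0 := by linarith
    field_simp
    simp at *
    linarith
  exact h2 ▸ hs.hasSum

end words

/-! ### The Beltrami equation with an absolutely summable exponential series as coefficient -/

section beltramiSeries
variable {ι : Type*} (c l : ι → ℂ)

/-- Total frequency of a word. -/
def wfreq (L : List ι) : ℂ := (L.map l).sum

/-- Coefficient of a word in the series of `dz F`. -/
def wcoef : List ι → ℂ
  | [] => 1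
  | a :: L => conj (wfreq l (a :: L)) / wfreq l (a :: L) * (c a * wcoef L)

/-- Coefficient of a word in the series of the correction term. -/
def ecoef : List ι → ℂ
  | [] => 0
  | a :: L => (c a * wcoef c l L) / (I / 2 * wfreq l (a :: L))

/-- Coefficient of a word in the constant part of `μ · dz F`. -/
def kcoef : List ι → ℂ
  | [] => 0
  | a :: L => open Classical in if wfreq l (a :: L) = 0 then c a * wcoef c l L else 0

lemma norm_wcoef_le (L : List ι) : ‖wcoef c l L‖ ≤ (L.map fun a => ‖c a‖).prod := by
  induction L with
  | nil => simp [wcoef]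
  | cons a L ih =>
    simp only [wcoef, List.map_cons, List.prod_cons, norm_mul, norm_div, RCLike.norm_conj]
    calc _ ≤ 1 * (‖c a‖ * ‖wcoef c l L‖) := by gcongr; exact div_self_le_one _
      _ ≤ _ := by rw [one_mul]; gcongr

variable {c l}

lemma norm_wfreq_le {t : ℝ} (ht : 0 < t) (L : List ι) :
    1 + t * ‖wfreq l L‖ ≤ (L.map fun a => 1 + t * ‖l a‖).prod := by
  induction L with
  | nil => simp [wfreq]
  | cons a L ih =>
    have h1 : wfreq l (a :: L) = l a + wfreq l L := by simp [wfreq]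
    rw [List.map_cons, List.prod_cons, h1]
    calc 1 + t * ‖l a + wfreq l L‖ ≤ 1 + t * (‖l a‖ + ‖wfreq l L‖) := by gcongr; exact norm_add_le _ _
      _ ≤ (1 + t * ‖l a‖) * (1 + t * ‖wfreq l L‖) := by
        have := mul_nonneg (mul_nonneg ht.le (norm_nonneg (l a))) (mul_nonneg ht.le (norm_nonneg (wfreq l L)))
        nlinarith
      _ ≤ _ := by gcongr

lemma norm_coef_mul_le {t : ℝ} (ht : 0 < t) (k : ℕ) (L : List ι) :
    (L.map fun a => ‖c a‖).prod * (1 + t * ‖wfreq l L‖) ^ k ≤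
      (L.map fun a => ‖c a‖ * (1 + t * ‖l a‖) ^ k).prod := by
  rw [List.prod_map_mul]
  have hpow : (L.map fun a => (1 + t * ‖l a‖) ^ k).prod = (L.map fun a => 1 + t * ‖l a‖).prod ^ k := by
    induction L with
    | nil => simp
    | cons a L ih => rw [List.map_cons, List.prod_cons, ih, List.map_cons, List.prod_cons, mul_pow]
  rw [hpow]
  have : 0 ≤ (L.map fun a => ‖c a‖).prod := List.prod_nonneg (by simp)
  gcongr
  exact norm_wfreq_le ht L

lemma summable_of_rapid (hr : Rapid c l) (t : ℝ) (k : ℕ) :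
    Summable fun a => ‖c a‖ * (1 + t * ‖l a‖) ^ k := by
  have : ∀ a, ‖c a‖ * (1 + t * ‖l a‖) ^ k =
      ∑ j ∈ Finset.range (k + 1), (t ^ j * k.choose j) * (‖c a‖ * ‖l a‖ ^ j) := fun a => by
    rw [add_comm, add_pow, Finset.mul_sum]
    refine Finset.sum_congr rfl fun j _ => ?_
    rw [mul_pow]; ring
  simp_rw [this]
  exact summable_sum fun j _ => (hr j).mul_left _

lemma exists_weight (hr : Rapid c l) (h1 : ∑' a, ‖c a‖ < 1) (k : ℕ) :
    ∃ t > 0, ∑' a, ‖c a‖ * (1 + t * ‖l a‖) ^ k < 1 := by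
  have h := tendsto_tsum_of_dominated_convergence (𝓕 := 𝓝[>] (0 : ℝ))
    (f := fun t a => ‖c a‖ * (1 + t * ‖l a‖) ^ k) (g := fun a => ‖c a‖)
    (summable_of_rapid hr 1 k) (fun a => ?_) ?_
  · obtain ⟨t, ht, ht0⟩ := ((h.eventually_lt_const h1).and self_mem_nhdsWithin).exists
    exact ⟨t, ht0, ht⟩
  · have : ContinuousAt (fun t : ℝ => ‖c a‖ * (1 + t * ‖l a‖) ^ k) 0 := by fun_prop
    have := this.tendsto.mono_left (nhdsWithin_le_nhds (s := Ioi 0))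
    simpa using this
  · filter_upwards [Ioo_mem_nhdsGT (zero_lt_one (α := ℝ))] with t ht a
    have h0 : 0 ≤ t := ht.1.le
    rw [Real.norm_of_nonneg (by positivity)]
    gcongr
    exact ht.2.le

/-- Words carry rapidly decaying weights. -/
lemma rapid_words (hr : Rapid c l) (h1 : ∑' a, ‖c a‖ < 1) {v : List ι → ℂ} {K : ℝ} (hK : 0 ≤ K)
    (hv : ∀ L, ‖v L‖ ≤ K * (L.map fun a => ‖c a‖).prod) :
    Rapid v (fun L => conj (wfreq l L)) := fun k => by
  obtain ⟨t, ht, hlt⟩ := exists_weight hr h1 k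
  have hs := (summable_words (g := fun a => ‖c a‖ * (1 + t * ‖l a‖) ^ k) (fun a => by positivity)
    (summable_of_rapid hr t k).hasSum hlt).summable
  refine Summable.of_nonneg_of_le (fun L => by positivity) (fun L => ?_) (hs.mul_left (K * (t⁻¹) ^ k))
  rw [RCLike.norm_conj]
  have hp : 0 ≤ (L.map fun a => ‖c a‖).prod := List.prod_nonneg (by simp)
  have h2 : ‖wfreq l L‖ ≤ t⁻¹ * (1 + t * ‖wfreq l L‖) := by
    rw [mul_add, inv_mul_cancel_left₀ ht.ne']
    have : 0 < t⁻¹ := by positivity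
    linarith
  calc ‖v L‖ * ‖wfreq l L‖ ^ k
      ≤ (K * (L.map fun a => ‖c a‖).prod) * (t⁻¹ * (1 + t * ‖wfreq l L‖)) ^ k := by
        gcongr; exact hv L
    _ = K * t⁻¹ ^ k * ((L.map fun a => ‖c a‖).prod * (1 + t * ‖wfreq l L‖) ^ k) := by
      rw [mul_pow]; ring
    _ ≤ _ := by gcongr; exact norm_coef_mul_le ht k L

lemma norm_ecoef_le {δ : ℝ} (hδ : 0 < δ) (hl : ∀ L, wfreq l L = 0 ∨ δ ≤ ‖wfreq l L‖) (L : List ι) :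
    ‖ecoef c l L‖ ≤ 2 / δ * (L.map fun a => ‖c a‖).prod := by
  have hp : 0 ≤ (L.map fun a => ‖c a‖).prod := List.prod_nonneg (by simp)
  cases L with
  | nil => simp [ecoef]; positivity
  | cons a L =>
    have hn : ‖c a * wcoef c l L‖ ≤ ((a :: L).map fun a => ‖c a‖).prod := by
      rw [norm_mul, List.map_cons, List.prod_cons]
      gcongr; exact norm_wcoef_le c l L
    simp only [ecoef, norm_div, norm_mul (I / 2), norm_I, RCLike.norm_ofNat]
    rcases hl (a :: L) with h | h
    · rw [h]
      have : 0 ≤ 2 / δ * ((a :: L).map fun a => ‖c a‖).prod := mul_nonneg (by positivity) hp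
      simpa using this
    · have hpos : 0 < 1 / 2 * ‖wfreq l (a :: L)‖ := by have := hδ.trans_le h; positivity
      rw [div_le_iff₀ hpos]
      calc _ ≤ _ := hn
        _ = 2 / δ * ((a :: L).map fun a => ‖c a‖).prod * (1 / 2 * δ) := by field_simp
        _ ≤ _ := by gcongr

/-- The correction term `e` of the solution `F = z + κ z̄ + e`. -/
def bCorr (c l : ι → ℂ) : ℂ → ℂ := dser (ecoef c l) (fun L => conj (wfreq l L)) expRe

/-- The constant `κ` of the solution `F = z + κ z̄ + e`. -/
def bConst (c l : ι → ℂ) : ℂ := ∑' L, kcoef c l L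

lemma contDiff_bCorr {δ : ℝ} (hδ : 0 < δ) (hl : ∀ L, wfreq l L = 0 ∨ δ ≤ ‖wfreq l L‖)
    (hr : Rapid c l) (h1 : ∑' a, ‖c a‖ < 1) : ContDiff ℝ ∞ (bCorr c l) :=
  contDiff_dser (rapid_words hr h1 (by positivity) (norm_ecoef_le hδ hl)) bddDerivs_expRe

lemma rapid_wcoef (hr : Rapid c l) (h1 : ∑' a, ‖c a‖ < 1) : Rapid (wcoef c l) (fun L => conj (wfreq l L)) :=
  rapid_words hr h1 zero_le_one fun L => by simpa using norm_wcoef_le c l L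

lemma dz_bCorr {δ : ℝ} (hδ : 0 < δ) (hl : ∀ L, wfreq l L = 0 ∨ δ ≤ ‖wfreq l L‖)
    (hr : Rapid c l) (h1 : ∑' a, ‖c a‖ < 1) (z : ℂ) :
    1 + dz (bCorr c l) z = dser (wcoef c l) (fun L => conj (wfreq l L)) expRe z := by
  classical
  have hre := rapid_words hr h1 (by positivity) (norm_ecoef_le (c := c) hδ hl)
  rw [bCorr, dz_dser hre bddDerivs_expRe]
  have hs := (summable_dser (rapid_wcoef hr h1) bddDerivs_expRe z).hasSum
  have h2 := hs.sub (hasSum_ite_eq ([] : List ι) (1 : ℂ))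
  have h3 : dser (fun L => ecoef c l L * conj (wfreq l L)) (fun L => conj (wfreq l L)) (dz expRe) z
      = dser (wcoef c l) (fun L => conj (wfreq l L)) expRe z - 1 := by
    refine (h2.congr_fun fun L => ?_).tsum_eq
    rw [dz_expRe]
    cases L with
    | nil => simp [ecoef, wcoef, wfreq, expRe_zero]
    | cons a L =>
      simp only [ecoef, wcoef, reduceCtorEq, if_false, sub_zero]
      by_cases h0 : wfreq l (a :: L) = 0
      · simp [h0]
      · field_simp [I_ne_zero]
  rw [h3]; ring

lemma dbar_bCorr {δ : ℝ} (hδ : 0 < δ) (hl : ∀ L, wfreq l L = 0 ∨ δ ≤ ‖wfreq l L‖)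
    (hr : Rapid c l) (h1 : ∑' a, ‖c a‖ < 1) (z : ℂ) :
    dbar (bCorr c l) z = dser c (fun a => conj (l a)) expRe z * (1 + dz (bCorr c l) z) - bConst c l := by
  classical
  have hre := rapid_words hr h1 (by positivity) (norm_ecoef_le (c := c) hδ hl)
  rw [dz_bCorr hδ hl hr h1, bCorr, dbar_dser hre bddDerivs_expRe]
  have hrc : Rapid c fun a => conj (l a) := fun k => by simpa using hr k
  have hA := summable_dser (rapid_wcoef hr h1) bddDerivs_expRe z
  have hB := summable_dser hrc bddDerivs_expRe z
  have hmul := hasSum_mul_of_norm hB hA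
  let f : List ι → ℂ
    | [] => 0
    | a :: L => c a * wcoef c l L * expRe (conj (wfreq l (a :: L)) * z)
  have hf0 : HasSum (fun p : ι × List ι => f (p.1 :: p.2))
      (dser c (fun a => conj (l a)) expRe z * dser (wcoef c l) (fun L => conj (wfreq l L)) expRe z) := by
    refine HasSum.congr_fun hmul fun p => ?_
    simp only [f, wfreq, List.map_cons, List.sum_cons, map_add, add_mul, expRe_add]; ring
  have hf := hasSum_list hf0
  have hk : Summable (kcoef c l) := by
    refine Summable.of_norm_bounded (g := fun L => (L.map fun a => ‖c a‖).prod) ?_ fun L => ?_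
    · exact (summable_words (fun a => norm_nonneg _) (by simpa using (hr 0).hasSum) h1).summable
    · cases L with
      | nil => simp [kcoef]
      | cons a L =>
        simp only [kcoef, List.map_cons, List.prod_cons]
        split_ifs
        · rw [norm_mul]; gcongr; exact norm_wcoef_le c l L
        · simpa using mul_nonneg (norm_nonneg _) (List.prod_nonneg (by simp))
  have h2 := hf.sub hk.hasSum
  have h3 : f [] = 0 := rfl
  rw [h3, zero_add] at h2
  refine (h2.congr_fun fun L => ?_).tsum_eq
  rw [dbar_expRe]
  cases L with
  | nil => simp [ecoef, kcoef, f]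
  | cons a L =>
    simp only [ecoef, kcoef, f, conj_conj]
    by_cases h0 : wfreq l (a :: L) = 0
    · simp [h0, expRe_zero]
    · rw [if_neg h0, sub_zero]; field_simp [I_ne_zero]

/-- Smallness of the correction term. -/
lemma bCorr_small {δ : ℝ} (hδ : 0 < δ) (hl : ∀ L, wfreq l L = 0 ∨ δ ≤ ‖wfreq l L‖)
    (hr : Rapid c l) {m : ℕ} {q : ℝ} (hq : ∑' a, ‖c a‖ * (1 + ‖l a‖) ^ m ≤ q) (hq2 : q ≤ 1 / 2) :
    ‖bConst c l‖ ≤ 2 * q ∧ ∀ j ≤ m, ∀ z, ‖iteratedFDeriv ℝ j (bCorr c l) z‖ ≤ 4 / δ * q := by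
  classical
  set g : ι → ℝ := fun a => ‖c a‖ * (1 + ‖l a‖) ^ m with hg
  have hg0 : ∀ a, 0 ≤ g a := fun a => by positivity
  have hgs : Summable g := by simpa using summable_of_rapid hr 1 m
  have hq0 : 0 ≤ ∑' a, g a := tsum_nonneg hg0
  have hw := summable_words hg0 hgs.hasSum (by linarith)
  have hcg : ∀ a, ‖c a‖ ≤ g a := fun a =>
    le_mul_of_one_le_right (norm_nonneg _) (one_le_pow₀ (by linarith [norm_nonneg (l a)]))
  have h1 : ∑' a, ‖c a‖ < 1 := by
    have : ∑' a, ‖c a‖ ≤ ∑' a, g a :=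
      Summable.tsum_le_tsum hcg (by simpa using hr 0) hgs
    linarith
  -- the weights of nonempty words
  set W : List ι → ℝ := fun L => if L = [] then 0 else (L.map g).prod with hW
  have hWs : HasSum W (1 / (1 - ∑' a, g a) - 1) := by
    refine (hw.sub (hasSum_ite_eq ([] : List ι) (1 : ℝ))).congr_fun fun L => ?_
    by_cases hL : L = [] <;> simp [hW, hL]
  have hWle : 1 / (1 - ∑' a, g a) - 1 ≤ 2 * q := by
    rw [sub_le_iff_le_add, div_le_iff₀ (by linarith)]
    nlinarith
  have hpc : ∀ L : List ι, (L.map fun a => ‖c a‖).prod * (1 + ‖wfreq l L‖) ^ m ≤ (L.map g).prod := by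
    intro L
    have := norm_coef_mul_le (c := c) (l := l) zero_lt_one m L
    simpa only [one_mul] using this
  have hp0 : ∀ L : List ι, 0 ≤ (L.map fun a => ‖c a‖).prod := fun L => List.prod_nonneg (by simp)
  refine ⟨?_, fun j hj z => ?_⟩
  · refine (tsum_of_norm_bounded hWs fun L => ?_).trans hWle
    cases L with
    | nil => simp [kcoef, hW]
    | cons a L =>
      simp only [kcoef, hW, reduceCtorEq, if_false]
      have h3 : ‖c a * wcoef c l L‖ ≤ ((a :: L).map g).prod := by
        refine le_trans ?_ (hpc _)
        refine le_trans ?_ (le_mul_of_one_le_right (hp0 _) (one_le_pow₀ (by linarith [norm_nonneg (wfreq l (a :: L))])))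
        rw [norm_mul, List.map_cons, List.prod_cons]
        gcongr; exact norm_wcoef_le c l L
      split_ifs
      · exact h3
      · simpa using (norm_nonneg _).trans h3
  · refine (norm_iteratedFDeriv_dser (rapid_words hr h1 (by positivity) (norm_ecoef_le hδ hl))
      bddDerivs_expRe j z).trans ?_
    rw [mul_one]
    have hle : ∀ L, ‖ecoef c l L‖ * ‖conj (wfreq l L)‖ ^ j ≤ 2 / δ * W L := fun L => by
      rw [RCLike.norm_conj]
      by_cases hL : L = []
      · simp [hL, hW, ecoef]
      · simp only [hW, hL, if_false]
        calc _ ≤ (2 / δ * (L.map fun a => ‖c a‖).prod) * (1 + ‖wfreq l L‖) ^ m := by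
              gcongr
              · exact mul_nonneg (by positivity) (hp0 L)
              · exact norm_ecoef_le hδ hl L
              · calc ‖wfreq l L‖ ^ j ≤ (1 + ‖wfreq l L‖) ^ j := by gcongr; linarith
                  _ ≤ _ := pow_le_pow_right₀ (by linarith [norm_nonneg (wfreq l L)]) hj
          _ ≤ _ := by rw [mul_assoc]; gcongr; exact hpc L
    calc _ ≤ 2 / δ * (1 / (1 - ∑' a, g a) - 1) := by
          rw [← (hWs.mul_left (2 / δ)).tsum_eq]
          exact Summable.tsum_le_tsum hle
            (rapid_words hr h1 (by positivity) (norm_ecoef_le hδ hl) j) (hWs.mul_left _).summable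
      _ ≤ 2 / δ * (2 * q) := by gcongr
      _ = 4 / δ * q := by ring

end beltramiSeries

/-! ### Fourier series in one variable -/

/-- The Fourier coefficient of `g` on `[a, a + 2π/ν]` at frequency `ν n`. -/
def fcoef (ν a : ℝ) (g : ℝ → ℂ) (n : ℤ) : ℂ :=
  (ν / (2 * Real.pi) : ℝ) * ∫ x in a..(a + 2 * Real.pi / ν), cexp (I * (-(ν * n * x) : ℝ)) * g x

lemma hasSum_fcoef {ν a : ℝ} (hν : 0 < ν) {g : ℝ → ℂ} (hg : Continuous g)
    (hper : g a = g (a + 2 * Real.pi / ν)) (hs : Summable fun n => ‖fcoef ν a g n‖) {x : ℝ}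
    (hx : x ∈ Ico a (a + 2 * Real.pi / ν)) :
    HasSum (fun n : ℤ => fcoef ν a g n * cexp (I * (ν * n * x : ℝ))) (g x) := by
  set T : ℝ := 2 * Real.pi / ν with hT
  have hTpos : 0 < T := by positivity
  have : Fact (0 < T) := ⟨hTpos⟩
  have hνT : (2 * Real.pi : ℂ) = ν * T := by
    rw [hT]; push_cast
    field_simp [hν.ne']
  let G : C(AddCircle T, ℂ) := ⟨AddCircle.liftIco T a g, AddCircle.liftIco_continuous hper hg.continuousOn⟩
  have hTc : (T : ℂ) ≠ 0 := by exact_mod_cast hTpos.ne'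
  have hco : ∀ n, fourierCoeff G n = fcoef ν a g n := fun n => by
    change fourierCoeff (AddCircle.liftIco T a g) n = _
    rw [fourierCoeff_liftIco_eq, fourierCoeffOn_eq_integral, fcoef, Complex.real_smul]
    congr 1
    · rw [hT, add_sub_cancel_left, one_div_div]
    · refine intervalIntegral.integral_congr fun y _ => ?_
      have h := fourier_coe_apply (T := a + T - a) (n := -n) (x := y)
      simp only [smul_eq_mul]
      rw [h]
      congr 2
      have hTT : ((a + T - a : ℝ) : ℂ) = T := by push_cast; ring
      rw [hTT, div_eq_iff hTc]
      have := congrArg (· * (-(I * n * y) : ℂ)) hνT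
      push_cast
      linear_combination this
  have := has_pointwise_sum_fourier_series_of_summable (f := G)
    (by simp_rw [funext hco]; exact hs.of_norm) (x : AddCircle T)
  have hGx : G (x : AddCircle T) = g x := AddCircle.liftIco_coe_apply hx
  rw [hGx] at this
  refine this.congr_fun fun n => ?_
  rw [hco, fourier_coe_apply, smul_eq_mul]
  congr 2
  rw [eq_div_iff hTc]
  push_cast
  linear_combination -(I * n * x) * hνT

/-! ### Fourier coefficients of smooth compactly supported functions on the plane -/

lemma norm_dbarCLM_le : ‖dbarCLM‖ ≤ 1 := by
  refine ContinuousLinearMap.opNorm_le_bound _ zero_le_one fun L => ?_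
  have h1 := L.le_opNorm 1
  have h2 := L.le_opNorm I
  simp only [norm_one, norm_I, mul_one] at h1 h2
  simp only [dbarCLM, one_mul, smul_apply, add_apply,
    ContinuousLinearMap.apply_apply, ContinuousLinearMap.comp_apply, ContinuousLinearMap.mul_apply']
  rw [norm_smul]
  have h3 : ‖L 1 + I * L I‖ ≤ ‖L 1‖ + ‖L I‖ := (norm_add_le _ _).trans (by simp)
  rw [Real.norm_of_nonneg (by norm_num)]
  linarith

lemma norm_iteratedFDeriv_dbar_le {u : ℂ → ℂ} (hu : ContDiff ℝ ∞ u) (j : ℕ) (z : ℂ) :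
    ‖iteratedFDeriv ℝ j (dbar u) z‖ ≤ ‖iteratedFDeriv ℝ (j + 1) u z‖ := by
  have h1 : dbar u = dbarCLM ∘ fderiv ℝ u := funext fun z => (dbarCLM_fderiv u z).symm
  have h2 : ContDiff ℝ ∞ (fderiv ℝ u) := hu.fderiv_right (by simp)
  rw [h1, ← norm_iteratedFDeriv_fderiv]
  refine (ContinuousLinearMap.norm_iteratedFDeriv_comp_left dbarCLM (h2.contDiffAt (x := z))
    (n := j) (by exact_mod_cast le_top)).trans ?_
  exact mul_le_of_le_one_left (norm_nonneg _) norm_dbarCLM_le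

lemma dbar_iterate {u : ℂ → ℂ} (hu : ContDiff ℝ ∞ u) (hc : HasCompactSupport u) (k : ℕ) :
    ContDiff ℝ ∞ (dbar^[k] u) ∧ HasCompactSupport (dbar^[k] u) ∧
      tsupport (dbar^[k] u) ⊆ tsupport u ∧
      ∀ j z, ‖iteratedFDeriv ℝ j (dbar^[k] u) z‖ ≤ ‖iteratedFDeriv ℝ (j + k) u z‖ := by
  induction k with
  | zero => exact ⟨hu, hc, subset_rfl, fun j z => le_rfl⟩
  | succ k ih =>
    obtain ⟨h1, h2, h3, h4⟩ := ih
    rw [Function.iterate_succ_apply']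
    refine ⟨h1.dbar, h2.dbar, (tsupport_dbar_subset _).trans h3, fun j z => ?_⟩
    refine (norm_iteratedFDeriv_dbar_le h1 j z).trans ((h4 (j + 1) z).trans ?_)
    rw [show j + 1 + k = j + (k + 1) by ring]

/-- `e^{i Re(conj λ z)}` -/
lemma expRe_dil_wirt (a z : ℂ) :
    dbar (fun z => expRe (a * z)) z = I / 2 * conj a * expRe (a * z) := by
  have h1 := (expRe_wirt (a * z)).wirt_comp (((hasDerivAt_id z).const_mul a).hasWirt)
  rw [h1.wirt_eq.2]; simp; ring

lemma contDiff_expRe_dil (a : ℂ) : ContDiff ℝ ∞ fun z => expRe (a * z) :=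
  bddDerivs_expRe.1.comp (contDiff_const.mul contDiff_id)

/-- The (unnormalised) Fourier integral at frequency `l`. -/
def fint (u : ℂ → ℂ) (l : ℂ) : ℂ := ∫ z, expRe (-conj l * z) * u z

lemma fint_dbar {u : ℂ → ℂ} (hu : ContDiff ℝ ∞ u) (hc : HasCompactSupport u) (l : ℂ) :
    fint (dbar u) l = I / 2 * l * fint u l := by
  rw [fint, integral_mul_dbar (contDiff_expRe_dil _) hu hc, fint, ← integral_const_mul, ← integral_neg]
  refine integral_congr_ae (.of_forall fun z => ?_)
  simp only [expRe_dil_wirt]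
  simp; ring

lemma fint_dbar_iterate {u : ℂ → ℂ} (hu : ContDiff ℝ ∞ u) (hc : HasCompactSupport u) (l : ℂ) (k : ℕ) :
    fint (dbar^[k] u) l = (I / 2 * l) ^ k * fint u l := by
  induction k with
  | zero => simp
  | succ k ih =>
    obtain ⟨h1, h2, -⟩ := dbar_iterate hu hc k
    rw [Function.iterate_succ_apply', fint_dbar h1 h2, ih]; ring

lemma norm_fint_le {u : ℂ → ℂ} {R K : ℝ} (hR : 0 ≤ R) (hK : ∀ z, ‖u z‖ ≤ K)
    (hs : tsupport u ⊆ closedBall 0 R) (l : ℂ) : ‖fint u l‖ ≤ K * (Real.pi * R ^ 2) := by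
  have h0 : ∀ z ∉ closedBall (0 : ℂ) R, expRe (-conj l * z) * u z = 0 := fun z hz => by
    rw [image_eq_zero_of_notMem_tsupport fun h => hz (hs h), mul_zero]
  rw [fint, ← setIntegral_eq_integral_of_forall_compl_eq_zero h0]
  refine (norm_setIntegral_le_of_norm_le_const (C := K) measure_closedBall_lt_top fun z _ => ?_).trans ?_
  · rw [norm_mul, norm_expRe, one_mul]; exact hK z
  · rw [Measure.real, Complex.volume_closedBall]
    simp [hR, mul_comm]

lemma norm_fint_decay {u : ℂ → ℂ} (hu : ContDiff ℝ ∞ u) {R K : ℝ} {k : ℕ} (hR : 0 ≤ R)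
    (hs : tsupport u ⊆ closedBall 0 R) (hK : ∀ j ≤ k, ∀ z, ‖iteratedFDeriv ℝ j u z‖ ≤ K) (l : ℂ) :
    (1 + ‖l‖) ^ k * ‖fint u l‖ ≤ 4 ^ k * 2 * (K * (Real.pi * R ^ 2)) := by
  have hc : HasCompactSupport u := HasCompactSupport.of_support_subset_isCompact (isCompact_closedBall 0 R) (subset_closure.trans hs)
  obtain ⟨-, -, h3, h4⟩ := dbar_iterate hu hc k
  have hb0 := norm_fint_le hR (fun z => by simpa using hK 0 (by simp) z) hs l
  have hb1 : ∀ z, ‖dbar^[k] u z‖ ≤ K := fun z => by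
    have h := h4 0 z
    rw [norm_iteratedFDeriv_zero, zero_add] at h
    exact h.trans (hK k le_rfl z)
  have hbk := norm_fint_le hR hb1 (h3.trans hs) l
  rw [fint_dbar_iterate hu hc, norm_mul, norm_pow, norm_mul] at hbk
  simp only [norm_div, norm_I, RCLike.norm_ofNat] at hbk
  have h5 : (1 + ‖l‖) ^ k ≤ 2 ^ k * (1 + ‖l‖ ^ k) := by
    refine (add_pow_le zero_le_one (norm_nonneg _) k).trans ?_
    rw [one_pow]; gcongr
    · norm_num
    · omega
  have h6 : ‖l‖ ^ k = 2 ^ k * (1 / 2 * ‖l‖) ^ k := by rw [← mul_pow]; congr 1; ring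
  have h2k : (1 : ℝ) ≤ 2 ^ k := one_le_pow₀ (by norm_num)
  set B := K * (Real.pi * R ^ 2)
  calc (1 + ‖l‖) ^ k * ‖fint u l‖ ≤ 2 ^ k * (1 + ‖l‖ ^ k) * ‖fint u l‖ := by gcongr
    _ = 2 ^ k * (‖fint u l‖ + 2 ^ k * ((1 / 2 * ‖l‖) ^ k * ‖fint u l‖)) := by rw [h6]; ring
    _ ≤ 2 ^ k * (2 ^ k * B + 2 ^ k * B) := by
      have : ‖fint u l‖ ≤ 2 ^ k * B := hb0.trans (le_mul_of_one_le_left ((norm_nonneg _).trans hb0) h2k)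
      gcongr
    _ = 4 ^ k * 2 * B := by rw [show (4 : ℝ) = 2 * 2 by norm_num, mul_pow]; ring

/-! ### Fourier series of smooth compactly supported functions on the plane -/

/-- Lattice frequency. -/
def lat (ν : ℝ) (p : ℤ × ℤ) : ℂ := ν * (p.1 + p.2 * I)

lemma lat_bound (ν : ℝ) (p : ℤ × ℤ) :
    (1 + ν ^ 2 * (p.1 : ℝ) ^ 2) * (1 + ν ^ 2 * (p.2 : ℝ) ^ 2) ≤ (1 + ‖lat ν p‖) ^ 4 := by
  have h : ‖lat ν p‖ ^ 2 = ν ^ 2 * ((p.1 : ℝ) ^ 2 + (p.2 : ℝ) ^ 2) := by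
    rw [← Complex.normSq_eq_norm_sq, Complex.normSq_apply]
    simp [lat]; ring
  have h1 : 0 ≤ ‖lat ν p‖ := norm_nonneg _
  have h2 : 1 + ‖lat ν p‖ ^ 2 ≤ (1 + ‖lat ν p‖) ^ 2 := by nlinarith
  have h3 : 0 ≤ ν ^ 2 * (p.1 : ℝ) ^ 2 := by positivity
  have h4 : 0 ≤ ν ^ 2 * (p.2 : ℝ) ^ 2 := by positivity
  calc (1 + ν ^ 2 * (p.1 : ℝ) ^ 2) * (1 + ν ^ 2 * (p.2 : ℝ) ^ 2)
      ≤ (1 + ‖lat ν p‖ ^ 2) * (1 + ‖lat ν p‖ ^ 2) := by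
        rw [h]; gcongr <;> nlinarith
    _ ≤ (1 + ‖lat ν p‖) ^ 2 * (1 + ‖lat ν p‖) ^ 2 := by gcongr
    _ = _ := by ring

lemma summable_one_div_quadratic {ν : ℝ} (hν : 0 < ν) :
    Summable fun n : ℤ => 1 / (1 + ν ^ 2 * (n : ℝ) ^ 2) := by
  refine Summable.of_nonneg_of_le (fun n => by positivity) (fun n => ?_)
    (((Real.summable_one_div_int_pow (p := 2)).2 (by norm_num)).mul_left (1 / ν ^ 2) |>.add
      (hasSum_ite_eq (0 : ℤ) (1 : ℝ)).summable)
  by_cases hn : n = 0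
  · simp [hn]
  · have : (0 : ℝ) < (n : ℝ) ^ 2 := by positivity
    simp only [hn, if_false, add_zero]
    rw [one_div_mul_one_div]
    gcongr
    linarith

lemma summable_lat {ν : ℝ} (hν : 0 < ν) :
    Summable fun p : ℤ × ℤ => 1 / (1 + ‖lat ν p‖) ^ 4 := by
  have h := summable_one_div_quadratic hν
  have h2 := (hasSum_mul_of_nonneg h.hasSum h.hasSum (fun n => by positivity)
    (fun n => by positivity)).summable
  refine Summable.of_nonneg_of_le (fun n => by positivity) (fun p => ?_) h2
  rw [one_div_mul_one_div]
  gcongr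
  exact lat_bound ν p

/-- Fourier coefficients on the lattice of frequency spacing `ν`. -/
def pcoef (ν : ℝ) (u : ℂ → ℂ) (p : ℤ × ℤ) : ℂ := ((ν / (2 * Real.pi)) ^ 2 : ℝ) * fint u (lat ν p)

lemma pcoef_bound {ν : ℝ} {u : ℂ → ℂ} (hu : ContDiff ℝ ∞ u) {R K : ℝ} {k : ℕ} (hR : 0 ≤ R)
    (hs : tsupport u ⊆ closedBall 0 R)
    (hK : ∀ j ≤ k + 4, ∀ z, ‖iteratedFDeriv ℝ j u z‖ ≤ K) (p : ℤ × ℤ) :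
    ‖pcoef ν u p‖ * (1 + ‖lat ν p‖) ^ k ≤
      (ν / (2 * Real.pi)) ^ 2 * (4 ^ (k + 4) * 2 * (Real.pi * R ^ 2)) * K *
        (1 / (1 + ‖lat ν p‖) ^ 4) := by
  have h := norm_fint_decay hu hR hs hK (lat ν p)
  have hpos : 0 < 1 + ‖lat ν p‖ := by positivity
  rw [pcoef, norm_mul, norm_real, Real.norm_of_nonneg (by positivity), mul_one_div,
    le_div_iff₀ (by positivity)]
  calc _ = (ν / (2 * Real.pi)) ^ 2 * ((1 + ‖lat ν p‖) ^ (k + 4) * ‖fint u (lat ν p)‖) := by ring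
    _ ≤ (ν / (2 * Real.pi)) ^ 2 * (4 ^ (k + 4) * 2 * (K * (Real.pi * R ^ 2))) := by gcongr
    _ = _ := by ring

lemma exists_iteratedFDeriv_bound {u : ℂ → ℂ} (hu : ContDiff ℝ ∞ u) (hc : HasCompactSupport u)
    (k : ℕ) : ∃ K, ∀ j ≤ k, ∀ z, ‖iteratedFDeriv ℝ j u z‖ ≤ K := by
  have : ∀ j, ∃ K, ∀ z, ‖iteratedFDeriv ℝ j u z‖ ≤ K := fun j =>
    (hu.continuous_iteratedFDeriv (by exact_mod_cast le_top)).bounded_above_of_compact_support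
      (hc.iteratedFDeriv j)
  choose K hK using this
  refine ⟨∑ j ∈ Finset.range (k + 1), |K j|, fun j hj z => (hK j z).trans ((le_abs_self _).trans ?_)⟩
  exact Finset.single_le_sum (f := fun j => |K j|) (fun _ _ => abs_nonneg _) (by simpa [Nat.lt_succ_iff] using hj)

lemma rapid_pcoef {ν : ℝ} (hν : 0 < ν) {u : ℂ → ℂ} (hu : ContDiff ℝ ∞ u) {R : ℝ} (hR : 0 ≤ R)
    (hs : tsupport u ⊆ closedBall 0 R) : Rapid (pcoef ν u) (lat ν) := fun k => by
  have hc : HasCompactSupport u := HasCompactSupport.of_support_subset_isCompact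
    (isCompact_closedBall 0 R) (subset_closure.trans hs)
  obtain ⟨K, hK⟩ := exists_iteratedFDeriv_bound hu hc (k + 4)
  refine Summable.of_nonneg_of_le (fun p => by positivity) (fun p => ?_)
    ((summable_lat hν).mul_left
      ((ν / (2 * Real.pi)) ^ 2 * (4 ^ (k + 4) * 2 * (Real.pi * R ^ 2)) * K))
  refine le_trans ?_ (pcoef_bound (ν := ν) hu hR hs hK p)
  gcongr
  linarith

lemma integral_complex {f : ℂ → ℂ} (hf : Integrable f) :
    ∫ z, f z = ∫ y : ℝ, ∫ x : ℝ, f (x + y * I) := by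
  have h1 := (Complex.volume_preserving_equiv_real_prod.symm).integral_comp
    (Complex.measurableEquivRealProd.symm.measurableEmbedding) f
  rw [← h1]
  have h2 : Integrable (fun p : ℝ × ℝ => f (Complex.measurableEquivRealProd.symm p))
      (volume.prod volume) :=
    ((Complex.volume_preserving_equiv_real_prod.symm).integrable_comp_emb
      Complex.measurableEquivRealProd.symm.measurableEmbedding).2 hf
  have h3 := integral_prod_symm _ h2
  rw [Measure.volume_eq_prod, h3]
  refine integral_congr_ae (.of_forall fun y => integral_congr_ae (.of_forall fun x => ?_))
  simp only
  congr 1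
  rw [Complex.measurableEquivRealProd_symm_apply]
  apply Complex.ext <;> simp

lemma intervalIntegral_eq_integral {f : ℝ → ℂ} {a b : ℝ} (hab : a ≤ b)
    (h : ∀ x ∉ Ioc a b, f x = 0) : ∫ x in a..b, f x = ∫ x, f x := by
  rw [intervalIntegral.integral_of_le hab, setIntegral_eq_integral_of_forall_compl_eq_zero h]

lemma hasSum_pcoef {ν R : ℝ} (hν : 0 < ν) {u : ℂ → ℂ} (hu : ContDiff ℝ ∞ u) (hR : 0 ≤ R)
    (hs : tsupport u ⊆ closedBall 0 R) (hRν : R < Real.pi / ν) {z : ℂ} (hz : ‖z‖ ≤ R) :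
    dser (pcoef ν u) (fun p => conj (lat ν p)) expRe z = u z := by
  have hc : HasCompactSupport u := HasCompactSupport.of_support_subset_isCompact
    (isCompact_closedBall 0 R) (subset_closure.trans hs)
  have h0 : ∀ x y : ℝ, R < |x| ∨ R < |y| → u (x + y * I) = 0 := fun x y h =>
    image_eq_zero_of_notMem_tsupport fun hm => by
      have h1 := mem_closedBall_zero_iff.1 (hs hm)
      have h2 := Complex.abs_re_le_norm (x + y * I)
      have h3 := Complex.abs_im_le_norm (x + y * I)
      simp at h2 h3
      rcases h with h | h <;> linarith
  set a : ℝ := -(Real.pi / ν) with ha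
  have hab : a + 2 * Real.pi / ν = Real.pi / ν := by rw [ha]; ring
  have hpi : 0 < Real.pi / ν := by have := Real.pi_pos; positivity
  have hle : a ≤ a + 2 * Real.pi / ν := by rw [hab]; linarith
  have hout : ∀ x ∉ Ioc a (a + 2 * Real.pi / ν), R < |x| := fun x hx => by
    rw [hab] at hx
    by_contra! hcon
    have := abs_le.1 hcon
    exact hx ⟨by linarith, by linarith⟩
  have hcont2 : Continuous fun p : ℝ × ℝ => u (p.1 + p.2 * I) :=
    hu.continuous.comp (by fun_prop)
  -- Fourier coefficients in the horizontal variable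
  let A : ℤ → ℝ → ℂ := fun n y => fcoef ν a (fun x => u (x + y * I)) n
  have hA : ∀ n, Continuous (A n) := fun n => by
    refine continuous_const.mul (intervalIntegral.continuous_parametric_intervalIntegral_of_continuous'
      (f := fun (y x : ℝ) => cexp (I * (-(ν * n * x) : ℝ)) * u (x + y * I)) ?_ _ _)
    exact (by fun_prop : Continuous fun p : ℝ × ℝ => cexp (I * (-(ν * n * p.2) : ℝ))).mul
      (hcont2.comp continuous_swap)
  have hA0 : ∀ n y, R < |y| → A n y = 0 := fun n y hy => by
    simp [A, fcoef, h0 _ y (Or.inr hy)]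
  have ha1 : R < |a| := by rw [ha, abs_neg, abs_of_pos hpi]; exact hRν
  have hb1 : R < |a + 2 * Real.pi / ν| := by rw [hab, abs_of_pos hpi]; exact hRν
  have hcoef : ∀ n k, fcoef ν a (A n) k = pcoef ν u (n, k) := fun n k => by
    have hintg : Integrable fun z => expRe (-conj (lat ν (n, k)) * z) * u z :=
      ((contDiff_expRe_dil _).continuous.mul hu.continuous).integrable_of_hasCompactSupport hc.mul_left
    rw [pcoef, fint, integral_complex hintg, fcoef, intervalIntegral_eq_integral hle
      (fun y hy => by rw [hA0 n y (hout y hy), mul_zero])]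
    have : ∀ y : ℝ, cexp (I * (-(ν * k * y) : ℝ)) * A n y = (ν / (2 * Real.pi) : ℝ) *
        ∫ x : ℝ, expRe (-conj (lat ν (n, k)) * (x + y * I)) * u (x + y * I) := fun y => by
      simp only [A]
      rw [fcoef, intervalIntegral_eq_integral hle
        (fun x hx => by rw [h0 x y (Or.inl (hout x hx)), mul_zero]), mul_left_comm,
        ← integral_const_mul]
      congr 1
      refine integral_congr_ae (.of_forall fun x => ?_)
      simp only [expRe]
      rw [← mul_assoc, ← Complex.exp_add, ← mul_add]
      congr 3
      rw [← ofReal_add]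
      congr 1
      simp [lat]
    simp_rw [this]
    rw [integral_const_mul, ← mul_assoc]
    push_cast; ring
  have hsum : Summable fun p : ℤ × ℤ => ‖pcoef ν u p‖ := by simpa using rapid_pcoef hν hu hR hs 0
  have hI : ∀ x : ℝ, |x| ≤ R → x ∈ Ico a (a + 2 * Real.pi / ν) := fun x hx => by
    have := abs_le.1 hx
    rw [hab]; exact ⟨by linarith, by linarith⟩
  have hx := hI z.re ((Complex.abs_re_le_norm z).trans hz)
  have hy := hI z.im ((Complex.abs_im_le_norm z).trans hz)
  have hAy : ∀ n, HasSum (fun k : ℤ => pcoef ν u (n, k) * cexp (I * (ν * k * z.im : ℝ))) (A n z.im) :=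
    fun n => by
      have := hasSum_fcoef hν (hA n) (by rw [hA0 n a ha1, hA0 n _ hb1])
        (by simp_rw [hcoef]; exact hsum.prod_factor n) hy
      simpa only [hcoef] using this
  have hAs : Summable fun n => ‖A n z.im‖ := by
    refine Summable.of_nonneg_of_le (fun n => norm_nonneg _) (fun n => ?_) hsum.prod
    rw [← (hAy n).tsum_eq]
    refine tsum_of_norm_bounded (hsum.prod_factor n).hasSum fun k => ?_
    rw [norm_mul, mul_comm I, norm_exp_ofReal_mul_I, mul_one]
  have hfin := hasSum_fcoef hν (g := fun x : ℝ => u (x + z.im * I))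
    (hcont2.comp (by fun_prop : Continuous fun x : ℝ => (x, z.im)))
    (by simp only [h0 a z.im (Or.inl ha1), h0 _ z.im (Or.inl hb1)]) hAs hx
  rw [re_add_im] at hfin
  have hr : Rapid (pcoef ν u) (fun p => conj (lat ν p)) := fun k => by
    simpa using rapid_pcoef hν hu hR hs k
  have hS := (summable_dser hr bddDerivs_expRe z).hasSum
  have hfib := hS.prod_fiberwise (g := fun n => A n z.im * cexp (I * (ν * n * z.re : ℝ))) fun n => by
    refine ((hAy n).mul_right _).congr_fun fun k => ?_
    rw [mul_assoc, ← Complex.exp_add, ← mul_add]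
    congr 2
    simp only [expRe]
    congr 2
    rw [← ofReal_add]
    congr 1
    simp [lat]; ring
  exact hfib.unique hfin

lemma lat_add (ν : ℝ) (p p' : ℤ × ℤ) : lat ν (p + p') = lat ν p + lat ν p' := by
  simp [lat]; ring

lemma wfreq_lat (ν : ℝ) (L : List (ℤ × ℤ)) : wfreq (lat ν) L = lat ν L.sum := by
  induction L with
  | nil => simp [wfreq, lat]
  | cons a L ih =>
    rw [List.sum_cons, lat_add, ← ih]; simp [wfreq]

lemma lat_eq_zero_or {ν : ℝ} (p : ℤ × ℤ) : lat ν p = 0 ∨ ν ≤ ‖lat ν p‖ := by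
  by_cases hp : p = 0
  · left; simp [lat, hp]
  · right
    have h : ‖lat ν p‖ ^ 2 = ν ^ 2 * ((p.1 : ℝ) ^ 2 + (p.2 : ℝ) ^ 2) := by
      rw [← Complex.normSq_eq_norm_sq, Complex.normSq_apply]
      simp [lat]; ring
    have h1 : (1 : ℝ) ≤ (p.1 : ℝ) ^ 2 + (p.2 : ℝ) ^ 2 := by
      have : 0 < p.1 ^ 2 + p.2 ^ 2 := by
        by_contra! hcon
        have h1 : p.1 = 0 := by nlinarith [sq_nonneg p.1, sq_nonneg p.2]
        have h2 : p.2 = 0 := by nlinarith [sq_nonneg p.1, sq_nonneg p.2]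
        exact hp (Prod.ext h1 h2)
      exact_mod_cast Int.add_one_le_iff.2 this
    refine le_of_sq_le_sq ?_ (norm_nonneg _)
    rw [h]; exact le_mul_of_one_le_right (sq_nonneg _) h1

/-- Global solution of the Beltrami equation for small smooth compactly supported coefficients. -/
theorem beltrami (m : ℕ) {R η : ℝ} (hR : 0 < R) (hη : 0 < η) :
    ∃ κ > 0, ∀ μ : ℂ → ℂ, ContDiff ℝ ∞ μ → tsupport μ ⊆ closedBall 0 R →
      (∀ j ≤ m + 5, ∀ z, ‖iteratedFDeriv ℝ j μ z‖ ≤ κ) →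
      ∃ F : ℂ → ℂ, ContDiff ℝ ∞ F ∧ (∀ z ∈ closedBall (0 : ℂ) R, dbar F z = μ z * dz F z) ∧
        (∀ j ≤ m, ∀ z ∈ closedBall (0 : ℂ) R, ‖iteratedFDeriv ℝ j (fun w => F w - w) z‖ ≤ η) ∧
        ∀ z, ‖fderiv ℝ (fun w => F w - w) z‖ ≤ 1 / 2 := by
  set ν : ℝ := Real.pi / (2 * R) with hν
  have hν0 : 0 < ν := by have := Real.pi_pos; positivity
  have hRν : R < Real.pi / ν := by
    rw [hν, div_div_cancel₀ Real.pi_ne_zero]; linarith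
  set S : ℝ := ∑' p : ℤ × ℤ, 1 / (1 + ‖lat ν p‖) ^ 4
  set C : ℝ := (ν / (2 * Real.pi)) ^ 2 * (4 ^ (m + 1 + 4) * 2 * (Real.pi * R ^ 2)) with hC
  have hS0 : 0 ≤ S := tsum_nonneg fun p => by positivity
  have hC0 : 0 ≤ C := by have := Real.pi_pos; positivity
  set E : ℝ := C * S * (2 * (1 + R) + 4 / ν) + 2 * C * S with hE
  have hE0 : 0 ≤ E := by positivity
  refine ⟨min η (1 / 2) / (E + 1), by positivity, fun μ hμ hs hK => ?_⟩
  set κ := min η (1 / 2) / (E + 1) with hκ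
  have hκ0 : 0 < κ := by positivity
  have hκE : κ * (E + 1) = min η (1 / 2) := div_mul_cancel₀ _ (by positivity)
  have hκE' : κ * E ≤ min η (1 / 2) := by nlinarith
  have hr := rapid_pcoef hν0 hμ hR.le hs
  set q : ℝ := C * κ * S
  have hq0 : 0 ≤ q := by positivity
  have hqsum : ∑' p, ‖pcoef ν μ p‖ * (1 + ‖lat ν p‖) ^ (m + 1) ≤ q := by
    have h2 := (summable_lat hν0).hasSum.mul_left (C * κ)
    refine (Summable.tsum_le_tsum (fun p => ?_) (by simpa using summable_of_rapid hr 1 (m + 1))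
      h2.summable).trans h2.tsum_eq.le
    exact pcoef_bound hμ hR.le hs (fun j hj => hK j (by omega)) p
  have hqE : q * (2 * (1 + R) + 4 / ν) + 2 * q = κ * E := by rw [hE]; ring
  have hx0 : 0 ≤ q * (2 * (1 + R) + 4 / ν) := by positivity
  have hq2 : q ≤ 1 / 2 := by
    have := hκE'.trans (min_le_right _ _); linarith
  have hl : ∀ L, wfreq (lat ν) L = 0 ∨ ν ≤ ‖wfreq (lat ν) L‖ := fun L => by
    rw [wfreq_lat]; exact lat_eq_zero_or _
  have h1 : ∑' a, ‖pcoef ν μ a‖ < 1 := by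
    refine lt_of_le_of_lt (Summable.tsum_le_tsum (fun p => ?_) (by simpa using hr 0)
      (by simpa using summable_of_rapid hr 1 (m + 1))) (lt_of_le_of_lt (hqsum.trans hq2) (by norm_num))
    exact le_mul_of_one_le_right (norm_nonneg _) (one_le_pow₀ (by linarith [norm_nonneg (lat ν p)]))
  obtain ⟨hk, he⟩ := bCorr_small hν0 hl hr hqsum hq2
  set k := bConst (pcoef ν μ) (lat ν)
  set e := bCorr (pcoef ν μ) (lat ν)
  have hesm : ContDiff ℝ ∞ e := contDiff_bCorr hν0 hl hr h1
  have hFid : (fun w => w + k * conj w + e w - w) = (wirt 0 k : ℂ → ℂ) + e := by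
    ext w; simp [wirt_apply]; ring
  have hknorm : ‖wirt 0 k‖ ≤ ‖k‖ :=
    ContinuousLinearMap.opNorm_le_bound _ (norm_nonneg _) fun v => by simp [wirt_apply]
  have hbound : ∀ j ≤ m + 1, ∀ z : ℂ, (j = 0 → ‖z‖ ≤ R) →
      ‖iteratedFDeriv ℝ j (fun w => w + k * conj w + e w - w) z‖ ≤ min η (1 / 2) := by
    intro j hj z hz
    have hj' : ((j : ℕ) : ℕ∞ω) ≤ ∞ := by exact_mod_cast le_top
    rw [hFid, iteratedFDeriv_add_apply ((wirt 0 k).contDiff.contDiffAt)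
      ((hesm.of_le hj').contDiffAt)]
    refine (norm_add_le _ _).trans ?_
    have hkk : ‖k‖ ≤ 2 * q * (1 + R) := hk.trans (by nlinarith)
    have hL : ‖iteratedFDeriv ℝ j (wirt 0 k : ℂ → ℂ) z‖ ≤ 2 * q * (1 + R) := by
      cases j with
      | zero =>
        rw [norm_iteratedFDeriv_zero]
        have := hz rfl
        calc ‖wirt 0 k z‖ = ‖k‖ * ‖z‖ := by simp [wirt_apply]
          _ ≤ 2 * q * (1 + R) := by gcongr; linarith
      | succ j =>
        rw [← norm_iteratedFDeriv_fderiv]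
        have : fderiv ℝ (wirt 0 k : ℂ → ℂ) = fun _ => wirt 0 k := funext fun z => (wirt 0 k).fderiv
        rw [this]
        cases j with
        | zero => simpa using hknorm.trans hkk
        | succ j => rw [iteratedFDeriv_const_of_ne (by simp)]; simp; positivity
    have := he j hj z
    calc _ ≤ 2 * q * (1 + R) + 4 / ν * q := add_le_add hL this
      _ ≤ κ * E := by rw [← hqE]; linarith
      _ ≤ _ := hκE'
  have hcj : ContDiff ℝ ∞ fun w : ℂ => conj w := conjCLE.contDiff
  refine ⟨fun w => w + k * conj w + e w, ?_, fun z hz => ?_, fun j hj z hz => ?_, fun z => ?_⟩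
  · exact (contDiff_id.add (contDiff_const.mul hcj)).add hesm
  · have hw := ((hasFDerivAt_id' z).wirt_add ((hasDerivAt_const z k).hasWirt.wirt_mul
      (hasFDerivAt_conj z))).wirt_add (hesm.diffAt z).hasWirt
    have hw1 := hw.wirt_eq.1
    have hw2 := hw.wirt_eq.2
    simp only [mul_zero, zero_mul, add_zero, zero_add, mul_one] at hw1 hw2
    rw [hw1, hw2, dbar_bCorr hν0 hl hr h1 z, hasSum_pcoef hν0 hμ hR.le hs hRν (mem_closedBall_zero_iff.1 hz)]
    ring
  · exact (hbound j (by omega) z fun _ => mem_closedBall_zero_iff.1 hz).trans (min_le_left _ _)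
  · rw [← norm_iteratedFDeriv_one]
    exact (hbound 1 (by omega) z (by simp)).trans (min_le_right _ _)

/-! ### Almost analytic extension of smooth periodic curves -/

lemma BddDerivs.mul {u v : ℂ → ℂ} {C C' : ℕ → ℝ} (hu : BddDerivs u C) (hv : BddDerivs v C') :
    ∃ C'' : ℕ → ℝ, BddDerivs (fun z => u z * v z) C'' := by
  refine ⟨fun j => ∑ i ∈ Finset.range (j + 1), (j.choose i : ℝ) * C i * C' (j - i),
    hu.1.mul hv.1, fun j z => ?_⟩
  have hj : ((j : ℕ) : ℕ∞ω) ≤ ∞ := by exact_mod_cast le_top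
  refine (norm_iteratedFDeriv_mul_le hu.1 hv.1 z hj).trans ?_
  refine Finset.sum_le_sum fun i _ => mul_le_mul ?_ (hv.2 _ z) (norm_nonneg _) ?_
  · exact mul_le_mul_of_nonneg_left (hu.2 i z) (Nat.cast_nonneg _)
  · exact mul_nonneg (Nat.cast_nonneg _) ((norm_nonneg _).trans (hu.2 i z))

lemma exists_bddDerivs_im {l : ℝ → ℂ} (hl : ContDiff ℝ ∞ l) (hc : HasCompactSupport l) :
    ∃ C : ℕ → ℝ, BddDerivs (fun z => l z.im) C := by
  have hb : ∀ j : ℕ, ∃ C, ∀ x, ‖iteratedFDeriv ℝ j l x‖ ≤ C := fun j =>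
    (hc.iteratedFDeriv j).exists_bound_of_continuous
      (hl.continuous_iteratedFDeriv (by exact_mod_cast le_top))
  choose C hC using hb
  have he : (fun z : ℂ => l z.im) = l ∘ imCLM := rfl
  refine ⟨C, he ▸ hl.comp imCLM.contDiff, fun j z => ?_⟩
  have hj : ((j : ℕ) : ℕ∞ω) ≤ ∞ := by exact_mod_cast le_top
  rw [he, ContinuousLinearMap.iteratedFDeriv_comp_right _ hl z hj]
  refine (ContinuousMultilinearMap.norm_compContinuousLinearMap_le _ _).trans ?_
  have : ∏ _i : Fin j, ‖imCLM‖ = 1 := by simp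
  rw [this, mul_one]
  exact hC j _

/-- The profile `exp(i Re z) l(Im z)`. -/
def prof (l : ℝ → ℂ) (z : ℂ) : ℂ := expRe z * l z.im

lemma exists_bddDerivs_prof {l : ℝ → ℂ} (hl : ContDiff ℝ ∞ l) (hc : HasCompactSupport l) :
    ∃ C : ℕ → ℝ, BddDerivs (prof l) C := by
  obtain ⟨C, hC⟩ := exists_bddDerivs_im hl hc
  exact bddDerivs_expRe.mul hC

lemma dbar_prof {l : ℝ → ℂ} (hl : ContDiff ℝ ∞ l) (z : ℂ) :
    dbar (prof l) z = I / 2 * prof (fun x => l x + deriv l x) z := by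
  have h1 : HasDerivAt l (deriv l z.im) z.im :=
    (hl.differentiable (by simp)).differentiableAt.hasDerivAt
  have h2 : HasFDerivAt (fun z : ℂ => l z.im) _ z := h1.hasFDerivAt.comp z imCLM.hasFDerivAt
  have h3 : HasFDerivAt (fun z : ℂ => l z.im) (wirt (-I / 2 * deriv l z.im) (I / 2 * deriv l z.im)) z := by
    refine h2.to_wirt fun v => ?_
    have : ((v.im : ℝ) : ℂ) = -I / 2 * v + I / 2 * conj v := by
      apply Complex.ext <;> simp <;> ring
    simp only [ContinuousLinearMap.comp_apply, ContinuousLinearMap.toSpanSingleton_apply, imCLM_apply,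
      Complex.real_smul]
    rw [this]; ring
  have := ((expRe_wirt z).wirt_mul h3).wirt_eq.2
  change dbar (fun z => expRe z * l z.im) z = _
  rw [this, prof]; ring

lemma prof_add_two_pi (l : ℝ → ℂ) (n : ℤ) (z : ℂ) :
    prof l (n * (z + 2 * Real.pi)) = prof l (n * z) := by
  have h : expRe ((n : ℂ) * (2 * Real.pi)) = 1 := by
    rw [expRe]
    have : (((n : ℂ) * (2 * Real.pi)).re : ℂ) = n * (2 * Real.pi) := by simp
    rw [this, show I * (n * (2 * Real.pi)) = n * (2 * Real.pi * I) by ring]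
    exact exp_int_mul_two_pi_mul_I n
  rw [prof, prof, mul_add, expRe_add, h, mul_one]
  congr 2
  simp

lemma fcoef_deriv {g : ℝ → ℂ} (hg : ContDiff ℝ ∞ g)
    (hp : Function.Periodic g (2 * Real.pi)) (n : ℤ) :
    fcoef 1 0 (deriv g) n = I * n * fcoef 1 0 g n := by
  have hd : ∀ x, HasDerivAt g (deriv g x) x := fun x =>
    (hg.differentiable (by simp)).differentiableAt.hasDerivAt
  have he : ∀ x : ℝ, HasDerivAt (fun x : ℝ => cexp (I * (-(1 * n * x) : ℝ)))
      (cexp (I * (-(1 * n * x) : ℝ)) * (-I * n)) x := fun x => by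
    have h := ((hasDerivAt_id (x : ℂ)).const_mul (-I * n)).cexp.comp_ofReal
    simp only [id, mul_one] at h
    convert h using 1
    · ext y; congr 1; push_cast; ring
    · congr 2; push_cast; ring
  have hcd : Continuous (deriv g) := hg.continuous_deriv (by simp)
  have hce : Continuous fun x : ℝ => cexp (I * (-(1 * n * x) : ℝ)) := by fun_prop
  have := intervalIntegral.integral_mul_deriv_eq_deriv_mul (a := 0) (b := 0 + 2 * Real.pi / 1)
    (fun x _ => he x) (fun x _ => hd x)
    ((hce.mul continuous_const).intervalIntegrable _ _) (hcd.intervalIntegrable _ _)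
  rw [fcoef, fcoef, this]
  have h1 : g (0 + 2 * Real.pi / 1) = g 0 := by rw [div_one]; exact hp 0
  have h2 : cexp (I * (-(1 * n * (0 + 2 * Real.pi / 1)) : ℝ)) = 1 := by
    have := exp_int_mul_two_pi_mul_I (-n)
    rw [← this]; congr 1; push_cast; ring
  rw [h1, h2]
  have h3 : (fun x : ℝ => cexp (I * (-(1 * n * x) : ℝ)) * (-I * n) * g x) =
      fun x : ℝ => (-I * n) * (cexp (I * (-(1 * n * x) : ℝ)) * g x) := by ext; ring
  rw [h3, intervalIntegral.integral_const_mul]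
  simp; ring

lemma exists_fcoef_bound (g : ℝ → ℂ) :
    ∃ C, ∀ n, ‖fcoef 1 0 g n‖ ≤ C := by
  refine ⟨(1 / (2 * Real.pi)) * ∫ x in (0 : ℝ)..(0 + 2 * Real.pi / 1), ‖g x‖, fun n => ?_⟩
  have hle : (0 : ℝ) ≤ 0 + 2 * Real.pi / 1 := by have := Real.pi_pos; positivity
  rw [fcoef, norm_mul, norm_real, Real.norm_of_nonneg (by have := Real.pi_pos; positivity)]
  refine mul_le_mul_of_nonneg_left ?_ (by have := Real.pi_pos; positivity)
  refine (intervalIntegral.norm_integral_le_integral_norm hle).trans_eq ?_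
  refine intervalIntegral.integral_congr fun x _ => ?_
  simp only [norm_mul, mul_comm I, norm_exp_ofReal_mul_I, one_mul]

lemma fcoef_pow_bound (k : ℕ) : ∀ {g : ℝ → ℂ}, ContDiff ℝ ∞ g →
    Function.Periodic g (2 * Real.pi) → ∃ C, ∀ n : ℤ, ‖fcoef 1 0 g n‖ * ‖(n : ℂ)‖ ^ k ≤ C := by
  induction k with
  | zero =>
    intro g hg hp
    simpa using exists_fcoef_bound g
  | succ k ih =>
    intro g hg hp
    have hg' : ContDiff ℝ ∞ (deriv g) := by
      simpa using (contDiff_infty_iff_deriv.1 hg).2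
    obtain ⟨C, hC⟩ := ih hg' fun x => by
      rw [← deriv_comp_add_const]; congr 1; exact funext hp
    refine ⟨C, fun n => ?_⟩
    refine le_trans (le_of_eq ?_) (hC n)
    rw [fcoef_deriv hg hp, norm_mul, norm_mul, norm_I]; ring

lemma rapid_fcoef {g : ℝ → ℂ} (hg : ContDiff ℝ ∞ g) (hp : Function.Periodic g (2 * Real.pi)) :
    Rapid (fcoef 1 0 g) (fun n : ℤ => (n : ℂ)) := fun k => by
  obtain ⟨C, hC⟩ := fcoef_pow_bound (k + 2) hg hp
  refine Summable.of_norm_bounded_eventually (g := fun n : ℤ => C * (1 / (n : ℝ) ^ 2))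
    ((Real.summable_one_div_int_pow.2 one_lt_two).mul_left C) ?_
  filter_upwards [(Set.finite_singleton (0 : ℤ)).compl_mem_cofinite] with n hn
  have hn0 : (n : ℝ) ≠ 0 := by exact_mod_cast hn
  have h2 : ‖(n : ℂ)‖ ^ 2 = (n : ℝ) ^ 2 := by
    rw [Complex.norm_intCast, sq_abs]
  rw [Real.norm_of_nonneg (by positivity), mul_one_div, le_div_iff₀ (by positivity), ← h2]
  exact (by rw [pow_add]; ring : _ = _).trans_le (hC n)

/-- A smooth function equal to `1` near `0`, times `exp (-x)`. -/
lemma exists_profile : ∃ k l : ℝ → ℂ, ContDiff ℝ ∞ k ∧ HasCompactSupport k ∧ k 0 = 1 ∧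
    (∀ x, k x + deriv k x = l x) ∧
    ∀ K : ℕ, ∃ lK : ℝ → ℂ, ContDiff ℝ ∞ lK ∧ HasCompactSupport lK ∧ ∀ x : ℝ, l x = x ^ K * lK x := by
  let χ : ContDiffBump (0 : ℝ) := ⟨1, 2, one_pos, one_lt_two⟩
  let e : ℝ → ℂ := fun x => ((Real.exp (-x) : ℝ) : ℂ)
  let c : ℝ → ℂ := fun x => ((χ x : ℝ) : ℂ)
  have hχ : ContDiff ℝ ∞ (fun x => χ x) := χ.contDiff
  have hc : ContDiff ℝ ∞ c := ofRealCLM.contDiff.comp hχ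
  have he : ContDiff ℝ ∞ e := ofRealCLM.contDiff.comp (Real.contDiff_exp.comp contDiff_neg)
  have hcc : HasCompactSupport c := χ.hasCompactSupport.comp_left (g := fun x : ℝ => (x : ℂ)) rfl
  have hc' : ContDiff ℝ ∞ (deriv c) := (contDiff_infty_iff_deriv.1 hc).2
  have hed : ∀ x, HasDerivAt e (-e x) x := fun x => by
    have := ((Real.hasDerivAt_exp (-x)).comp x (hasDerivAt_neg x)).ofReal_comp
    simpa [e] using this
  have hcd : ∀ x, HasDerivAt c (deriv c x) x := fun x =>
    (hc.differentiable (by simp)).differentiableAt.hasDerivAt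
  have hz : ∀ x ∈ ball (0 : ℝ) 1, deriv c x = 0 := fun x hx => by
    have : c =ᶠ[𝓝 x] fun _ => 1 := by
      filter_upwards [isOpen_ball.mem_nhds hx] with y hy
      simp only [c]
      rw [χ.one_of_mem_closedBall (ball_subset_closedBall hy)]; simp
    rw [this.deriv_eq]; simp
  refine ⟨fun x => c x * e x, fun x => deriv c x * e x, hc.mul he, hcc.mul_right, ?_, fun x => ?_, fun K => ?_⟩
  · simp [c, e]
    exact χ.one_of_mem_closedBall (by simp [χ.rIn_pos.le])
  · have := ((hcd x).mul (hed x)).deriv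
    change c x * e x + deriv (c * e) x = deriv c x * e x
    rw [this]; ring
  · refine ⟨fun x => deriv c x * e x * ((x : ℂ) ^ K)⁻¹, ?_, ?_, fun x => ?_⟩
    · rw [contDiff_iff_contDiffAt]
      intro x
      by_cases hx : x ∈ ball (0 : ℝ) 1
      · have : (fun x : ℝ => deriv c x * e x * ((x : ℂ) ^ K)⁻¹) =ᶠ[𝓝 x] fun _ => 0 := by
          filter_upwards [isOpen_ball.mem_nhds hx] with y hy
          rw [hz y hy]; ring
        exact contDiffAt_const.congr_of_eventuallyEq this
      · have hx0 : x ≠ 0 := by rintro rfl; simp at hx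
        refine (hc'.contDiffAt.mul he.contDiffAt).mul (ContDiffAt.inv ?_ ?_)
        · exact (ofRealCLM.contDiff.contDiffAt).pow K
        · exact pow_ne_zero _ (by exact_mod_cast hx0)
    · exact (hcc.deriv.mul_right (f' := e)).mul_right
    · by_cases hx : x = 0
      · subst hx; simp only [hz 0 (by simp)]; ring
      · have : (x : ℂ) ≠ 0 := by exact_mod_cast hx
        field_simp

/-- Almost analytic extension of a smooth periodic function on the line. -/
theorem exists_almostAnalytic {γ : ℝ → ℂ} (hγ : ContDiff ℝ ∞ γ)
    (hp : Function.Periodic γ (2 * Real.pi)) :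
    ∃ Γ : ℂ → ℂ, ContDiff ℝ ∞ Γ ∧ (∀ z, Γ (z + 2 * Real.pi) = Γ z) ∧ (∀ t : ℝ, Γ t = γ t) ∧
      ∀ K : ℕ, ∃ B : ℂ → ℂ, ContDiff ℝ ∞ B ∧ (∀ z, B (z + 2 * Real.pi) = B z) ∧
        ∀ z, dbar Γ z = z.im ^ K * B z := by
  obtain ⟨k, l, hk, hkc, hk0, hkl, hK⟩ := exists_profile
  have hr := rapid_fcoef hγ hp
  obtain ⟨C, hC⟩ := exists_bddDerivs_prof hk hkc
  have hper : ∀ (a : ℤ → ℂ) (l : ℝ → ℂ) z, dser a (fun n : ℤ => (n : ℂ)) (prof l) (z + 2 * Real.pi) =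
      dser a (fun n : ℤ => (n : ℂ)) (prof l) z := fun a l z =>
    tsum_congr fun n => by rw [prof_add_two_pi]
  have hγ' : ∀ t ∈ Ico (0 : ℝ) (0 + 2 * Real.pi / 1),
      dser (fcoef 1 0 γ) (fun n : ℤ => (n : ℂ)) (prof k) t = γ t := fun t ht => by
    have h := hasSum_fcoef one_pos hγ.continuous (by simpa using (hp 0).symm)
      (by simpa using hr 0) ht
    rw [← h.tsum_eq]
    refine tsum_congr fun n => ?_
    have : (n * (t : ℂ)).im = 0 := by simp
    rw [prof, this, hk0, mul_one, expRe]
    congr 3; simp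
  refine ⟨dser (fcoef 1 0 γ) (fun n : ℤ => (n : ℂ)) (prof k), contDiff_dser hr hC, hper _ _, fun t => ?_,
    fun K => ?_⟩
  · have hP : Function.Periodic (fun t : ℝ =>
        (dser (fcoef 1 0 γ) (fun n : ℤ => (n : ℂ)) (prof k) t, γ t)) (2 * Real.pi) := fun t => by
      have := hper (fcoef 1 0 γ) k t
      rw [Prod.mk.injEq]
      exact ⟨by simpa using this, hp t⟩
    obtain ⟨y, hy, h⟩ := hP.exists_mem_Ico₀ Real.two_pi_pos t
    rw [Prod.mk.injEq] at h
    rw [h.1, h.2]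
    exact hγ' y (by simpa using hy)
  · obtain ⟨lK, hlK, hlKc, hl⟩ := hK K
    obtain ⟨C', hC'⟩ := exists_bddDerivs_prof hlK hlKc
    have hrp : ∀ j : ℕ, Rapid (fun n : ℤ => fcoef 1 0 γ n * (n : ℂ) ^ j) (fun n : ℤ => (n : ℂ)) := fun j => by
      induction j with
      | zero => simpa using hr
      | succ j ih => simpa only [pow_succ, ← mul_assoc] using ih.mul_freq
    refine ⟨fun z => I / 2 * dser (fun n : ℤ => fcoef 1 0 γ n * (n : ℂ) ^ (K + 1)) (fun n : ℤ => (n : ℂ)) (prof lK) z,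
      contDiff_const.mul (contDiff_dser (hrp _) hC'), fun z => by simp only [hper], fun z => ?_⟩
    rw [dbar_dser hr hC]
    simp only [dser]
    rw [← tsum_mul_left, ← tsum_mul_left]
    refine tsum_congr fun n => ?_
    rw [dbar_prof hk, prof, prof, hkl, hl, map_intCast]
    have : ((n : ℂ) * z).im = n * z.im := by simp
    rw [this]; push_cast; ring

/-! ### Thin strips around smooth periodic curves -/

/-- Smooth local inverses at points with positive Jacobian. -/
lemma exists_localInverse {f : ℂ → ℂ} {z : ℂ} (hf : ContDiffAt ℝ ∞ f z)
    (hJ : ‖dbar f z‖ < ‖dz f z‖) :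
    ∃ e : OpenPartialHomeomorph ℂ ℂ, z ∈ e.source ∧ (∀ x, e x = f x) ∧
      ContDiffAt ℝ ∞ e.symm (f z) := by
  have hd : HasFDerivAt f (wirt (dz f z) (dbar f z)) z := (hf.differentiableAt (by simp)).hasWirt
  have hdet : (wirt (dz f z) (dbar f z)).det ≠ 0 := by
    rw [det_wirt]
    have := pow_lt_pow_left₀ hJ (norm_nonneg _) two_ne_zero
    linarith
  rw [← ContinuousLinearMap.coe_toContinuousLinearEquivOfDetNeZero _ hdet] at hd
  exact ⟨hf.toOpenPartialHomeomorph f hd (by simp), hf.mem_toOpenPartialHomeomorph_source hd (by simp),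
    fun x => rfl, hf.to_localInverse hd (by simp)⟩

lemma exists_int_shift (z : ℂ) : ∃ k : ℤ, (z + k * (2 * Real.pi : ℂ)).re ∈ Icc 0 (2 * Real.pi) := by
  obtain ⟨k, hk, -⟩ := existsUnique_add_zsmul_mem_Ico Real.two_pi_pos z.re 0
  refine ⟨k, ?_⟩
  have : (z + k * (2 * Real.pi : ℂ)).re = z.re + k • (2 * Real.pi) := by simp
  rw [this]
  exact ⟨hk.1, by simpa using hk.2.le⟩

lemma exists_strip {P : ℂ → ℂ → Prop}
    (hP : ∀ z w (k l : ℤ), P (z + k * (2 * Real.pi : ℂ)) (w + l * (2 * Real.pi : ℂ)) → P z w)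
    (h0 : ∀ t t' : ℝ, ∀ᶠ p in 𝓝 ((t : ℂ), (t' : ℂ)), P p.1 p.2) :
    ∃ σ > 0, ∀ z w : ℂ, |z.im| < σ → |w.im| < σ → P z w := by
  set K : Set ℂ := (fun t : ℝ => (t : ℂ)) '' Icc 0 (2 * Real.pi)
  have hK : IsCompact (K ×ˢ K) :=
    (isCompact_Icc.image continuous_ofReal).prod (isCompact_Icc.image continuous_ofReal)
  have hsub : K ×ˢ K ⊆ interior {p : ℂ × ℂ | P p.1 p.2} := by
    rintro ⟨_, _⟩ ⟨⟨t, -, rfl⟩, ⟨t', -, rfl⟩⟩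
    exact mem_interior_iff_mem_nhds.2 (h0 t t')
  obtain ⟨σ, hσ, h⟩ := hK.exists_thickening_subset_open isOpen_interior hsub
  refine ⟨σ, hσ, fun z w hz hw => ?_⟩
  obtain ⟨k, hk⟩ := exists_int_shift z
  obtain ⟨l, hl⟩ := exists_int_shift w
  refine hP z w k l (show (_, _) ∈ {p : ℂ × ℂ | P p.1 p.2} from interior_subset (h (mem_thickening_iff.2 ⟨(((z + k * (2 * Real.pi : ℂ)).re : ℝ),
    ((w + l * (2 * Real.pi : ℂ)).re : ℝ)), ⟨⟨_, hk, rfl⟩, ⟨_, hl, rfl⟩⟩, ?_⟩)))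
  have hd : ∀ v : ℂ, dist v (v.re : ℂ) = |v.im| := fun v => by
    rw [dist_eq_norm]
    have : v - v.re = v.im * I := by apply Complex.ext <;> simp
    rw [this, norm_mul, norm_I, mul_one, norm_real, Real.norm_eq_abs]
  rw [Prod.dist_eq, hd, hd, max_lt_iff]
  simpa using ⟨hz, hw⟩

/-- A finite family of boundary-flat smooth periodic maps of a thin strip, jointly injective modulo the
period. -/
structure CollarMap {n : ℕ} (Γ : Fin n → ℂ → ℂ) (σ : ℝ) : Prop where
  pos : 0 < σ
  smooth : ∀ i, ContDiff ℝ ∞ (Γ i)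
  per : ∀ i, Function.Periodic (Γ i) (2 * Real.pi : ℂ)
  inj : ∀ i j z w, |z.im| < σ → |w.im| < σ → Γ i z = Γ j w →
    i = j ∧ ∃ k : ℤ, w = z + k * (2 * Real.pi : ℂ)
  jac : ∀ i z, |z.im| < σ → ‖dbar (Γ i) z‖ < ‖dz (Γ i) z‖
  flat : ∀ i (K : ℕ), ∃ B : ℂ → ℂ, ContDiff ℝ ∞ B ∧ Function.Periodic B (2 * Real.pi : ℂ) ∧
    ∀ z, dbar (Γ i) z = z.im ^ K * B z

lemma dz_periodic {f : ℂ → ℂ} {c : ℂ} (h : Function.Periodic f c) : Function.Periodic (dz f) c := fun z => by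
  have : (fun x => f (x + c)) = f := funext h
  rw [dz, dz, ← fderiv_comp_add_right, this]

lemma dbar_periodic {f : ℂ → ℂ} {c : ℂ} (h : Function.Periodic f c) : Function.Periodic (dbar f) c := fun z => by
  have : (fun x => f (x + c)) = f := funext h
  rw [dbar, dbar, ← fderiv_comp_add_right, this]

theorem exists_collarMap {n : ℕ} {γ : Fin n → ℝ → ℂ} (hγ : ∀ i, ContDiff ℝ ∞ (γ i))
    (hp : ∀ i, Function.Periodic (γ i) (2 * Real.pi)) (hi : ∀ i, InjOn (γ i) (Ico 0 (2 * Real.pi)))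
    (hd : ∀ i t, deriv (γ i) t ≠ 0)
    (hdis : Pairwise fun i j => Disjoint (range (γ i)) (range (γ j))) :
    ∃ (Γ : Fin n → ℂ → ℂ) (σ : ℝ), CollarMap Γ σ ∧ ∀ i (t : ℝ), Γ i t = γ i t := by
  choose Γ hΓ hper hΓγ hflat using fun i => exists_almostAnalytic (hγ i) (hp i)
  have hper' : ∀ i, Function.Periodic (Γ i) (2 * Real.pi : ℂ) := hper
  have hjac0 : ∀ i (t : ℝ), ‖dbar (Γ i) t‖ < ‖dz (Γ i) t‖ := fun i t => by
    obtain ⟨B, -, -, hB⟩ := hflat i 1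
    have h0 : dbar (Γ i) t = 0 := by rw [hB]; simp
    rw [h0, norm_zero, norm_pos_iff]
    have h1 : HasDerivAt (fun t : ℝ => Γ i t) (dz (Γ i) t) t := by
      have h2 := ((hΓ i).diffAt t).hasWirt.comp_hasDerivAt t (ofRealCLM.hasDerivAt (x := t))
      simp only [h0, wirt_apply, zero_mul, add_zero, ofRealCLM_apply, ofReal_one, mul_one] at h2
      exact h2
    have h3 : (fun t : ℝ => Γ i t) = γ i := funext (hΓγ i)
    rw [h3] at h1
    rw [← h1.deriv]; exact hd i t
  have hinjt : ∀ i (t t' : ℝ), γ i t = γ i t' → ∃ k : ℤ, t' = t + k * (2 * Real.pi) := fun i t t' h => by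
    obtain ⟨k, hk, -⟩ := existsUnique_add_zsmul_mem_Ico Real.two_pi_pos t 0
    obtain ⟨l, hl, -⟩ := existsUnique_add_zsmul_mem_Ico Real.two_pi_pos t' 0
    rw [zero_add, zsmul_eq_mul] at hk hl
    have := hi i hk hl (by rw [(hp i).int_mul k, (hp i).int_mul l, h])
    exact ⟨k - l, by push_cast; linarith⟩
  have hev : ∀ i j : Fin n, ∃ σ > 0, ∀ z w : ℂ, |z.im| < σ → |w.im| < σ → (Γ i z = Γ j w →
      i = j ∧ ∃ k : ℤ, w = z + k * (2 * Real.pi : ℂ)) ∧ ‖dbar (Γ i) z‖ < ‖dz (Γ i) z‖ := fun i j => by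
    refine exists_strip (fun z w k l h => ⟨fun hzw => ?_, ?_⟩) fun t t' => ?_
    · obtain ⟨hij, m, hm⟩ := h.1 (by rw [(hper' i).int_mul k, (hper' j).int_mul l, hzw])
      exact ⟨hij, k + m - l, by push_cast; linear_combination hm⟩
    · have := h.2
      rwa [(dz_periodic (hper' i)).int_mul k, (dbar_periodic (hper' i)).int_mul k] at this
    · refine Filter.Eventually.and ?_ ?_
      · by_cases hne : γ i t = γ j t'
        · have hij : i = j := by
            by_contra hij
            exact Set.disjoint_left.1 (hdis hij) (mem_range_self t) (hne ▸ mem_range_self t')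
          subst hij
          obtain ⟨k, hk⟩ := hinjt i t t' hne
          obtain ⟨e, he, hee, -⟩ := exists_localInverse (hΓ i).contDiffAt (hjac0 i t)
          have h1 : ∀ᶠ p in 𝓝 ((t : ℂ), (t' : ℂ)), p.1 ∈ e.source :=
            continuous_fst.continuousAt.eventually (e.open_source.mem_nhds he)
          have h2 : ∀ᶠ p in 𝓝 ((t : ℂ), (t' : ℂ)), p.2 - k * (2 * Real.pi : ℂ) ∈ e.source := by
            have hcs : Continuous fun p : ℂ × ℂ => p.2 - k * (2 * Real.pi : ℂ) := by fun_prop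
            refine hcs.continuousAt.eventually (e.open_source.mem_nhds ?_)
            convert he using 1
            simp [hk]
          filter_upwards [h1, h2] with p hp1 hp2 heq
          refine ⟨rfl, k, ?_⟩
          have := e.injOn hp1 hp2 (by
            rw [hee, hee, heq, ← (hper' i).int_mul k (p.2 - _), sub_add_cancel])
          rw [this]; ring
        · have : ∀ᶠ p in 𝓝 ((t : ℂ), (t' : ℂ)), Γ i p.1 ≠ Γ j p.2 := by
            have h1 := ((hΓ i).continuous.comp continuous_fst).sub
              ((hΓ j).continuous.comp continuous_snd)
            have h2 := h1.continuousAt.eventually_ne (x := ((t : ℂ), (t' : ℂ))) (y := 0)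
              (by simpa [hΓγ, sub_eq_zero] using hne)
            simpa [sub_eq_zero] using h2
          filter_upwards [this] with p hp h
          exact absurd h hp
      · refine ContinuousAt.eventually_lt (f := fun p : ℂ × ℂ => ‖dbar (Γ i) p.1‖)
          (g := fun p : ℂ × ℂ => ‖dz (Γ i) p.1‖) ?_ ?_ (hjac0 i t)
        · exact ((hΓ i).dbar.continuous.comp continuous_fst).norm.continuousAt
        · exact ((hΓ i).dz.continuous.comp continuous_fst).norm.continuousAt
  choose σ hσ hσP using hev
  obtain ⟨s, hs, hsσ⟩ : ∃ s > 0, ∀ p : Fin n × Fin n, s ≤ σ p.1 p.2 := by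
    by_cases hn : Nonempty (Fin n × Fin n)
    · obtain ⟨p, hp⟩ := Finite.exists_min fun p : Fin n × Fin n => σ p.1 p.2
      exact ⟨σ p.1 p.2, hσ _ _, hp⟩
    · exact ⟨1, one_pos, fun p => (hn ⟨p⟩).elim⟩
  exact ⟨Γ, s, ⟨hs, hΓ, hper', fun i j z w hz hw => (hσP i j z w (hz.trans_le (hsσ (i, j)))
    (hw.trans_le (hsσ (i, j)))).1, fun i z hz => (hσP i i z z (hz.trans_le (hsσ (i, i)))
    (hz.trans_le (hsσ (i, i)))).2, hflat⟩, hΓγ⟩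

/-- The union of the images of the strip. -/
def collarNbd {n : ℕ} (Γ : Fin n → ℂ → ℂ) (σ : ℝ) : Set ℂ :=
  {z | ∃ p : Fin n × ℂ, |p.2.im| < σ ∧ Γ p.1 p.2 = z}

open Classical in
/-- The function on the collar induced by periodic functions on the strip. -/
def collarDesc {n : ℕ} (Γ : Fin n → ℂ → ℂ) (σ : ℝ) {E : Type*} [Zero E] (q : Fin n → ℂ → E) (z : ℂ) : E :=
  if h : z ∈ collarNbd Γ σ then q h.choose.1 h.choose.2 else 0

lemma isOpen_strip (σ : ℝ) : IsOpen {z : ℂ | |z.im| < σ} :=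
  isOpen_lt (continuous_im.abs) continuous_const

namespace CollarMap
variable {n : ℕ} {Γ : Fin n → ℂ → ℂ} {σ : ℝ}

lemma desc_apply (h : CollarMap Γ σ) {E : Type*} [Zero E] {q : Fin n → ℂ → E}
    (hq : ∀ i, Function.Periodic (q i) (2 * Real.pi : ℂ)) (i : Fin n) {z : ℂ} (hz : |z.im| < σ) :
    collarDesc Γ σ q (Γ i z) = q i z := by
  have hm : Γ i z ∈ collarNbd Γ σ := ⟨(i, z), hz, rfl⟩
  rw [collarDesc, dif_pos hm]
  obtain ⟨hij, k, hk⟩ := h.inj _ _ _ _ hm.choose_spec.1 hz hm.choose_spec.2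
  have h2 : q i z = q hm.choose.1 hm.choose.2 := by
    rw [congrArg (q i) hk, (hq _).int_mul k]
    exact congrArg (fun j => q j hm.choose.2) hij.symm
  exact h2.symm

lemma exists_local (h : CollarMap Γ σ) (i : Fin n) {z : ℂ} (hz : |z.im| < σ) :
    ∃ e : OpenPartialHomeomorph ℂ ℂ, z ∈ e.source ∧ e.source ⊆ {z | |z.im| < σ} ∧ (∀ x, e x = Γ i x) ∧
      ContDiffAt ℝ ∞ e.symm (Γ i z) := by
  obtain ⟨e, he, hee, hs⟩ := exists_localInverse (h.smooth i).contDiffAt (h.jac i z hz)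
  exact ⟨e.restrOpen _ (isOpen_strip σ), ⟨he, hz⟩, fun x hx => hx.2, hee, hs⟩

lemma image_mem_nhds (h : CollarMap Γ σ) (i : Fin n) {z : ℂ} (hz : |z.im| < σ) {s : Set ℂ}
    (hs : s ∈ 𝓝 z) : Γ i '' s ∈ 𝓝 (Γ i z) := by
  obtain ⟨e, he, -, hee, -⟩ := h.exists_local i hz
  have := e.image_mem_nhds he hs
  rw [hee] at this
  have h2 : (e : ℂ → ℂ) = Γ i := funext hee
  rwa [h2] at this

lemma isOpen_nbd (h : CollarMap Γ σ) : IsOpen (collarNbd Γ σ) := by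
  rw [isOpen_iff_mem_nhds]
  rintro _ ⟨⟨i, z⟩, hz, rfl⟩
  refine Filter.mem_of_superset (h.image_mem_nhds i hz ((isOpen_strip σ).mem_nhds hz)) ?_
  rintro _ ⟨w, hw, rfl⟩
  exact ⟨(i, w), hw, rfl⟩

lemma contDiffAt_desc (h : CollarMap Γ σ) {E : Type*} [NormedAddCommGroup E] [NormedSpace ℝ E]
    {q : Fin n → ℂ → E} (hq : ∀ i, Function.Periodic (q i) (2 * Real.pi : ℂ)) (i : Fin n) {z : ℂ}
    (hz : |z.im| < σ) (hs : ContDiffAt ℝ ∞ (q i) z) : ContDiffAt ℝ ∞ (collarDesc Γ σ q) (Γ i z) := by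
  obtain ⟨e, he, hes, hee, hsm⟩ := h.exists_local i hz
  have h1 : e.symm (Γ i z) = z := by rw [← hee, e.left_inv he]
  have h2 : ContDiffAt ℝ ∞ (fun w => q i (e.symm w)) (Γ i z) :=
    ContDiffAt.comp (Γ i z) (by rwa [h1]) hsm
  refine h2.congr_of_eventuallyEq ?_
  have : e.target ∈ 𝓝 (Γ i z) := e.open_target.mem_nhds (by rw [← hee]; exact e.map_source he)
  filter_upwards [this] with w hw
  have hw' := e.map_target hw
  conv_lhs => rw [← e.right_inv hw, hee, h.desc_apply hq i (hes hw')]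

lemma contDiffOn_desc (h : CollarMap Γ σ) {E : Type*} [NormedAddCommGroup E] [NormedSpace ℝ E]
    {q : Fin n → ℂ → E} (hq : ∀ i, Function.Periodic (q i) (2 * Real.pi : ℂ))
    (hs : ∀ i z, |z.im| < σ → ContDiffAt ℝ ∞ (q i) z) :
    ContDiffOn ℝ ∞ (collarDesc Γ σ q) (collarNbd Γ σ) := by
  rintro _ ⟨⟨i, z⟩, hz, rfl⟩
  exact (h.contDiffAt_desc hq i hz (hs i z hz)).contDiffWithinAt

lemma desc_of_notMem {E : Type*} [Zero E] (q : Fin n → ℂ → E) {z : ℂ} (hz : z ∉ collarNbd Γ σ) :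
    collarDesc Γ σ q z = 0 := dif_neg hz

/-- The image of a closed substrip is compact. -/
lemma isCompact_image (h : CollarMap Γ σ) (i : Fin n) (c : ℝ) :
    IsCompact (Γ i '' {z | |z.im| ≤ c}) := by
  have he : Γ i '' {z | |z.im| ≤ c} = Γ i '' ((fun p : ℝ × ℝ => (p.1 + p.2 * I : ℂ)) '' (Icc 0 (2 * Real.pi) ×ˢ Icc (-c) c)) := by
    apply Subset.antisymm
    · rintro _ ⟨z, hz, rfl⟩
      obtain ⟨k, hk⟩ := exists_int_shift z
      refine ⟨_, ⟨((z + k * (2 * Real.pi : ℂ)).re, (z + k * (2 * Real.pi : ℂ)).im), ⟨hk, ?_⟩, rfl⟩, ?_⟩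
      · have : (z + k * (2 * Real.pi : ℂ)).im = z.im := by simp
        rw [this]; exact abs_le.1 hz
      · simp only [re_add_im]; exact (h.per i).int_mul k z
    · rintro _ ⟨_, ⟨⟨x, y⟩, ⟨-, hy⟩, rfl⟩, rfl⟩
      exact ⟨_, by simpa using abs_le.2 hy, rfl⟩
  rw [he]
  refine ((isCompact_Icc.prod isCompact_Icc).image ?_).image (h.smooth i).continuous
  fun_prop

/-- A connected open set avoiding one of the curves cannot contain both of its sides. -/
lemma not_both_sides (h : CollarMap Γ σ) (i : Fin n) {Ω : Set ℂ} (hΩ : IsOpen Ω)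
    (hc : IsPreconnected Ω) (h0 : ∀ t : ℝ, Γ i t ∉ Ω)
    (h1 : ∀ z, |z.im| < σ → z.im ≠ 0 → Γ i z ∈ Ω) : False := by
  classical
  have hσ := h.pos
  let ψ : ContDiffBump (0 : ℝ) := ⟨σ / 3, 2 * σ / 3, by positivity, by linarith⟩
  let q : Fin n → ℂ → ℝ := fun j z => if j = i ∧ 0 < z.im then ψ z.im else 0
  have hq : ∀ j, Function.Periodic (q j) (2 * Real.pi : ℂ) := fun j z => by simp [q]
  set f := collarDesc Γ σ q with hf
  set C : Set ℂ := Γ i '' {z | |z.im| ≤ 0}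
  have hCc : IsClosed C := (h.isCompact_image i 0).isClosed
  have hCmem : ∀ t : ℝ, Γ i t ∈ C := fun t => ⟨t, by simp, rfl⟩
  have hCΩ : ∀ z ∈ Ω, z ∉ C := by
    rintro _ hz ⟨w, hw, rfl⟩
    have : w = (w.re : ℂ) := by
      apply Complex.ext <;> simp
      simpa using hw
    rw [this] at hz
    exact h0 _ hz
  -- smoothness off the curve
  have hsm : ∀ z ∉ C, ContDiffAt ℝ ∞ f z := by
    intro z hz
    by_cases hzN : z ∈ collarNbd Γ σ
    · obtain ⟨⟨j, w⟩, hw, rfl⟩ := hzN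
      refine h.contDiffAt_desc hq j hw ?_
      by_cases hj : j = i
      · subst hj
        have hw0 : w.im ≠ 0 := fun h0 => hz ⟨w, by simp [h0], rfl⟩
        rcases lt_or_gt_of_ne hw0 with hlt | hgt
        · have : q j =ᶠ[𝓝 w] fun _ => 0 := by
            filter_upwards [(isOpen_lt continuous_im continuous_const).mem_nhds hlt] with v hv
            simp only [q]
            rw [if_neg]
            rintro ⟨-, h⟩
            exact absurd h (not_lt.2 (le_of_lt hv))
          exact contDiffAt_const.congr_of_eventuallyEq this
        · have : q j =ᶠ[𝓝 w] fun z => ψ (imCLM z) := by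
            filter_upwards [(isOpen_lt continuous_const continuous_im).mem_nhds hgt] with v hv
            simp only [q]
            rw [if_pos ⟨trivial, hv⟩]; rfl
          exact (ψ.contDiff.comp imCLM.contDiff).contDiffAt.congr_of_eventuallyEq this
      · have : q j = fun _ => 0 := by ext z; simp [q, hj]
        rw [this]; exact contDiffAt_const
    · have hQ := (h.isCompact_image i (2 * σ / 3)).isClosed
      have hzQ : z ∉ Γ i '' {z | |z.im| ≤ 2 * σ / 3} := by
        rintro ⟨w, hw, rfl⟩
        exact hzN ⟨(i, w), lt_of_le_of_lt hw (by linarith), rfl⟩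
      have : f =ᶠ[𝓝 z] fun _ => 0 := by
        filter_upwards [hQ.isOpen_compl.mem_nhds hzQ] with v hv
        by_cases hvN : v ∈ collarNbd Γ σ
        · obtain ⟨⟨j, w⟩, hw, rfl⟩ := hvN
          rw [hf, h.desc_apply hq j hw]
          simp only [q]
          split_ifs with hj
          · refine ψ.zero_of_le_dist ?_
            obtain ⟨rfl, hj⟩ := hj
            by_contra hlt
            refine hv ⟨w, ?_, rfl⟩
            rw [not_le, Real.dist_eq, sub_zero] at hlt
            exact le_of_lt hlt
          · rfl
        · exact desc_of_notMem _ hvN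
      exact contDiffAt_const.congr_of_eventuallyEq this
  let θ : ℂ → ℂ →L[ℝ] ℝ := fun z => if z ∈ C then 0 else fderiv ℝ f z
  have hθoff : ∀ z ∉ C, θ =ᶠ[𝓝 z] fderiv ℝ f := fun z hz => by
    filter_upwards [hCc.isOpen_compl.mem_nhds hz] with w hw
    exact if_neg hw
  have hθon : ∀ z ∈ C, θ =ᶠ[𝓝 z] fun _ => (0 : ℂ →L[ℝ] ℝ) := by
    rintro _ ⟨t, ht, rfl⟩
    have ht' : |t.im| < σ := lt_of_le_of_lt ht hσ
    have := h.image_mem_nhds i ht' ((isOpen_strip (σ / 3)).mem_nhds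
      (show |t.im| < σ / 3 from lt_of_le_of_lt ht (by linarith)))
    filter_upwards [this]
    rintro _ ⟨w, hw, rfl⟩
    have hw : |w.im| < σ / 3 := hw
    by_cases hwC : Γ i w ∈ C
    · exact if_pos hwC
    · change (if Γ i w ∈ C then (0 : ℂ →L[ℝ] ℝ) else fderiv ℝ f (Γ i w)) = 0
      rw [if_neg hwC]
      have hw0 : w.im ≠ 0 := fun h0 => hwC ⟨w, by simp [h0], rfl⟩
      have hloc : ∃ c : ℝ, ∀ᶠ v in 𝓝 w, |v.im| < σ ∧ q i v = c := by
        have hs := (isOpen_strip (σ / 3)).mem_nhds hw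
        rcases lt_or_gt_of_ne hw0 with hlt | hgt
        · refine ⟨0, ?_⟩
          filter_upwards [hs, (isOpen_lt continuous_im continuous_const).mem_nhds hlt] with v hv hv2
          have hv : |v.im| < σ / 3 := hv
          refine ⟨by linarith, if_neg ?_⟩
          rintro ⟨-, h⟩
          exact absurd h (not_lt.2 (le_of_lt hv2))
        · refine ⟨1, ?_⟩
          filter_upwards [hs, (isOpen_lt continuous_const continuous_im).mem_nhds hgt] with v hv hv2
          have hv : |v.im| < σ / 3 := hv
          refine ⟨by linarith, ?_⟩
          simp only [q]
          rw [if_pos ⟨trivial, hv2⟩]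
          exact ψ.one_of_mem_closedBall (by simpa using hv.le)
      obtain ⟨c, hc⟩ := hloc
      have hcf : f =ᶠ[𝓝 (Γ i w)] fun _ => c := by
        filter_upwards [h.image_mem_nhds i (by linarith) hc]
        rintro _ ⟨v, ⟨hv, hvc⟩, rfl⟩
        rw [hf, h.desc_apply hq i hv, hvc]
      rw [hcf.fderiv_eq]; simp
  obtain ⟨H, hH⟩ : ∃ H : ℂ → ℝ, ∀ a ∈ univ, HasFDerivAt H (θ a) a := by
    refine convex_univ.exists_forall_hasFDerivAt_of_fderiv_symmetric isOpen_univ (fun z _ => ?_) fun z _ x y => ?_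
    · refine DifferentiableAt.differentiableWithinAt ?_
      by_cases hz : z ∈ C
      · exact (hθon z hz).differentiableAt_iff.2 (differentiableAt_const _)
      · refine (hθoff z hz).differentiableAt_iff.2 ?_
        exact ((hsm z hz).fderiv_right (m := ∞) (by simp)).differentiableAt (by simp)
    · by_cases hz : z ∈ C
      · rw [(hθon z hz).fderiv_eq]; simp
      · rw [(hθoff z hz).fderiv_eq]
        exact ((hsm z hz).isSymmSndFDerivAt (by
          simp only [minSmoothness_of_isRCLikeNormedField]
          exact WithTop.coe_le_coe.2 (le_top : (2 : ℕ∞) ≤ ⊤))) x y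
  have hHd : ∀ z, HasFDerivAt H (θ z) z := fun z => hH z (mem_univ z)
  have hconst : ∃ a, ∀ z ∈ Ω, f z - H z = a := by
    refine hΩ.exists_is_const_of_fderiv_eq_zero (𝕜 := ℝ) hc (fun z hz => ?_) fun z hz => ?_
    · exact (((hsm z (hCΩ z hz)).differentiableAt (by simp)).sub (hHd z).differentiableAt).differentiableWithinAt
    · have h1 := ((hsm z (hCΩ z hz)).differentiableAt (by simp)).hasFDerivAt.sub (hHd z)
      have h2 : θ z = fderiv ℝ f z := if_neg (hCΩ z hz)
      rw [h2, sub_self] at h1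
      exact h1.fderiv
  obtain ⟨a, ha⟩ := hconst
  have hHc : Continuous H := continuous_iff_continuousAt.2 fun z => (hHd z).continuousAt
  have hlim : Filter.Tendsto (fun s : ℝ => H (Γ i (s * I)) - H (Γ i (-s * I))) (𝓝[>] 0) (𝓝 0) := by
    have hcont : Continuous fun s : ℝ => H (Γ i (s * I)) - H (Γ i (-s * I)) := by
      have := (h.smooth i).continuous
      fun_prop
    have := (hcont.tendsto 0).mono_left (nhdsWithin_le_nhds (s := Ioi 0))
    simpa using this
  have hone : ∀ᶠ s : ℝ in 𝓝[>] 0, H (Γ i (s * I)) - H (Γ i (-s * I)) = 1 := by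
    filter_upwards [Ioo_mem_nhdsGT (show (0 : ℝ) < σ / 3 by positivity)] with s hs
    have hs0 := hs.1
    have hss := hs.2
    have e1 : f (Γ i (s * I)) = 1 := by
      rw [hf, h.desc_apply hq i (by simp [abs_of_pos hs0]; linarith)]
      simp only [q]
      rw [if_pos ⟨trivial, by simpa using hs0⟩]
      exact ψ.one_of_mem_closedBall (by simpa [abs_of_pos hs0] using hss.le)
    have e2 : f (Γ i (-s * I)) = 0 := by
      rw [hf, h.desc_apply hq i (by simp [abs_of_pos hs0]; linarith)]
      simp only [q]
      rw [if_neg]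
      rintro ⟨-, hp⟩
      simp at hp; linarith
    have m1 := ha _ (h1 (s * I) (by simp [abs_of_pos hs0]; linarith) (by simpa using hs0.ne'))
    have m2 := ha _ (h1 (-s * I) (by simp [abs_of_pos hs0]; linarith) (by simpa using hs0.ne'))
    rw [e1] at m1; rw [e2] at m2
    linarith
  have := tendsto_nhds_unique (hlim.congr' hone) tendsto_const_nhds
  exact one_ne_zero this.symm

end CollarMap

/-- Reversing the orientation of some of the curves. -/
lemma CollarMap.flip {n : ℕ} {Γ : Fin n → ℂ → ℂ} {σ : ℝ} (h : CollarMap Γ σ) (p : Fin n → Prop)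
    [DecidablePred p] : CollarMap (fun i z => if p i then Γ i (-z) else Γ i z) σ := by
  have hneg : ∀ z : ℂ, HasFDerivAt (fun z : ℂ => -z) (wirt (-1) 0) z := fun z => by
    simpa using (hasDerivAt_neg z).hasWirt
  have hd : ∀ i z, dz (fun z => Γ i (-z)) z = -dz (Γ i) (-z) ∧ dbar (fun z => Γ i (-z)) z = -dbar (Γ i) (-z) :=
    fun i z => by
      have := (((h.smooth i).diffAt (-z)).hasWirt.wirt_comp (hneg z)).wirt_eq
      simpa using this
  refine ⟨h.pos, fun i => ?_, fun i => ?_, fun i j z w hz hw he => ?_, fun i z hz => ?_, fun i K => ?_⟩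
  · by_cases hi : p i
    · simp only [hi, if_true]; exact (h.smooth i).comp contDiff_neg
    · simp only [hi, if_false]; exact h.smooth i
  · by_cases hi : p i
    · simp only [hi, if_true]
      intro z
      have := (h.per i) (-z - 2 * Real.pi)
      simp only [sub_add_cancel] at this
      change Γ i (-(z + 2 * Real.pi)) = Γ i (-z)
      rw [this]; congr 1; ring
    · simp only [hi, if_false]; exact h.per i
  · have hz' : |(-z).im| < σ := by simpa using hz
    have hw' : |(-w).im| < σ := by simpa using hw
    have hij : i = j := by
      by_cases hi : p i <;> by_cases hj : p j <;> simp only [hi, hj, if_true, if_false] at he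
      · exact (h.inj _ _ _ _ hz' hw' he).1
      · exact (h.inj _ _ _ _ hz' hw he).1
      · exact (h.inj _ _ _ _ hz hw' he).1
      · exact (h.inj _ _ _ _ hz hw he).1
    subst hij
    refine ⟨rfl, ?_⟩
    by_cases hi : p i <;> simp only [hi, if_true, if_false] at he
    · obtain ⟨-, k, hk⟩ := h.inj _ _ _ _ hz' hw' he
      refine ⟨-k, ?_⟩
      push_cast
      linear_combination -hk
    · exact (h.inj _ _ _ _ hz hw he).2
  · by_cases hi : p i
    · simp only [hi, if_true]
      rw [(hd i z).1, (hd i z).2, norm_neg, norm_neg]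
      exact h.jac i _ (by simpa using hz)
    · simp only [hi, if_false]; exact h.jac i z hz
  · obtain ⟨B, hB, hBp, hBe⟩ := h.flat i K
    by_cases hi : p i
    · refine ⟨fun z => -(-1) ^ K * B (-z), by fun_prop, fun z => ?_, fun z => ?_⟩
      · have := hBp (-z - 2 * Real.pi)
        simp only [sub_add_cancel] at this
        dsimp only
        rw [this]; congr 2; ring
      · simp only [hi, if_true]
        rw [(hd i z).2, hBe, neg_im]
        push_cast
        rw [neg_pow]; ring
    · refine ⟨B, hB, hBp, fun z => ?_⟩
      simp only [hi, if_false]; exact hBe z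

lemma preconnected_disjoint_frontier {Ω t : Set ℂ} (hΩ : IsOpen Ω) (ht : IsPreconnected t)
    (hd : ∀ z ∈ t, z ∉ frontier Ω) : t ⊆ Ω ∨ ∀ z ∈ t, z ∉ closure Ω := by
  refine ht.subset_or_subset (v := (closure Ω)ᶜ) hΩ isClosed_closure.isOpen_compl
    (disjoint_compl_right_iff_subset.2 subset_closure) fun z hz => ?_
  by_cases h : z ∈ Ω
  · exact Or.inl h
  · exact Or.inr fun hc => hd z hz (by rw [hΩ.frontier_eq]; exact ⟨hc, h⟩)

/-- A collar of the boundary whose lower sides lie in the domain. -/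
theorem exists_orientedCollar {Ω : Set ℂ} (hΩo : IsOpen Ω) (hΩc : IsConnected Ω)
    (hsm : HasSmoothBoundary Ω) :
    ∃ (n : ℕ) (Γ : Fin n → ℂ → ℂ) (σ : ℝ), CollarMap Γ σ ∧
      frontier Ω = ⋃ i, range (fun t : ℝ => Γ i t) ∧
      (∀ i z, |z.im| < σ → z.im < 0 → Γ i z ∈ Ω) ∧
      ∀ i z, |z.im| < σ → 0 < z.im → Γ i z ∉ closure Ω := by
  classical
  obtain ⟨-, n, γ, hγ, hp, hi, hd, hdis, hfr⟩ := hsm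
  obtain ⟨Γ, σ, hC, hΓγ⟩ := exists_collarMap hγ hp hi hd hdis
  have hfr' : frontier Ω = ⋃ i, range (fun t : ℝ => Γ i t) := by simp only [hΓγ, hfr]
  have hσ := hC.pos
  have hoff : ∀ i z, |z.im| < σ → z.im ≠ 0 → Γ i z ∉ frontier Ω := by
    intro i z hz h0 hmem
    rw [hfr', mem_iUnion] at hmem
    obtain ⟨j, t, ht⟩ := hmem
    obtain ⟨-, k, hk⟩ := hC.inj _ _ _ _ hz (by simpa using hσ) ht.symm
    exact h0 (by simpa using (congrArg im hk).symm)
  have hlow : ∀ i, (∀ z, |z.im| < σ → z.im < 0 → Γ i z ∈ Ω) ∨ ∀ z, |z.im| < σ → z.im < 0 → Γ i z ∉ closure Ω := by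
    intro i
    have hconv : Convex ℝ {z : ℂ | -σ < z.im ∧ z.im < 0} :=
      (convex_halfSpace_im_gt (-σ)).inter (convex_halfSpace_im_lt 0)
    have := preconnected_disjoint_frontier hΩo
      (hconv.isPreconnected.image _ (hC.smooth i).continuous.continuousOn) (by
        rintro _ ⟨z, ⟨h1, h2⟩, rfl⟩
        exact hoff i z (abs_lt.2 ⟨h1, by linarith⟩) h2.ne)
    exact this.imp (fun h z hz h0 => h ⟨z, ⟨(abs_lt.1 hz).1, h0⟩, rfl⟩)
      fun h z hz h0 => h _ ⟨z, ⟨(abs_lt.1 hz).1, h0⟩, rfl⟩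
  have hup : ∀ i, (∀ z, |z.im| < σ → 0 < z.im → Γ i z ∈ Ω) ∨ ∀ z, |z.im| < σ → 0 < z.im → Γ i z ∉ closure Ω := by
    intro i
    have hconv : Convex ℝ {z : ℂ | 0 < z.im ∧ z.im < σ} :=
      (convex_halfSpace_im_gt 0).inter (convex_halfSpace_im_lt σ)
    have := preconnected_disjoint_frontier hΩo
      (hconv.isPreconnected.image _ (hC.smooth i).continuous.continuousOn) (by
        rintro _ ⟨z, ⟨h1, h2⟩, rfl⟩
        exact hoff i z (abs_lt.2 ⟨by linarith, h2⟩) h1.ne')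
    exact this.imp (fun h z hz h0 => h ⟨z, ⟨h0, (abs_lt.1 hz).2⟩, rfl⟩)
      fun h z hz h0 => h _ ⟨z, ⟨h0, (abs_lt.1 hz).2⟩, rfl⟩
  have hcurve : ∀ i (t : ℝ), Γ i t ∈ frontier Ω := fun i t => by
    rw [hfr']; exact mem_iUnion.2 ⟨i, t, rfl⟩
  have hcurve' : ∀ i (t : ℝ), Γ i t ∉ Ω := fun i t h => by
    have := hcurve i t
    rw [hΩo.frontier_eq] at this
    exact this.2 h
  have hreal : ∀ z : ℂ, z.im = 0 → z = (z.re : ℂ) := fun z hz => by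
    apply Complex.ext <;> simp [hz]
  have hone : ∀ i, ((∀ z, |z.im| < σ → z.im < 0 → Γ i z ∈ Ω) ∧ ∀ z, |z.im| < σ → 0 < z.im → Γ i z ∉ closure Ω) ∨
      ((∀ z, |z.im| < σ → z.im < 0 → Γ i z ∉ closure Ω) ∧ ∀ z, |z.im| < σ → 0 < z.im → Γ i z ∈ Ω) := by
    intro i
    rcases hlow i with hl | hl <;> rcases hup i with hu | hu
    · exfalso
      refine hC.not_both_sides i hΩo hΩc.isPreconnected (hcurve' i) fun z hz h0 => ?_
      rcases lt_or_gt_of_ne h0 with h | h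
      · exact hl z hz h
      · exact hu z hz h
    · exact Or.inl ⟨hl, hu⟩
    · exact Or.inr ⟨hl, hu⟩
    · exfalso
      have hcl : Γ i ((0 : ℝ) : ℂ) ∈ closure Ω := frontier_subset_closure (hcurve i 0)
      have hN := hC.image_mem_nhds i (z := ((0 : ℝ) : ℂ)) (by simpa using hσ)
        ((isOpen_strip σ).mem_nhds (show |((0 : ℝ) : ℂ).im| < σ by simpa using hσ))
      obtain ⟨_, ⟨z, hz, rfl⟩, hzΩ⟩ := mem_closure_iff_nhds.1 hcl _ hN
      rcases lt_trichotomy z.im 0 with h | h | h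
      · exact hl z hz h (subset_closure hzΩ)
      · rw [hreal z h] at hzΩ; exact hcurve' i _ hzΩ
      · exact hu z hz h (subset_closure hzΩ)
  let p : Fin n → Prop := fun i => ∀ z, |z.im| < σ → 0 < z.im → Γ i z ∈ Ω
  have hpn : ∀ i, ¬ p i → ((∀ z, |z.im| < σ → z.im < 0 → Γ i z ∈ Ω) ∧ ∀ z, |z.im| < σ → 0 < z.im → Γ i z ∉ closure Ω) :=
    fun i hi => (hone i).resolve_right fun h => hi h.2
  have hhalf : |((σ / 2 : ℝ) * I).im| < σ := by
    simp only [im_ofReal_mul, I_im, mul_one]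
    rw [abs_of_pos (by positivity)]; linarith
  have hpp : ∀ i, p i → ∀ z, |z.im| < σ → z.im < 0 → Γ i z ∉ closure Ω := fun i hi =>
    ((hone i).resolve_left fun h => h.2 ((σ / 2 : ℝ) * I) hhalf
      (by simp [hσ]) (subset_closure (hi _ hhalf (by simp [hσ])))).1
  refine ⟨n, _, σ, hC.flip p, ?_, fun i z hz h0 => ?_, fun i z hz h0 => ?_⟩
  · rw [hfr']
    refine iUnion_congr fun i => ?_
    by_cases h : p i
    · simp only [h, if_true]
      ext w
      constructor
      · rintro ⟨t, rfl⟩; exact ⟨-t, by simp⟩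
      · rintro ⟨t, rfl⟩; exact ⟨-t, by simp⟩
    · simp only [h, if_false]
  · by_cases h : p i
    · simp only [h, if_true]
      exact h (-z) (by simpa using hz) (by simpa using h0)
    · simp only [h, if_false]
      exact (hpn i h).1 z hz h0
  · by_cases h : p i
    · simp only [h, if_true]
      exact hpp i h (-z) (by simpa using hz) (by simpa using h0)
    · simp only [h, if_false]
      exact (hpn i h).2 z hz h0

/-- A collar of the boundary of `Ω`: a signed coordinate `s`, a reflection `R` and a Beltrami
coefficient `μ`, flat on the boundary, for which `R` becomes antiholomorphic. -/
structure Collar (Ω N : Set ℂ) (s : ℂ → ℝ) (R μ : ℂ → ℂ) : Prop where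
  isOpen : IsOpen N
  frontier_subset : frontier Ω ⊆ N
  smooth_s : ContDiffOn ℝ ∞ s N
  smooth_R : ContDiffOn ℝ ∞ R N
  maps : ∀ z ∈ N, R z ∈ N
  invol : ∀ z ∈ N, R (R z) = z
  s_R : ∀ z ∈ N, s (R z) = -s z
  s_zero : ∀ z ∈ N, s z = 0 ↔ z ∈ frontier Ω
  s_neg : ∀ z ∈ N, s z < 0 ↔ z ∈ Ω
  R_fix : ∀ z ∈ frontier Ω, R z = z
  flat : ∀ K : ℕ, ∃ b : ℂ → ℂ, ContDiffOn ℝ ∞ b N ∧ ∀ z ∈ N, μ z = s z ^ K * b z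
  reflect : ∀ z ∈ N, dz R z + μ (R z) * conj (dbar R z) = 0

lemma wirt_solve {A B X Y P Q : ℂ} (h1 : X * A + Y * conj B = P) (h2 : X * B + Y * conj A = Q) :
    X * (A * conj A - B * conj B) = P * conj A - Q * conj B ∧
      Y * (A * conj A - B * conj B) = Q * A - P * B := by
  subst h1 h2
  constructor <;> ring

lemma mul_sub_mul_ne_zero {A B A' B' : ℂ} (h : ‖B‖ < ‖A‖) (h' : ‖B'‖ < ‖A'‖) :
    A * A' - B * B' ≠ 0 := by
  intro h0
  have := congrArg norm (sub_eq_zero.1 h0)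
  rw [norm_mul, norm_mul] at this
  nlinarith [norm_nonneg B, norm_nonneg B']

theorem exists_collar {Ω : Set ℂ} (hΩo : IsOpen Ω) (hΩc : IsConnected Ω)
    (hsm : HasSmoothBoundary Ω) : ∃ N s R μ, Collar Ω N s R μ := by
  obtain ⟨n, Γ, σ, h, hfr, hin, hout⟩ := exists_orientedCollar hΩo hΩc hsm
  have hσ := h.pos
  have hcp : ∀ z : ℂ, conj (z + 2 * Real.pi) = conj z + 2 * Real.pi := fun z => by
    apply Complex.ext <;> simp
  have hstrip : ∀ {z : ℂ}, |z.im| < σ → |(conj z).im| < σ := fun hz => by simpa using hz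
  let qs : Fin n → ℂ → ℝ := fun _ z => z.im
  let qR : Fin n → ℂ → ℂ := fun i z => Γ i (conj z)
  let den : Fin n → ℂ → ℂ := fun i z =>
    dz (Γ i) z * dz (Γ i) (conj z) - dbar (Γ i) z * dbar (Γ i) (conj z)
  let qμ : Fin n → ℂ → ℂ := fun i z =>
    -(dbar (Γ i) z * conj (dz (Γ i) (conj z)) - dz (Γ i) z * conj (dbar (Γ i) (conj z))) /
      conj (den i z)
  have hqs : ∀ i, Function.Periodic (qs i) (2 * Real.pi : ℂ) := fun i z => by simp [qs]
  have hqR : ∀ i, Function.Periodic (qR i) (2 * Real.pi : ℂ) := fun i z => by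
    simp only [qR]; rw [hcp, h.per i]
  have hqden : ∀ i, Function.Periodic (den i) (2 * Real.pi : ℂ) := fun i z => by
    simp only [den]
    rw [hcp, dz_periodic (h.per i), dz_periodic (h.per i), dbar_periodic (h.per i),
      dbar_periodic (h.per i)]
  have hqμ : ∀ i, Function.Periodic (qμ i) (2 * Real.pi : ℂ) := fun i z => by
    simp only [qμ]
    rw [hqden i, hcp, dz_periodic (h.per i), dz_periodic (h.per i), dbar_periodic (h.per i),
      dbar_periodic (h.per i)]
  have hconj : ContDiff ℝ ∞ fun z : ℂ => conj z := conjCLE.contDiff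
  have hden0 : ∀ i z, |z.im| < σ → den i z ≠ 0 := fun i z hz =>
    mul_sub_mul_ne_zero (h.jac i z hz) (h.jac i _ (hstrip hz))
  have hA : ∀ i, ContDiff ℝ ∞ (dz (Γ i)) := fun i => (h.smooth i).dz
  have hB : ∀ i, ContDiff ℝ ∞ (dbar (Γ i)) := fun i => (h.smooth i).dbar
  have hA' : ∀ i, ContDiff ℝ ∞ fun z => dz (Γ i) (conj z) := fun i => (hA i).comp hconj
  have hB' : ∀ i, ContDiff ℝ ∞ fun z => dbar (Γ i) (conj z) := fun i => (hB i).comp hconj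
  have hdens : ∀ i, ContDiff ℝ ∞ (den i) := fun i =>
    ((hA i).mul (hA' i)).sub ((hB i).mul (hB' i))
  have hsR : ContDiffOn ℝ ∞ (collarDesc Γ σ qR) (collarNbd Γ σ) :=
    h.contDiffOn_desc hqR fun i z _ => ((h.smooth i).comp hconj).contDiffAt
  have hRmap : ∀ i z, |z.im| < σ → collarDesc Γ σ qR (Γ i z) = Γ i (conj z) :=
    fun i z hz => h.desc_apply hqR i hz
  have hsap : ∀ i z, |z.im| < σ → collarDesc Γ σ qs (Γ i z) = z.im :=
    fun i z hz => h.desc_apply hqs i hz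
  have hreal : ∀ z : ℂ, z.im = 0 → z = (z.re : ℂ) := fun z hz => by
    apply Complex.ext <;> simp [hz]
  have hcurve : ∀ i z, z.im = 0 → Γ i z ∈ frontier Ω := fun i z hz => by
    rw [hfr, hreal z hz]; exact mem_iUnion.2 ⟨i, z.re, rfl⟩
  have hdisj : ∀ z ∈ frontier Ω, z ∉ Ω := fun z hz => by
    rw [hΩo.frontier_eq] at hz; exact hz.2
  refine ⟨collarNbd Γ σ, collarDesc Γ σ qs, collarDesc Γ σ qR, collarDesc Γ σ qμ,
    h.isOpen_nbd, ?_, ?_, hsR, ?_, ?_, ?_, ?_, ?_, ?_, ?_, ?_⟩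
  · rw [hfr]
    rintro _ hz
    obtain ⟨i, t, rfl⟩ := mem_iUnion.1 hz
    exact ⟨(i, t), by simpa using hσ, rfl⟩
  · exact h.contDiffOn_desc hqs fun i z _ => imCLM.contDiff.contDiffAt
  · rintro _ ⟨⟨i, z⟩, hz, rfl⟩
    rw [hRmap i z hz]
    exact ⟨(i, conj z), hstrip hz, rfl⟩
  · rintro _ ⟨⟨i, z⟩, hz, rfl⟩
    rw [hRmap i z hz, hRmap i _ (hstrip hz), conj_conj]
  · rintro _ ⟨⟨i, z⟩, hz, rfl⟩
    rw [hRmap i z hz, hsap i _ (hstrip hz), hsap i z hz, conj_im]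
  · rintro _ ⟨⟨i, z⟩, hz, rfl⟩
    rw [hsap i z hz]
    refine ⟨hcurve i z, fun hm => ?_⟩
    by_contra h0
    rcases lt_or_gt_of_ne h0 with h1 | h1
    · exact hdisj _ hm (hin i z hz h1)
    · exact hout i z hz h1 (frontier_subset_closure hm)
  · rintro _ ⟨⟨i, z⟩, hz, rfl⟩
    rw [hsap i z hz]
    refine ⟨hin i z hz, fun hm => ?_⟩
    by_contra h0
    rcases eq_or_lt_of_le (not_lt.1 h0) with h1 | h1
    · exact hdisj _ (hcurve i z h1.symm) hm
    · exact hout i z hz h1 (subset_closure hm)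
  · rw [hfr]
    rintro _ hz
    obtain ⟨i, t, rfl⟩ := mem_iUnion.1 hz
    dsimp only
    rw [hRmap i t (by simpa using hσ), conj_ofReal]
  · intro K
    choose b hb hbp hbe using fun i => h.flat i K
    let qb : Fin n → ℂ → ℂ := fun i z =>
      -(b i z * conj (dz (Γ i) (conj z)) - (-1) ^ K * dz (Γ i) z * conj (b i (conj z))) /
        conj (den i z)
    have hqb : ∀ i, Function.Periodic (qb i) (2 * Real.pi : ℂ) := fun i z => by
      simp only [qb]
      rw [hqden i, hcp, dz_periodic (h.per i), dz_periodic (h.per i), hbp i, hbp i]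
    refine ⟨collarDesc Γ σ qb, h.contDiffOn_desc hqb fun i z hz => ?_, ?_⟩
    · simp only [qb, div_eq_mul_inv]
      have h1 : ContDiff ℝ ∞ fun z => conj (dz (Γ i) (conj z)) := hconj.comp (hA' i)
      have h2 : ContDiff ℝ ∞ fun z => conj (b i (conj z)) := hconj.comp ((hb i).comp hconj)
      have h3 : ContDiff ℝ ∞ fun z => conj (den i z) := hconj.comp (hdens i)
      refine ContDiffAt.mul ?_ (h3.contDiffAt.inv (by simpa using hden0 i z hz))
      exact ((((hb i).mul h1).sub ((contDiff_const.mul (hA i)).mul h2)).neg).contDiffAt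
    · rintro _ ⟨⟨i, z⟩, hz, rfl⟩
      rw [h.desc_apply hqμ i hz, hsap i z hz, h.desc_apply hqb i hz]
      simp only [qμ, qb]
      rw [hbe i z, hbe i (conj z), conj_im]
      simp only [map_mul, map_pow, ofReal_neg, map_neg, conj_ofReal]
      rw [neg_pow]
      ring
  · rintro _ ⟨⟨i, z⟩, hz, rfl⟩
    have hRd : DifferentiableAt ℝ (collarDesc Γ σ qR) (Γ i z) :=
      hsR.diffAt h.isOpen_nbd ⟨(i, z), hz, rfl⟩
    have hl : HasFDerivAt (fun w => collarDesc Γ σ qR (Γ i w)) _ z :=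
      hRd.hasWirt.wirt_comp ((h.smooth i).diffAt z).hasWirt
    have hr : HasFDerivAt (fun w => Γ i (conj w)) _ z :=
      ((h.smooth i).diffAt (conj z)).hasWirt.wirt_comp (hasFDerivAt_conj z)
    have heq : (fun w => collarDesc Γ σ qR (Γ i w)) =ᶠ[𝓝 z] fun w => Γ i (conj w) := by
      filter_upwards [(isOpen_strip σ).mem_nhds hz] with w hw using hRmap i w hw
    have := (hr.congr_of_eventuallyEq heq).unique hl
    obtain ⟨e1, e2⟩ := wirt_inj this
    simp only [mul_zero, map_one, mul_one, zero_add, map_zero, add_zero] at e1 e2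
    obtain ⟨f1, f2⟩ := wirt_solve e1.symm e2.symm
    set X := dz (collarDesc Γ σ qR) (Γ i z)
    set Y := dbar (collarDesc Γ σ qR) (Γ i z)
    rw [hRmap i z hz, h.desc_apply hqμ i (hstrip hz)]
    simp only [qμ, den, conj_conj]
    set A := dz (Γ i) z
    set B := dbar (Γ i) z
    set A' := dz (Γ i) (conj z)
    set B' := dbar (Γ i) (conj z)
    have hJ : A * conj A - B * conj B ≠ 0 := by
      have h1 := h.jac i z hz
      exact mul_sub_mul_ne_zero h1 (by simpa using h1)
    have hD : conj (A' * A - B' * B) ≠ 0 := by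
      have := mul_sub_mul_ne_zero (h.jac i _ (hstrip hz)) (h.jac i z hz)
      exact (map_ne_zero (starRingEnd ℂ)).2 this
    have f2' := congrArg conj f2
    have hJ' : conj (A * conj A - B * conj B) = A * conj A - B * conj B := by
      simp only [map_sub, map_mul, conj_conj]; ring
    rw [map_mul, hJ'] at f2'
    have : (X + -(B' * conj A - A' * conj B) / conj (A' * A - B' * B) * conj Y) *
        (A * conj A - B * conj B) = 0 := by
      rw [add_mul, mul_assoc, f2', f1, div_mul_cancel₀ _ hD]; ring
    exact (mul_eq_zero.1 this).resolve_right hJ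

/-- The boundary of a smoothly bounded domain is a null set. -/
lemma volume_frontier_eq_zero {Ω : Set ℂ} (hsm : HasSmoothBoundary Ω) : volume (frontier Ω) = 0 := by
  obtain ⟨-, n, γ, hγ, -, -, -, -, hfr⟩ := hsm
  rw [hfr, measure_iUnion_null_iff]
  intro i
  have h1 : range (γ i) ⊆ (fun z : ℂ => γ i z.re) '' univ := by
    rintro _ ⟨t, rfl⟩; exact ⟨t, trivial, by simp⟩
  refine measure_mono_null h1 ?_
  have hd : ∀ t, HasDerivAt (γ i) (deriv (γ i) t) t := fun t =>
    ((hγ i).differentiable (by simp) t).hasDerivAt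
  refine addHaar_image_eq_zero_of_det_fderivWithin_eq_zero volume
    (f' := fun z => (ContinuousLinearMap.toSpanSingleton ℝ (deriv (γ i) z.re)).comp reCLM) ?_ ?_
  · intro z _
    exact ((hd z.re).hasFDerivAt.comp z reCLM.hasFDerivAt).hasFDerivWithinAt
  · intro z _
    rw [ContinuousLinearMap.det]
    refine LinearMap.det_eq_zero_iff_ker_ne_bot.2 fun hb => ?_
    have hI : I ∈ LinearMap.ker (((ContinuousLinearMap.toSpanSingleton ℝ (deriv (γ i) z.re)).comp
      reCLM : ℂ →L[ℝ] ℂ) : ℂ →ₗ[ℝ] ℂ) := by simp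
    rw [hb] at hI
    simp at hI

/-- The truncated power `x ↦ x₊ ^ K`. -/
def posPow (K : ℕ) (x : ℝ) : ℝ := if 0 < x then x ^ K else 0

lemma posPow_succ (K : ℕ) (x : ℝ) : posPow (K + 1) x = x * posPow K x := by
  unfold posPow; split_ifs <;> ring

lemma hasDerivAt_posPow (K : ℕ) (hc : Continuous (posPow (K + 1))) (x : ℝ) :
    HasDerivAt (posPow (K + 2)) ((K + 2 : ℕ) * posPow (K + 1) x) x := by
  rcases lt_trichotomy x 0 with h | h | h
  · have h1 : posPow (K + 2) =ᶠ[𝓝 x] fun _ => 0 := by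
      filter_upwards [Iio_mem_nhds h] with y hy
      exact if_neg (not_lt.2 (le_of_lt hy))
    rw [show posPow (K + 1) x = 0 from if_neg (not_lt.2 h.le), mul_zero]
    exact (hasDerivAt_const x (0 : ℝ)).congr_of_eventuallyEq h1
  · subst h
    have h0 : posPow (K + 1) 0 = 0 := if_neg (lt_irrefl _)
    have h2 : posPow (K + 2) 0 = 0 := if_neg (lt_irrefl _)
    rw [h0, mul_zero, hasDerivAt_iff_tendsto_slope]
    have h1 : Filter.Tendsto (posPow (K + 1)) (𝓝[≠] 0) (𝓝 0) := by
      have := (hc.tendsto 0).mono_left (nhdsWithin_le_nhds (s := {0}ᶜ))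
      rwa [h0] at this
    refine h1.congr' ?_
    filter_upwards [self_mem_nhdsWithin] with y hy
    have hy : y ≠ 0 := hy
    rw [slope_def_field, h2, posPow_succ (K + 1)]
    field_simp
    simp
  · have h1 : posPow (K + 2) =ᶠ[𝓝 x] fun y => y ^ (K + 2) := by
      filter_upwards [Ioi_mem_nhds h] with y hy
      exact if_pos hy
    rw [show posPow (K + 1) x = x ^ (K + 1) from if_pos h]
    simpa using (hasDerivAt_pow (K + 2) x).congr_of_eventuallyEq h1

lemma contDiff_posPow (K : ℕ) : ContDiff ℝ K (posPow (K + 1)) := by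
  induction K with
  | zero =>
    have : posPow 1 = fun x => max x 0 := by
      ext x
      unfold posPow
      split_ifs with h
      · rw [max_eq_left h.le, pow_one]
      · rw [max_eq_right (not_lt.1 h)]
    rw [zero_add, this]
    exact contDiff_zero.2 (by fun_prop)
  | succ K ih =>
    have hd := hasDerivAt_posPow K ih.continuous
    have hK : ((K + 1 : ℕ) : ℕ∞ω) = (K : ℕ∞ω) + 1 := by push_cast; rfl
    rw [hK, contDiff_succ_iff_deriv]
    refine ⟨fun x => (hd x).differentiableAt, by simp, ?_⟩
    rw [show deriv (posPow (K + 1 + 1)) = fun x => ((K + 2 : ℕ) : ℝ) * posPow (K + 1) x from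
      funext fun x => (hd x).deriv]
    exact contDiff_const.mul ih

/-- Smooth compactly supported functions have bounded derivatives. -/
lemma exists_iteratedFDeriv_bound_one {E F : Type*} [NormedAddCommGroup E] [NormedSpace ℝ E]
    [NormedAddCommGroup F] [NormedSpace ℝ F] {f : E → F} {M : ℕ}
    (hf : ContDiff ℝ M f) (hc : HasCompactSupport f) :
    ∃ C, 1 ≤ C ∧ ∀ j ≤ M, ∀ x, ‖iteratedFDeriv ℝ j f x‖ ≤ C := by
  have h : ∀ j : ℕ, ∃ C, j ≤ M → ∀ x, ‖iteratedFDeriv ℝ j f x‖ ≤ C := fun j => by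
    by_cases hj : j ≤ M
    · obtain ⟨C, hC⟩ := (hc.iteratedFDeriv j).exists_bound_of_continuous
        (hf.continuous_iteratedFDeriv (by exact_mod_cast hj))
      exact ⟨C, fun _ => hC⟩
    · exact ⟨0, fun h => absurd h hj⟩
  choose C hC using h
  refine ⟨1 + ∑ j ∈ Finset.range (M + 1), |C j|, ?_, fun j hj x => ?_⟩
  · have : 0 ≤ ∑ j ∈ Finset.range (M + 1), |C j| := Finset.sum_nonneg fun _ _ => abs_nonneg _
    linarith
  · have h1 := hC j hj x
    have h2 : |C j| ≤ ∑ j ∈ Finset.range (M + 1), |C j| :=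
      Finset.single_le_sum (f := fun j => |C j|) (fun _ _ => abs_nonneg _) (Finset.mem_range.2 (by omega))
    have := le_abs_self (C j)
    linarith

/-- A smooth cutoff equal to one near a compact set. -/
lemma exists_cutoff {K U : Set ℂ} (hK : IsCompact K) (hU : IsOpen U) (hKU : K ⊆ U) :
    ∃ χ : ℂ → ℝ, ContDiff ℝ ∞ χ ∧ HasCompactSupport χ ∧ tsupport χ ⊆ U ∧
      ∃ W, IsOpen W ∧ K ⊆ W ∧ W ⊆ U ∧ ∀ z ∈ W, χ z = 1 := by
  obtain ⟨L, hL, hKL, hLU⟩ := exists_compact_between hK hU hKU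
  obtain ⟨L', hL', hLL', hL'U⟩ := exists_compact_between hL hU hLU
  obtain ⟨f, hf, hr, hs, h1⟩ := exists_contMDiff_support_eq_eq_one_iff (modelWithCornersSelf ℝ ℂ)
    (n := ⊤) isOpen_interior hL.isClosed hLL'
  have hts : tsupport f ⊆ L' := by
    rw [tsupport, hs]
    exact closure_minimal interior_subset hL'.isClosed
  refine ⟨f, hf.contDiff, HasCompactSupport.of_support_subset_isCompact hL' ?_, hts.trans hL'U,
    interior L, isOpen_interior, hKL, interior_subset.trans hLU, fun z hz => (h1 z).1 (interior_subset hz)⟩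
  exact (subset_tsupport f).trans hts

lemma contDiff_mul_of_contDiffOn {E : Type*} [NormedAddCommGroup E] [NormedSpace ℝ E] {U : Set ℂ}
    {χ : ℂ → ℝ} {f : ℂ → E}
    (hU : IsOpen U) (hχ : ContDiff ℝ ∞ χ) (hs : tsupport χ ⊆ U) (hf : ContDiffOn ℝ ∞ f U) :
    ContDiff ℝ ∞ fun z => χ z • f z := by
  rw [contDiff_iff_contDiffAt]
  intro z
  by_cases hz : z ∈ U
  · exact hχ.contDiffAt.smul ((hf z hz).contDiffAt (hU.mem_nhds hz))
  · have : (fun z => χ z • f z) =ᶠ[𝓝 z] fun _ => 0 := by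
      filter_upwards [(isClosed_tsupport χ).isOpen_compl.mem_nhds fun h => hz (hs h)] with w hw
      rw [image_eq_zero_of_notMem_tsupport hw, zero_smul]
    exact contDiffAt_const.congr_of_eventuallyEq this

/-- The Beltrami coefficient of a collar extends by zero to the domain, after cutting off, with
arbitrarily small derivatives. -/
theorem Collar.exists_small {Ω N U : Set ℂ} {s : ℂ → ℝ} {R μ : ℂ → ℂ} (h : Collar Ω N s R μ)
    (hb : Bornology.IsBounded Ω) (hU : IsOpen U) (hfU : frontier Ω ⊆ U) (M : ℕ) {κ : ℝ} (hκ : 0 < κ) :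
    ∃ (ν : ℂ → ℂ) (W : Set ℂ), ContDiff ℝ ∞ ν ∧ tsupport ν ⊆ U ∧
      (∀ j ≤ M, ∀ z, ‖iteratedFDeriv ℝ j ν z‖ ≤ κ) ∧ (∀ z ∈ Ω, ν z = 0) ∧
      IsOpen W ∧ frontier Ω ⊆ W ∧ W ⊆ N ∧ W ⊆ U ∧ ∀ z ∈ W, z ∉ Ω → ν z = μ z := by
  have hKc : IsCompact (frontier Ω) :=
    hb.isCompact_closure.of_isClosed_subset isClosed_frontier frontier_subset_closure
  obtain ⟨χ, hχ, hχc, hχU, W, hW, hKW, hWU, hχ1⟩ :=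
    exists_cutoff hKc (h.isOpen.inter hU) (subset_inter h.frontier_subset hfU)
  obtain ⟨χ', hχ', hχc', hχN, W', hW', hKW', -, hχ1'⟩ :=
    exists_cutoff hχc h.isOpen (hχU.trans inter_subset_left)
  let s' : ℂ → ℝ := fun z => χ' z • s z
  have hs' : ContDiff ℝ ∞ s' := contDiff_mul_of_contDiffOn h.isOpen hχ' hχN h.smooth_s
  have hs'e : ∀ z, χ z ≠ 0 → s' z = s z := fun z hz => by
    simp only [s', hχ1' z (hKW' (subset_tsupport χ hz)), one_smul]
  have hs'c : HasCompactSupport s' := hχc'.smul_right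
  choose b hbs hbe using h.flat
  let b' : ℕ → ℂ → ℂ := fun K z => χ z • b K z
  have hb' : ∀ K, ContDiff ℝ ∞ (b' K) := fun K =>
    contDiff_mul_of_contDiffOn h.isOpen hχ (hχU.trans inter_subset_left) (hbs K)
  have hb'c : ∀ K, HasCompactSupport (b' K) := fun K => hχc.smul_right
  let ψ : ContDiffBump (0 : ℝ) := ⟨1, 2, by norm_num, by norm_num⟩
  let ρ : ℕ → ℝ → ℝ := fun K x => posPow K x * ψ x
  have hρ : ∀ K : ℕ, ContDiff ℝ K (ρ (K + 1)) := fun K =>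
    (contDiff_posPow K).mul ψ.contDiff
  have hρc : ∀ K : ℕ, HasCompactSupport (ρ K) := fun K => ψ.hasCompactSupport.mul_left
  let ν : ℝ → ℂ → ℂ := fun ε z => if 0 < s z then (ψ (s z / ε) : ℂ) * (χ z • μ z) else 0
  have hνe : ∀ ε, 0 < ε → ∀ K : ℕ, ν ε = fun z => (ε ^ K : ℝ) • (ρ K (s' z / ε) • b' K z) := by
    intro ε hε K
    ext z
    simp only [ν, ρ, b']
    by_cases hz : χ z = 0
    · simp [hz]
    · rw [hs'e z hz, posPow]
      have hzN : z ∈ N := (hχU (subset_tsupport χ hz)).1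
      by_cases h0 : 0 < s z
      · rw [if_pos h0, if_pos (by positivity), hbe K z hzN]
        simp only [real_smul]
        push_cast
        have : (ε : ℂ) ≠ 0 := by exact_mod_cast hε.ne'
        rw [div_pow]
        field_simp
      · rw [if_neg h0, if_neg (by rw [not_lt]; exact div_nonpos_of_nonpos_of_nonneg (not_lt.1 h0) hε.le)]
        simp
  have hν : ∀ ε, 0 < ε → ContDiff ℝ ∞ (ν ε) := by
    intro ε hε
    rw [contDiff_infty]
    intro K
    rw [hνe ε hε (K + 1)]
    have h1 : ContDiff ℝ K fun z => s' z / ε := (hs'.div_const ε).of_le (by exact_mod_cast le_top)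
    have h2 : ContDiff ℝ K fun z => ρ (K + 1) (s' z / ε) := (hρ K).comp h1
    have h3 : ContDiff ℝ K (b' (K + 1)) := (hb' (K + 1)).of_le (by exact_mod_cast le_top)
    have h4 : ContDiff ℝ K fun z => ρ (K + 1) (s' z / ε) • b' (K + 1) z := h2.smul h3
    exact h4.const_smul (ε ^ (K + 1))
  obtain ⟨C₁, hC₁, hC₁b⟩ := exists_iteratedFDeriv_bound_one (hρ M) (hρc _)
  obtain ⟨C₂, hC₂, hC₂b⟩ := exists_iteratedFDeriv_bound_one (M := M) (hs'.of_le (by exact_mod_cast le_top)) hs'c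
  obtain ⟨C₃, hC₃, hC₃b⟩ := exists_iteratedFDeriv_bound_one (M := M)
    ((hb' (M + 1)).of_le (by exact_mod_cast le_top)) (hb'c _)
  have hbound : ∀ ε, 0 < ε → ε ≤ 1 → ∀ j ≤ M, ∀ z, ‖iteratedFDeriv ℝ j (ν ε) z‖ ≤
      ε * (2 ^ M * (M.factorial * C₁ * C₂ ^ M) * C₃) := by
    intro ε hε hε1 j hj z
    have hd : 1 ≤ C₂ / ε := by rw [le_div_iff₀ hε]; linarith
    have h1 : ContDiff ℝ M fun z => s' z / ε := (hs'.div_const ε).of_le (by exact_mod_cast le_top)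
    have hcd : ContDiff ℝ M fun z => ρ (M + 1) (s' z / ε) := (hρ M).comp h1
    have hi : ∀ i ≤ M, ‖iteratedFDeriv ℝ i (fun z => ρ (M + 1) (s' z / ε)) z‖ ≤
        M.factorial * C₁ * (C₂ / ε) ^ M := by
      intro i hi
      have h2 : ‖iteratedFDeriv ℝ i (ρ (M + 1) ∘ fun z => s' z / ε) z‖ ≤
          i.factorial * C₁ * (C₂ / ε) ^ i := by
        refine norm_iteratedFDeriv_comp_le (hρ M) h1 (by exact_mod_cast hi) z
          (fun l hl => hC₁b l (hl.trans hi) _) fun l hl1 hl => ?_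
        have h3 : (fun z => s' z / ε) = fun z => ε⁻¹ • s' z := by
          ext w; simp [div_eq_inv_mul]
        rw [h3, iteratedFDeriv_const_smul_apply' (hs'.contDiffAt.of_le (by exact_mod_cast le_top)), norm_smul]
        calc ‖ε⁻¹‖ * ‖iteratedFDeriv ℝ l s' z‖ ≤ ε⁻¹ * C₂ := by
              rw [Real.norm_of_nonneg (by positivity)]
              gcongr; exact hC₂b l (hl.trans hi) z
          _ = C₂ / ε := by ring
          _ ≤ (C₂ / ε) ^ l := le_self_pow₀ hd (by omega)
      refine h2.trans ?_
      gcongr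
    rw [hνe ε hε (M + 1)]
    have hg : ContDiff ℝ M (b' (M + 1)) := (hb' (M + 1)).of_le (by exact_mod_cast le_top)
    have hsm : ContDiff ℝ M fun z => ρ (M + 1) (s' z / ε) • b' (M + 1) z := hcd.smul hg
    rw [iteratedFDeriv_const_smul_apply' (hsm.contDiffAt.of_le (by exact_mod_cast hj)), norm_smul,
      Real.norm_of_nonneg (by positivity)]
    have h4 := norm_iteratedFDeriv_smul_le hcd hg z (n := j) (by exact_mod_cast hj)
    have h5 : ∑ i ∈ Finset.range (j + 1), (j.choose i : ℝ) *
        ‖iteratedFDeriv ℝ i (fun z => ρ (M + 1) (s' z / ε)) z‖ * ‖iteratedFDeriv ℝ (j - i) (b' (M + 1)) z‖ ≤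
        ∑ i ∈ Finset.range (j + 1), (j.choose i : ℝ) * (M.factorial * C₁ * (C₂ / ε) ^ M) * C₃ := by
      refine Finset.sum_le_sum fun i hi' => ?_
      have : i ≤ j := by simpa [Nat.lt_succ_iff] using hi'
      gcongr
      · exact hi i (this.trans hj)
      · exact hC₃b _ ((Nat.sub_le _ _).trans hj) z
    rw [← Finset.sum_mul, ← Finset.sum_mul, ← Nat.cast_sum, Nat.sum_range_choose] at h5
    have h6 : ((2 ^ j : ℕ) : ℝ) ≤ 2 ^ M := by
      push_cast; exact pow_le_pow_right₀ (by norm_num) hj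
    calc ε ^ (M + 1) * _ ≤ ε ^ (M + 1) * (2 ^ M * (M.factorial * C₁ * (C₂ / ε) ^ M) * C₃) := by
          gcongr
          refine h4.trans (h5.trans ?_)
          gcongr
      _ = ε * (2 ^ M * (M.factorial * C₁ * C₂ ^ M) * C₃) := by
          rw [div_pow]; field_simp; ring
  set A : ℝ := 2 ^ M * (M.factorial * C₁ * C₂ ^ M) * C₃ with hA
  have hA0 : 0 < A := by positivity
  let ε := min 1 (κ / A)
  have hε : 0 < ε := lt_min one_pos (by positivity)
  refine ⟨ν ε, W ∩ {z | z ∈ N ∧ s z < ε}, hν ε hε, ?_, fun j hj z => ?_, fun z hz => ?_, ?_, ?_,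
    fun z hz => hz.2.1, fun z hz => (hWU hz.1).2, ?_⟩
  · have : Function.support (ν ε) ⊆ Function.support χ := by
      intro z hz hz0
      exact hz (by simp [ν, hz0])
    exact (closure_mono this).trans (hχU.trans inter_subset_right)
  · refine (hbound ε hε (min_le_left _ _) j hj z).trans ?_
    calc ε * A ≤ κ / A * A := by gcongr; exact min_le_right _ _
      _ = κ := by field_simp
  · simp only [ν]
    by_cases hχz : χ z = 0
    · simp [hχz]
    · have hzN : z ∈ N := (hχU (subset_tsupport χ hχz)).1
      rw [if_neg (not_lt.2 ((h.s_neg z hzN).2 hz).le)]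
  · refine hW.inter ?_
    exact h.smooth_s.continuousOn.isOpen_inter_preimage h.isOpen isOpen_Iio
  · intro z hz
    exact ⟨hKW hz, h.frontier_subset hz, by rw [(h.s_zero z (h.frontier_subset hz)).2 hz]; exact hε⟩
  · rintro z ⟨hzW, hzN, hzε⟩ hzΩ
    simp only [ν]
    rcases eq_or_lt_of_le (not_lt.1 fun h0 => hzΩ ((h.s_neg z hzN).1 h0)) with h0 | h0
    · rw [← h0, if_neg (lt_irrefl _), hbe 1 z hzN, ← h0]; simp
    · rw [if_pos h0, hχ1 z hzW, one_smul, ψ.one_of_mem_closedBall, ofReal_one, one_mul]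
      simp only [mem_closedBall, Real.dist_eq, sub_zero]
      change |s z / ε| ≤ 1
      rw [abs_of_pos (by positivity), div_le_one hε]
      exact hzε.le

/-- A bounded domain with an antiholomorphic reflection in its boundary. -/
structure SchwarzDomain (D N : Set ℂ) (R : ℂ → ℂ) : Prop where
  isOpen : IsOpen D
  connected : IsConnected D
  bounded : Bornology.IsBounded D
  isOpen_N : IsOpen N
  frontier_subset : frontier D ⊆ N
  smooth : ContDiffOn ℝ ∞ R N
  maps : ∀ z ∈ N, R z ∈ N
  invol : ∀ z ∈ N, R (R z) = z
  fix : ∀ z ∈ frontier D, R z = z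
  swap_in : ∀ z ∈ N, z ∈ D → R z ∉ closure D
  swap_out : ∀ z ∈ N, z ∉ closure D → R z ∈ D
  dz_eq_zero : ∀ z ∈ N, z ∉ frontier D → dz R z = 0
  null : volume (frontier D) = 0

/-- A smooth small perturbation of the identity is a diffeomorphism. -/
lemma exists_homeomorph_of_fderiv_le {F : ℂ → ℂ} (hF : ContDiff ℝ ∞ F)
    (h : ∀ z, ‖fderiv ℝ (fun w => F w - w) z‖ ≤ 1 / 2) :
    ∃ Φ : ℂ ≃ₜ ℂ, (∀ z, Φ z = F z) ∧ ContDiff ℝ ∞ Φ.symm := by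
  have hd : ∀ z, DifferentiableAt ℝ (fun w => F w - w) z := fun z =>
    (hF.sub contDiff_id).diffAt z
  have hA : ApproximatesLinearOn F ((ContinuousLinearEquiv.refl ℝ ℂ : ℂ ≃L[ℝ] ℂ) : ℂ →L[ℝ] ℂ) univ
      (1 / 2 : NNReal) := by
    intro x _ y _
    have := convex_univ.norm_image_sub_le_of_norm_fderiv_le (𝕜 := ℝ) (fun z _ => hd z) (fun z _ => h z)
      (mem_univ y) (mem_univ x)
    rw [show F x - F y - ((ContinuousLinearEquiv.refl ℝ ℂ : ℂ ≃L[ℝ] ℂ) : ℂ →L[ℝ] ℂ) (x - y) =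
      (F x - x) - (F y - y) by simp; ring]
    simpa using this
  have hc : Subsingleton ℂ ∨ (1 / 2 : NNReal) <
      ‖((ContinuousLinearEquiv.refl ℝ ℂ).symm : ℂ →L[ℝ] ℂ)‖₊⁻¹ := by
    right
    have : ((ContinuousLinearEquiv.refl ℝ ℂ).symm : ℂ →L[ℝ] ℂ) = ContinuousLinearMap.id ℝ ℂ := by
      ext; simp
    rw [this, ContinuousLinearMap.nnnorm_id, inv_one]
    exact NNReal.half_lt_self one_ne_zero
  let Φ := hA.toHomeomorph F hc
  have hΦ : ∀ z, Φ z = F z := fun z => rfl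
  refine ⟨Φ, hΦ, ?_⟩
  have hlt : ∀ z, ‖-fderiv ℝ (fun w => F w - w) z‖ < 1 := fun z => by
    rw [norm_neg]; linarith [h z]
  refine Φ.contDiff_symm (f₀' := fun z => ContinuousLinearEquiv.unitsEquiv ℝ ℂ (Units.oneSub _ (hlt z)))
    (fun z => ?_) hF
  have h1 : HasFDerivAt F (ContinuousLinearMap.id ℝ ℂ + fderiv ℝ (fun w => F w - w) z) z := by
    have := (hasFDerivAt_id (𝕜 := ℝ) z).add (hd z).hasFDerivAt
    refine this.congr_of_eventuallyEq (Filter.Eventually.of_forall fun w => ?_)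
    simp
  refine h1.congr_fderiv ?_
  ext v; simp [ContinuousLinearEquiv.unitsEquiv_apply, Units.oneSub]

theorem exists_schwarzDomain {Ω : Set ℂ} (hΩo : IsOpen Ω) (hΩc : IsConnected Ω)
    (hsm : HasSmoothBoundary Ω) (m : ℕ) {η : ℝ} (hη : 0 < η) :
    ∃ (F : ℂ → ℂ) (N : Set ℂ) (R : ℂ → ℂ), ContDiff ℝ ∞ F ∧ DifferentiableOn ℂ F Ω ∧
      Function.Injective F ∧ closure (F '' Ω) = F '' closure Ω ∧
      (∀ j ≤ m, ∀ z ∈ closure Ω, ‖iteratedFDeriv ℝ j (fun w => F w - w) z‖ ≤ η) ∧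
      SchwarzDomain (F '' Ω) N R := by
  obtain ⟨N, s, R, μ, h⟩ := exists_collar hΩo hΩc hsm
  obtain ⟨r, hr0, hr⟩ : ∃ r, 0 < r ∧ closure Ω ⊆ ball 0 r := by
    obtain ⟨r, hr⟩ := hsm.1.closure.subset_ball 0
    exact ⟨max r 1, by positivity, hr.trans (ball_subset_ball (le_max_left _ _))⟩
  obtain ⟨κ, hκ, hbel⟩ := beltrami m hr0 hη
  obtain ⟨ν, W, hν, hνs, hνb, hν0, hW, hfW, hWN, hWr, hνμ⟩ := h.exists_small hsm.1 (U := ball 0 r)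
    isOpen_ball (frontier_subset_closure.trans hr) (m + 5) hκ
  obtain ⟨F, hF, hFb, hFc, hFd⟩ := hbel ν hν (hνs.trans ball_subset_closedBall) hνb
  obtain ⟨Φ, hΦ, hΦs⟩ := exists_homeomorph_of_fderiv_le hF hFd
  have hΦF : (Φ : ℂ → ℂ) = F := funext hΦ
  have hcl : closure Ω ⊆ closedBall 0 r := hr.trans ball_subset_closedBall
  have hFΩ : ∀ z ∈ Ω, DifferentiableAt ℂ F z := fun z hz => by
    refine differentiableAt_of_dbar (hF.diffAt z) ?_
    rw [hFb z (hcl (subset_closure hz)), hν0 z hz, zero_mul]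
  have hwz : ∀ z, HasFDerivAt F (wirt (dz F z) (dbar F z)) z := fun z => (hF.diffAt z).hasWirt
  have hinv : ∀ z, HasFDerivAt (fun w => Φ.symm (F w)) (wirt 1 0) z := fun z => by
    refine (hasFDerivAt_id' z).congr_of_eventuallyEq (Filter.Eventually.of_forall fun w => ?_)
    change Φ.symm (F w) = w
    rw [← hΦ, Φ.symm_apply_apply]
  have hdz0 : ∀ z ∈ Ω, dz F z ≠ 0 := fun z hz h0 => by
    have hz' : HasFDerivAt F (wirt 0 0) z := by
      have := hwz z
      rwa [h0, (hFΩ z hz).dbar_eq_zero] at this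
    have := ((hinv z).unique ((hΦs.diffAt (F z)).hasWirt.wirt_comp hz'))
    have := (wirt_inj this).1
    simp at this
  let N' : Set ℂ := W ∩ R ⁻¹' W
  have hN'o : IsOpen N' :=
    (h.smooth_R.continuousOn.mono hWN).isOpen_inter_preimage hW hW
  have hN'N : N' ⊆ N := fun z hz => hWN hz.1
  have hRN' : ∀ z ∈ N', R z ∈ N' := fun z hz =>
    ⟨hz.2, by change R (R z) ∈ W; rw [h.invol z (hN'N hz)]; exact hz.1⟩
  let S : ℂ → ℂ := fun w => F (R (Φ.symm w))
  have hD : F '' Ω = Φ '' Ω := by rw [hΦF]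
  have hfr : frontier (F '' Ω) = F '' frontier Ω := by rw [hD, ← Φ.image_frontier, hΦF]
  have hclD : closure (F '' Ω) = F '' closure Ω := by rw [hD, ← Φ.image_closure, hΦF]
  have hinj : Function.Injective F := hΦF ▸ Φ.injective
  have hsym : ∀ z, Φ.symm (F z) = z := fun z => by rw [← hΦ, Φ.symm_apply_apply]
  have hS : ∀ z, S (F z) = F (R z) := fun z => by simp only [S, hsym]
  have hFN'o : IsOpen (F '' N') := by rw [← hΦF]; exact Φ.isOpenMap _ hN'o
  have hDo : IsOpen (F '' Ω) := by rw [← hΦF]; exact Φ.isOpenMap _ hΩo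
  have hSsm : ContDiffOn ℝ ∞ S (F '' N') := by
    refine hF.comp_contDiffOn (h.smooth_R.comp hΦs.contDiffOn ?_)
    rintro _ ⟨z, hz, rfl⟩
    rw [hsym]; exact hN'N hz
  have hsin : ∀ z ∈ N, z ∈ Ω → R z ∉ closure Ω := fun z hz hzΩ hc => by
    have h1 := (h.s_neg z hz).2 hzΩ
    have h2 : ¬ R z ∈ Ω := fun h2 => by
      have := (h.s_neg _ (h.maps z hz)).2 h2
      rw [h.s_R z hz] at this; linarith
    have h3 : R z ∈ frontier Ω := by rw [hΩo.frontier_eq]; exact ⟨hc, h2⟩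
    have := (h.s_zero _ (h.maps z hz)).2 h3
    rw [h.s_R z hz] at this; linarith
  have hsout : ∀ z ∈ N, z ∉ closure Ω → R z ∈ Ω := fun z hz hzc => by
    rw [← h.s_neg _ (h.maps z hz), h.s_R z hz]
    have h1 : ¬ s z < 0 := fun h1 => hzc (subset_closure ((h.s_neg z hz).1 h1))
    have h2 : s z ≠ 0 := fun h2 => hzc (frontier_subset_closure ((h.s_zero z hz).1 h2))
    have : 0 < s z := lt_of_le_of_ne (not_lt.1 h1) h2.symm
    linarith
  have hdin : ∀ z ∈ N', z ∈ Ω → dz S (F z) = 0 := by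
    intro z hz hzΩ
    have h1 : HasFDerivAt (fun w => S (F w)) _ z :=
      (hSsm.diffAt hFN'o (mem_image_of_mem F hz)).hasWirt.wirt_comp (hwz z)
    have h2 : HasFDerivAt (fun w => F (R w)) _ z :=
      (hwz (R z)).wirt_comp (h.smooth_R.diffAt h.isOpen (hN'N hz)).hasWirt
    have h3 := (wirt_inj (h1.unique (by simpa only [hS] using h2))).1
    have hb : R z ∈ closedBall (0 : ℂ) r := ball_subset_closedBall (hWr hz.2)
    have hRz : R z ∉ Ω := fun hc => hsin z (hN'N hz) hzΩ (subset_closure hc)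
    rw [(hFΩ z hzΩ).dbar_eq_zero, map_zero, mul_zero, add_zero, hFb _ hb, hνμ _ hz.2 hRz] at h3
    have h4 : dz S (F z) * dz F z = dz F (R z) * (dz R z + μ (R z) * conj (dbar R z)) := by
      rw [h3]; ring
    rw [h.reflect z (hN'N hz), mul_zero] at h4
    exact (mul_eq_zero.1 h4).resolve_right (hdz0 z hzΩ)
  have hSS : ∀ w ∈ F '' N', S (S w) = w := by
    rintro _ ⟨z, hz, rfl⟩
    have h1 := congrArg S (hS z)
    rw [hS (R z), h.invol z (hN'N hz)] at h1
    exact h1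
  have hmem : ∀ {z : ℂ} {A : Set ℂ}, F z ∈ F '' A ↔ z ∈ A := fun {z A} => hinj.mem_set_image
  refine ⟨F, F '' N', S, hF, fun z hz => (hFΩ z hz).differentiableWithinAt, hinj, hclD,
    fun j hj z hz => hFc j hj z (hcl hz), hDo, hΩc.image F hF.continuous.continuousOn, ?_, hFN'o, ?_,
    hSsm, ?_, hSS, ?_, ?_, ?_, ?_, ?_⟩
  · exact (hsm.1.isCompact_closure.image hF.continuous).isBounded.subset (image_mono subset_closure)
  · rw [hfr]
    refine image_mono fun z hz => ⟨hfW hz, ?_⟩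
    change R z ∈ W
    rw [h.R_fix z hz]; exact hfW hz
  · rintro _ ⟨z, hz, rfl⟩
    rw [hS]; exact mem_image_of_mem F (hRN' z hz)
  · rw [hfr]
    rintro _ ⟨z, hz, rfl⟩
    rw [hS, h.R_fix z hz]
  · rintro _ ⟨z, hz, rfl⟩ hzD
    rw [hS, hclD, hmem]
    exact hsin z (hN'N hz) (hmem.1 hzD)
  · rintro _ ⟨z, hz, rfl⟩ hzD
    rw [hclD, hmem] at hzD
    rw [hS, hmem]
    exact hsout z (hN'N hz) hzD
  · rintro _ ⟨z, hz, rfl⟩ hzf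
    rw [hfr, hmem] at hzf
    by_cases hzΩ : z ∈ Ω
    · exact hdin z hz hzΩ
    have hzc : z ∉ closure Ω := fun hc => hzf (by rw [hΩo.frontier_eq]; exact ⟨hc, hzΩ⟩)
    have hRz := hsout z (hN'N hz) hzc
    have h0 := hdin (R z) (hRN' z hz) hRz
    have hm := mem_image_of_mem F hz
    have hm' := mem_image_of_mem F (hRN' z hz)
    have h1 : HasFDerivAt (fun w => S (S w)) _ (F z) :=
      HasFDerivAt.wirt_comp (u := S) (v := S) (by rw [hS]; exact (hSsm.diffAt hFN'o hm').hasWirt)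
        (hSsm.diffAt hFN'o hm).hasWirt
    have h2 : HasFDerivAt (fun w => S (S w)) (wirt 1 0) (F z) := by
      refine (hasFDerivAt_id' _).congr_of_eventuallyEq ?_
      filter_upwards [hFN'o.mem_nhds hm] with w hw using hSS w hw
    obtain ⟨e1, e2⟩ := wirt_inj (h1.unique h2)
    rw [h0, zero_mul, zero_add] at e1 e2
    have hne : dbar S (F (R z)) ≠ 0 := fun hh => by rw [hh, zero_mul] at e1; exact zero_ne_one e1
    have := (mul_eq_zero.1 e2).resolve_left hne
    simpa using this
  · rw [hfr]
    exact addHaar_image_eq_zero_of_differentiableOn_of_addHaar_eq_zero volume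
      (hF.differentiable (by simp)).differentiableOn (volume_frontier_eq_zero hsm)

section weak
variable {f θ : ℂ → ℂ} {D N U : Set ℂ} {R : ℂ → ℂ}

lemma contDiff_mul_of_tsupport_subset (hU : IsOpen U) (hf : ContDiffOn ℝ ∞ f U)
    (hθ : ContDiff ℝ ∞ θ) (hs : tsupport θ ⊆ U) : ContDiff ℝ ∞ fun z => f z * θ z := by
  rw [contDiff_iff_contDiffAt]
  intro z
  by_cases hz : z ∈ U
  · exact (hf.contDiffAt (hU.mem_nhds hz)).mul hθ.contDiffAt
  · have : (fun z => f z * θ z) =ᶠ[𝓝 z] fun _ => 0 := by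
      filter_upwards [notMem_tsupport_iff_eventuallyEq.1 fun h => hz (hs h)] with w hw
      simp [hw]
    exact contDiffAt_const.congr_of_eventuallyEq this

lemma dbar_eq_zero_of_notMem_tsupport {z : ℂ} (hz : z ∉ tsupport θ) : dbar θ z = 0 :=
  image_eq_zero_of_notMem_tsupport fun h => hz (tsupport_dbar_subset θ h)

lemma dz_eq_zero_of_notMem_tsupport {z : ℂ} (hz : z ∉ tsupport θ) : dz θ z = 0 :=
  image_eq_zero_of_notMem_tsupport fun h => hz (tsupport_dz_subset θ h)

lemma setIntegral_mul_dbar (hs : tsupport θ ⊆ D) :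
    ∫ z in D, f z * dbar θ z = ∫ z, f z * dbar θ z :=
  setIntegral_eq_integral_of_forall_compl_eq_zero fun z hz => by
    rw [dbar_eq_zero_of_notMem_tsupport fun h => hz (hs h), mul_zero]

lemma setIntegral_mul_dz (hs : tsupport θ ⊆ D) :
    ∫ z in D, f z * dz θ z = ∫ z, f z * dz θ z :=
  setIntegral_eq_integral_of_forall_compl_eq_zero fun z hz => by
    rw [dz_eq_zero_of_notMem_tsupport fun h => hz (hs h), mul_zero]

/-- A holomorphic function is weakly holomorphic. -/
lemma DifferentiableOn.weakHolo (hf : DifferentiableOn ℂ f U) (hU : IsOpen U) : WeakHolo f U := by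
  intro ψ h1 h2 h3
  have hs : ContDiffOn ℝ ∞ f U := (hf.contDiffOn (n := ∞) hU).restrict_scalars ℝ
  have h4 := (integral_dbar_eq_zero (contDiff_mul_of_tsupport_subset hU hs h1 h3) h2.mul_left).1
  rw [← h4]
  refine integral_congr_ae (Filter.Eventually.of_forall fun z => ?_)
  by_cases hz : z ∈ U
  · have hd := hf.differentiableAt (hU.mem_nhds hz)
    simp only
    rw [dbar_mul (hs.diffAt hU hz) (h1.diffAt z), hd.dbar_eq_zero, zero_mul, zero_add]
  · have h5 : z ∉ tsupport ψ := fun h => hz (h3 h)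
    have h6 : z ∉ tsupport (fun z => f z * ψ z) :=
      fun h => h5 (tsupport_mul_subset_right h)
    simp only
    rw [dbar_eq_zero_of_notMem_tsupport h5, dbar_eq_zero_of_notMem_tsupport h6, mul_zero]

lemma tsupport_indicator_subset (hb : ∀ z ∈ frontier D, θ =ᶠ[𝓝 z] 0) :
    tsupport (D.indicator θ) ⊆ D := by
  intro z hz
  by_contra hzD
  have h1 : z ∈ closure D := closure_mono support_indicator_subset hz
  have h2 : z ∈ frontier D := by
    rw [frontier_eq_closure_inter_closure]
    exact ⟨h1, subset_closure hzD⟩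
  refine notMem_tsupport_iff_eventuallyEq.2 ?_ hz
  filter_upwards [hb z h2] with w hw
  simp [indicator, hw]

lemma contDiff_indicator (hD : IsOpen D) (hθ : ContDiff ℝ ∞ θ)
    (hb : ∀ z ∈ frontier D, θ =ᶠ[𝓝 z] 0) : ContDiff ℝ ∞ (D.indicator θ) := by
  rw [contDiff_iff_contDiffAt]
  intro z
  by_cases hz : z ∈ D
  · refine hθ.contDiffAt.congr_of_eventuallyEq ?_
    filter_upwards [hD.mem_nhds hz] with w hw
    exact indicator_of_mem hw _
  · refine (contDiffAt_const (c := (0 : ℂ))).congr_of_eventuallyEq ?_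
    exact notMem_tsupport_iff_eventuallyEq.1 fun h => hz (tsupport_indicator_subset hb h)

lemma WeakHolo.setIntegral_eq_zero (hf : WeakHolo f D) (hD : IsOpen D)
    (hbd : Bornology.IsBounded D) (hθ : ContDiff ℝ ∞ θ)
    (hb : ∀ z ∈ frontier D, θ =ᶠ[𝓝 z] 0) : ∫ z in D, f z * dbar θ z = 0 := by
  have h1 := tsupport_indicator_subset hb
  have hc : HasCompactSupport (D.indicator θ) :=
    hbd.isCompact_closure.of_isClosed_subset (isClosed_tsupport _) (h1.trans subset_closure)
  rw [← hf _ (contDiff_indicator hD hθ hb) hc h1, ← setIntegral_mul_dbar h1]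
  refine setIntegral_congr_fun hD.measurableSet fun z hz => ?_
  refine congrArg (f z * ·) ?_
  refine dbar_congr ?_
  filter_upwards [hD.mem_nhds hz] with w hw
  exact (indicator_of_mem hw _).symm

end weak

section schwarz
variable {f θ : ℂ → ℂ} {D N U : Set ℂ} {R : ℂ → ℂ}

lemma SchwarzDomain.ne (h : SchwarzDomain D N R) {z : ℂ} (hz : z ∈ N) (hzD : z ∈ D) : R z ≠ z :=
  fun h1 => h.swap_in z hz hzD (by rw [h1]; exact subset_closure hzD)

lemma SchwarzDomain.shrink (h : SchwarzDomain D N R) (hU : IsOpen U) (hfr : frontier D ⊆ U) :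
    SchwarzDomain D (N ∩ U ∩ {z | z ∈ N ∧ R z ∈ U}) R := by
  have ho : IsOpen {z | z ∈ N ∧ R z ∈ U} :=
    h.smooth.continuousOn.isOpen_inter_preimage h.isOpen_N hU
  refine ⟨h.isOpen, h.connected, h.bounded, (h.isOpen_N.inter hU).inter ho, ?_,
    h.smooth.mono fun z hz => hz.1.1, ?_, fun z hz => h.invol z hz.1.1, h.fix,
    fun z hz => h.swap_in z hz.1.1, fun z hz => h.swap_out z hz.1.1,
    fun z hz => h.dz_eq_zero z hz.1.1, h.null⟩
  · intro z hz
    refine ⟨⟨h.frontier_subset hz, hfr hz⟩, h.frontier_subset hz, ?_⟩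
    rw [h.fix z hz]; exact hfr hz
  · rintro z ⟨⟨h1, h2⟩, -, h3⟩
    refine ⟨⟨h.maps z h1, h3⟩, h.maps z h1, ?_⟩
    rw [h.invol z h1]; exact h2

/-- Weakly holomorphic integrable functions annihilate `∂̄θ` when `θ` vanishes on the boundary. -/
lemma SchwarzDomain.setIntegral_eq_zero (h : SchwarzDomain D N R) (hf : WeakHolo f D)
    (hi : IntegrableOn f D) (hθ : ContDiff ℝ ∞ θ) (hc : HasCompactSupport θ)
    (hs : tsupport θ ⊆ N) {C : ℝ} (hC : ∀ z ∈ N, ‖θ z‖ ≤ C * ‖z - R z‖) :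
    ∫ z in D, f z * dbar θ z = 0 := by
  let b : ContDiffBump (0 : ℂ) := ⟨1, 2, by norm_num, by norm_num⟩
  let ρ : ℂ → ℂ := fun w => 1 - (b w : ℂ)
  have hρ : ContDiff ℝ ∞ ρ := contDiff_const.sub (ofRealCLM.contDiff.comp b.contDiff)
  have hρ1 : ∀ w, 2 < ‖w‖ → ρ w = 1 := fun w hw => by
    simp only [ρ, b.zero_of_le_dist (x := w) (by simpa [b] using hw.le)]; simp
  have hρ0 : ∀ w, ‖w‖ < 1 → ρ w = 0 := fun w hw => by
    simp only [ρ, b.one_of_mem_closedBall (x := w) (by simpa [b] using hw.le)]; simp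
  have hρle : ∀ w, ‖ρ w‖ ≤ 1 := fun w => by
    have : ρ w = ((1 - b w : ℝ) : ℂ) := by simp [ρ]
    rw [this, norm_real, Real.norm_eq_abs, abs_le]
    constructor <;> linarith [b.le_one (x := w), b.nonneg (x := w)]
  have hρd : ∀ w, 2 < ‖w‖ → fderiv ℝ ρ w = 0 := by
    intro w hw
    have : ρ =ᶠ[𝓝 w] fun _ => 1 := by
      filter_upwards [(isOpen_lt continuous_const continuous_norm).mem_nhds hw] with v hv
      exact hρ1 v hv
    rw [this.fderiv_eq]; simp
  obtain ⟨L, hL⟩ : ∃ L, ∀ w, ‖‖w‖ • fderiv ℝ ρ w‖ ≤ L := by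
    refine HasCompactSupport.exists_bound_of_continuous ?_
      (continuous_norm.smul (hρ.continuous_fderiv (by simp)))
    refine HasCompactSupport.intro (isCompact_closedBall (0 : ℂ) 2) fun w hw => ?_
    rw [hρd w (by simpa using hw), smul_zero]
  let d : ℂ → ℂ := fun z => z - R z
  have hd : ContDiffOn ℝ ∞ d N := contDiffOn_id.sub h.smooth
  obtain ⟨B, hB⟩ : ∃ B, ∀ z ∈ tsupport θ, ‖fderiv ℝ d z‖ ≤ B := by
    refine IsCompact.exists_bound_of_continuousOn hc ?_
    exact (hd.continuousOn_fderiv_of_isOpen h.isOpen_N (by simp)).mono hs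
  obtain ⟨B', hB'⟩ := hc.dbar.exists_bound_of_continuous hθ.dbar.continuous
  let g : ℕ → ℂ → ℂ := fun n z => ρ (((n + 1 : ℝ) : ℂ) * d z)
  have hg : ∀ n, ContDiffOn ℝ ∞ (g n) N := fun n =>
    hρ.comp_contDiffOn (contDiffOn_const.mul hd)
  let u : ℕ → ℂ → ℂ := fun n z => g n z * θ z
  have hu : ∀ n, ContDiff ℝ ∞ (u n) := fun n =>
    contDiff_mul_of_tsupport_subset h.isOpen_N (hg n) hθ hs
  have hdu : ∀ n, ∀ z ∈ N, dbar (u n) z = dbar (g n) z * θ z + g n z * dbar θ z := fun n z hz =>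
    dbar_mul ((hg n).diffAt h.isOpen_N hz) (hθ.diffAt z)
  have hdu' : ∀ n z, z ∉ tsupport θ → dbar (u n) z = 0 := fun n z hz =>
    dbar_eq_zero_of_notMem_tsupport fun h => hz (tsupport_mul_subset_right h)
  have hnn : ∀ n : ℕ, ‖((n + 1 : ℝ) : ℂ)‖ = n + 1 := fun n => by
    rw [norm_real, Real.norm_of_nonneg (by positivity)]
  have hdg : ∀ n, ∀ z ∈ N, fderiv ℝ (g n) z =
      (fderiv ℝ ρ (((n + 1 : ℝ) : ℂ) * d z)).comp (((n + 1 : ℝ) : ℂ) • fderiv ℝ d z) := by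
    intro n z hz
    have h1 := (hd.diffAt h.isOpen_N hz).hasFDerivAt.const_mul (((n + 1 : ℝ) : ℂ))
    exact ((hρ.diffAt _).hasFDerivAt.comp z h1).fderiv
  have hbound : ∀ n z, ‖dbar (u n) z‖ ≤ |C| * |L| * |B| + |B'| := by
    intro n z
    by_cases hz : z ∈ tsupport θ
    · have hzN := hs hz
      rw [hdu n z hzN]
      refine (norm_add_le _ _).trans (add_le_add ?_ ?_)
      · rw [norm_mul]
        have h1 : ‖dbar (g n) z‖ ≤
            ‖fderiv ℝ ρ (((n + 1 : ℝ) : ℂ) * d z)‖ * ((n + 1) * |B|) := by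
          refine norm_dbar_le.trans ?_
          rw [hdg n z hzN]
          refine (ContinuousLinearMap.opNorm_comp_le _ _).trans ?_
          gcongr
          rw [norm_smul, hnn]
          gcongr
          exact (hB z hz).trans (le_abs_self _)
        have h2 : ‖θ z‖ ≤ |C| * ‖d z‖ :=
          (hC z hzN).trans (mul_le_mul_of_nonneg_right (le_abs_self C) (norm_nonneg _))
        have h3 := (hL (((n + 1 : ℝ) : ℂ) * d z)).trans (le_abs_self L)
        rw [norm_smul, norm_norm, norm_mul, hnn] at h3
        calc _ ≤ ‖fderiv ℝ ρ (((n + 1 : ℝ) : ℂ) * d z)‖ * ((n + 1) * |B|) * (|C| * ‖d z‖) := by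
              gcongr
          _ = |C| * ((n + 1) * ‖d z‖ * ‖fderiv ℝ ρ (((n + 1 : ℝ) : ℂ) * d z)‖) * |B| := by ring
          _ ≤ _ := by gcongr
      · rw [norm_mul]
        calc _ ≤ 1 * |B'| := by
              gcongr
              · exact hρle _
              · exact (hB' z).trans (le_abs_self _)
          _ = _ := one_mul _
    · rw [hdu' n z hz, norm_zero]; positivity
  have hzero : ∀ n, ∫ z in D, f z * dbar (u n) z = 0 := by
    intro n
    refine hf.setIntegral_eq_zero h.isOpen h.bounded (hu n) fun z hz => ?_
    have hzN := h.frontier_subset hz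
    have h1 : ContinuousAt (fun w => ‖((n + 1 : ℝ) : ℂ) * d w‖) z :=
      ((continuousAt_const.mul (hd.continuousOn.continuousAt (h.isOpen_N.mem_nhds hzN)))).norm
    have h2 : ‖((n + 1 : ℝ) : ℂ) * d z‖ < 1 := by simp [d, h.fix z hz]
    filter_upwards [h1.eventually_lt continuousAt_const h2] with w hw
    simp only [u, g, hρ0 _ hw]; simp
  have hlim : Filter.Tendsto (fun n => ∫ z in D, f z * dbar (u n) z) Filter.atTop
      (𝓝 (∫ z in D, f z * dbar θ z)) := by
    refine tendsto_integral_of_dominated_convergence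
      (fun z => ‖f z‖ * (|C| * |L| * |B| + |B'|)) ?_ (hi.norm.mul_const _) ?_ ?_
    · exact fun n => hi.aestronglyMeasurable.mul (hu n).dbar.continuous.aestronglyMeasurable
    · refine fun n => Filter.Eventually.of_forall fun z => ?_
      rw [norm_mul]; exact mul_le_mul_of_nonneg_left (hbound n z) (norm_nonneg _)
    · rw [ae_restrict_iff' h.isOpen.measurableSet]
      refine Filter.Eventually.of_forall fun z hzD => ?_
      refine Filter.Tendsto.const_mul _ ?_
      refine tendsto_const_nhds.congr' ?_
      by_cases hz : z ∈ tsupport θ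
      · have hzN := hs hz
        have hdz : 0 < ‖d z‖ := norm_pos_iff.2 (sub_ne_zero.2 (h.ne hzN hzD).symm)
        obtain ⟨n₀, hn₀⟩ := exists_nat_gt (2 / ‖d z‖)
        filter_upwards [Filter.eventually_ge_atTop n₀] with n hn
        have h1 : 2 < ‖((n + 1 : ℝ) : ℂ) * d z‖ := by
          rw [norm_mul, hnn, ← div_lt_iff₀ hdz]
          have : (n₀ : ℝ) ≤ n := by exact_mod_cast hn
          linarith
        have h2 : dbar (g n) z = 0 := by
          rw [← norm_le_zero_iff]
          refine norm_dbar_le.trans ?_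
          rw [hdg n z hzN, hρd _ h1]; simp
        rw [hdu n z hzN, h2]
        simp only [g, hρ1 _ h1]; ring
      · refine Filter.Eventually.of_forall fun n => ?_
        simp only [hdu' n z hz, dbar_eq_zero_of_notMem_tsupport hz]
  simp only [hzero] at hlim
  exact tendsto_nhds_unique hlim tendsto_const_nhds

end schwarz

/-- A compact subset of a domain lies in a relatively compact subdomain. -/
lemma exists_isConnected_between {D K : Set ℂ} {a : ℂ} (hD : IsOpen D) (hc : IsConnected D)
    (ha : a ∈ D) (hK : IsCompact K) (hKD : K ⊆ D) :
    ∃ U, IsOpen U ∧ IsConnected U ∧ a ∈ U ∧ K ⊆ U ∧ closure U ⊆ D := by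
  let P : Set ℂ := {x | ∃ U, IsOpen U ∧ IsConnected U ∧ a ∈ U ∧ x ∈ U ∧ closure U ⊆ D}
  have hball : ∀ x ∈ D, ∃ r > 0, closure (ball x r) ⊆ D := fun x hx => by
    obtain ⟨r, hr, h⟩ := Metric.nhds_basis_closedBall.mem_iff.1 (hD.mem_nhds hx)
    exact ⟨r, hr, closure_ball_subset_closedBall.trans h⟩
  have hP : D ⊆ P := by
    refine hc.isPreconnected.subset_of_closure_inter_subset ?_ ?_ ?_
    · refine isOpen_iff_forall_mem_open.2 ?_
      rintro x ⟨U, h1, h2, h3, h4, h5⟩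
      exact ⟨U, fun y hy => ⟨U, h1, h2, h3, hy, h5⟩, h1, h4⟩
    · obtain ⟨r, hr, h⟩ := hball a ha
      exact ⟨a, ha, ball a r, isOpen_ball, (convex_ball a r).isConnected ⟨a, mem_ball_self hr⟩,
        mem_ball_self hr, mem_ball_self hr, h⟩
    · rintro x ⟨hx, hxD⟩
      obtain ⟨r, hr, h⟩ := hball x hxD
      obtain ⟨y, hy, U, h1, h2, h3, h4, h5⟩ := mem_closure_iff_nhds.1 hx _ (ball_mem_nhds x hr)
      refine ⟨U ∪ ball x r, h1.union isOpen_ball, ?_, Or.inl h3, Or.inr (mem_ball_self hr), ?_⟩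
      · exact IsConnected.union ⟨y, h4, hy⟩ h2
          ((convex_ball x r).isConnected ⟨x, mem_ball_self hr⟩)
      · rw [closure_union]; exact union_subset h5 h
  have hP' : ∀ x ∈ insert a K, ∃ U, IsOpen U ∧ IsConnected U ∧ a ∈ U ∧ x ∈ U ∧ closure U ⊆ D :=
    fun x hx => hP (by rcases hx with rfl | hx; exacts [ha, hKD hx])
  choose! U h1 h2 h3 h4 h5 using hP'
  obtain ⟨t, ht, hcov⟩ := (hK.insert a).elim_nhds_subcover U
    fun x hx => (h1 x hx).mem_nhds (h4 x hx)
  refine ⟨⋃ x ∈ t, U x, isOpen_biUnion fun x hx => h1 x (ht x hx), ⟨⟨a, hcov (mem_insert _ _)⟩, ?_⟩,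
    hcov (mem_insert _ _), (subset_insert _ _).trans hcov, ?_⟩
  · have : (⋃ x ∈ t, U x) = ⋃₀ (U '' t) := by simp [sUnion_image]
    rw [this]
    refine isPreconnected_sUnion a _ ?_ ?_
    · rintro _ ⟨x, hx, rfl⟩; exact h3 x (ht x hx)
    · rintro _ ⟨x, hx, rfl⟩; exact (h2 x (ht x hx)).isPreconnected
  · rw [t.closure_biUnion]
    exact iUnion₂_subset fun x hx => h5 x (ht x hx)

/-- Smooth kernels reproducing the derivatives of holomorphic functions at a point. -/
lemma exists_derivative_kernel (a : ℂ) {r : ℝ} (hr : 0 < r) :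
    ∃ κ : ℕ → ℂ → ℂ, ∀ k, ContDiff ℝ ∞ (κ k) ∧ HasCompactSupport (κ k) ∧ tsupport (κ k) ⊆ ball a r ∧
      ∀ G, DifferentiableOn ℂ G (ball a r) → ∫ z, G z * κ k z = iteratedDeriv k G a := by
  obtain ⟨η, h1, h2, h3, -, -, h4⟩ := exists_meanValue_kernel hr
  let κ : ℕ → ℂ → ℂ := fun k => Nat.rec (fun z => η (a - z)) (fun _ u z => -dz u z) k
  have hκ : ∀ k, κ (k + 1) = fun z => -dz (κ k) z := fun k => rfl
  have hs : ∀ k, ContDiff ℝ ∞ (κ k) ∧ HasCompactSupport (κ k) ∧ tsupport (κ k) ⊆ ball a r := by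
    intro k
    induction k with
    | zero =>
      refine ⟨h1.comp (contDiff_const.sub contDiff_id), hasCompactSupport_comp_sub h2 a,
        tsupport_comp_sub_subset h3 a⟩
    | succ k ih =>
      rw [hκ]
      have : tsupport (fun z => -dz (κ k) z) ⊆ tsupport (κ k) := by
        refine subset_trans (closure_mono ?_) (tsupport_dz_subset (κ k))
        intro z hz; simpa using hz
      exact ⟨ih.1.dz.neg, HasCompactSupport.mono' ih.2.1 (subset_closure.trans this), this.trans ih.2.2⟩
  refine ⟨κ, fun k => ⟨(hs k).1, (hs k).2.1, (hs k).2.2, ?_⟩⟩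
  induction k with
  | zero =>
    intro G hG
    rw [iteratedDeriv_zero, ← h4 G a hG]
    exact integral_congr_ae (Filter.Eventually.of_forall fun z => mul_comm _ _)
  | succ k ih =>
    intro G hG
    rw [iteratedDeriv_succ', ← ih (deriv G) (hG.deriv isOpen_ball)]
    obtain ⟨s1, s2, s3⟩ := hs k
    have hGs : ContDiffOn ℝ ∞ G (ball a r) :=
      (hG.contDiffOn (n := ∞) isOpen_ball).restrict_scalars ℝ
    have hG's : ContDiffOn ℝ ∞ (deriv G) (ball a r) :=
      ((hG.deriv isOpen_ball).contDiffOn (n := ∞) isOpen_ball).restrict_scalars ℝ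
    have i0 := (integral_dbar_eq_zero (contDiff_mul_of_tsupport_subset isOpen_ball hGs s1 s3)
      s2.mul_left).2
    have i1 : Integrable fun z => deriv G z * κ k z :=
      (contDiff_mul_of_tsupport_subset isOpen_ball hG's s1 s3).continuous.integrable_of_hasCompactSupport
        s2.mul_left
    have i2 : Integrable fun z => G z * dz (κ k) z :=
      (contDiff_mul_of_tsupport_subset isOpen_ball hGs s1.dz
        ((tsupport_dz_subset _).trans s3)).continuous.integrable_of_hasCompactSupport
        s2.dz.mul_left
    have e : dz (fun z => G z * κ k z) = fun z => deriv G z * κ k z + G z * dz (κ k) z := by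
      funext z
      by_cases hz : z ∈ ball a r
      · rw [dz_mul (hGs.diffAt isOpen_ball hz) (s1.diffAt z),
          (hG.differentiableAt (isOpen_ball.mem_nhds hz)).dz_eq_deriv]
      · have h5 : z ∉ tsupport (κ k) := fun h => hz (s3 h)
        rw [dz_eq_zero_of_notMem_tsupport h5, image_eq_zero_of_notMem_tsupport h5,
          dz_eq_zero_of_notMem_tsupport fun h => h5 (tsupport_mul_subset_right h)]
        simp
    rw [e, integral_add i1 i2] at i0
    rw [hκ]
    simp only [mul_neg, integral_neg]
    linear_combination -i0

lemma eq_zero_of_iteratedDeriv_eq_zero {G : ℂ → ℂ} {U : Set ℂ} {a : ℂ} (hU : IsOpen U)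
    (hc : IsPreconnected U) (ha : a ∈ U) (hG : DifferentiableOn ℂ G U)
    (h0 : ∀ k, iteratedDeriv k G a = 0) : ∀ z ∈ U, G z = 0 := by
  obtain ⟨r, hr, hrU⟩ := Metric.isOpen_iff.1 hU a ha
  refine (hG.analyticOnNhd hU).eqOn_zero_of_preconnected_of_eventuallyEq_zero hc ha ?_
  filter_upwards [ball_mem_nhds a hr] with z hz
  have := hasSum_taylorSeries_on_ball (hG.mono hrU) hz
  simp only [h0, smul_zero] at this
  exact (hasSum_zero.unique this).symm

section hilbert
open scoped InnerProductSpace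
variable {H H₁ H₂ : Type*} [NormedAddCommGroup H] [InnerProductSpace ℂ H]
  [NormedAddCommGroup H₁] [InnerProductSpace ℂ H₁]
  [NormedAddCommGroup H₂] [InnerProductSpace ℂ H₂]

/-- Pairing two operators into the Hilbert direct sum. -/
def pairL (T : H →L[ℂ] H₁) (L : H →L[ℂ] H₂) : H →L[ℂ] WithLp 2 (H₁ × H₂) :=
  (WithLp.prodContinuousLinearEquiv 2 ℂ H₁ H₂).symm.toContinuousLinearMap.comp (T.prod L)

lemma pairL_apply (T : H →L[ℂ] H₁) (L : H →L[ℂ] H₂) (φ : H) :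
    pairL T L φ = WithLp.toLp 2 (T φ, L φ) := rfl

lemma inner_toLp (a c : H₁) (b d : H₂) :
    ⟪(WithLp.toLp 2 (a, b) : WithLp 2 (H₁ × H₂)), WithLp.toLp 2 (c, d)⟫_ℂ = ⟪a, c⟫_ℂ + ⟪b, d⟫_ℂ := by
  rw [WithLp.prod_inner_apply]

variable [CompleteSpace H]

/-- Orthogonal projection onto the closed graph of an isometry, written as two operators. -/
lemma exists_graph_projection (S : Set (H × H))
    (hS : ∀ p ∈ S, ∀ q ∈ S, ⟪p.1, q.1⟫_ℂ = ⟪p.2, q.2⟫_ℂ) :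
    ∃ Y W : H →L[ℂ] H, (∀ φ, ∀ p ∈ S, ⟪p.1, φ - Y φ⟫_ℂ = 0) ∧
      (∀ A B : H, (∀ p ∈ S, ⟪A, p.1⟫_ℂ = ⟪B, p.2⟫_ℂ) → ∀ φ, ⟪A, Y φ⟫_ℂ = ⟪B, W φ⟫_ℂ) ∧
      ∀ p ∈ S, Y p.1 = p.1 ∧ W p.1 = p.2 := by
  let E := WithLp 2 (H × H)
  let K₀ : Submodule ℂ E := Submodule.span ℂ ((fun p => WithLp.toLp 2 p) '' S)
  let K : Submodule ℂ E := K₀ᗮᗮ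
  let P : E →L[ℂ] E := K.starProjection
  have hgen : ∀ p ∈ S, (WithLp.toLp 2 p : E) ∈ K := fun p hp =>
    Submodule.le_orthogonal_orthogonal K₀ (Submodule.subset_span (mem_image_of_mem _ hp))
  have horth : ∀ x : E, (∀ p ∈ S, ⟪x, (WithLp.toLp 2 p : E)⟫_ℂ = 0) → ∀ e ∈ K, ⟪x, e⟫_ℂ = 0 := by
    intro x hx e he
    refine (Submodule.mem_orthogonal K₀ᗮ e).1 he x ((Submodule.mem_orthogonal' K₀ x).2 fun u hu => ?_)
    induction hu using Submodule.span_induction with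
    | mem u hu => obtain ⟨p, hp, rfl⟩ := hu; exact hx p hp
    | zero => simp
    | add u v _ _ h1 h2 => rw [inner_add_right, h1, h2, add_zero]
    | smul c u _ h1 => rw [inner_smul_right, h1, mul_zero]
  let Q : H →L[ℂ] E := P.comp ((2 : ℂ) • pairL (ContinuousLinearMap.id ℂ H) 0)
  have hQ : ∀ φ, Q φ = P (WithLp.toLp 2 ((2 : ℂ) • φ, (0 : H))) := fun φ => by
    have : ((2 : ℂ) • pairL (ContinuousLinearMap.id ℂ H) (0 : H →L[ℂ] H)) φ =
        WithLp.toLp 2 ((2 : ℂ) • φ, (0 : H)) := by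
      rw [smul_apply, pairL_apply, ← WithLp.toLp_smul]; simp
    exact congrArg P this
  have hQK : ∀ φ, Q φ ∈ K := fun φ => by rw [hQ]; exact K.starProjection_apply_mem _
  let Y : H →L[ℂ] H := (WithLp.fstL 2 ℂ H H).comp Q
  let W : H →L[ℂ] H := (WithLp.sndL 2 ℂ H H).comp Q
  have hYW : ∀ φ, Q φ = WithLp.toLp 2 (Y φ, W φ) := fun φ => rfl
  have hb : ∀ A B : H, (∀ p ∈ S, ⟪A, p.1⟫_ℂ = ⟪B, p.2⟫_ℂ) → ∀ φ, ⟪A, Y φ⟫_ℂ = ⟪B, W φ⟫_ℂ := by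
    intro A B hAB φ
    have := horth (WithLp.toLp 2 (A, -B)) (fun p hp => by
      rw [show p = (p.1, p.2) from rfl, inner_toLp, inner_neg_left, hAB p hp]; ring) (Q φ) (hQK φ)
    rw [hYW, inner_toLp, inner_neg_left] at this
    linear_combination this
  refine ⟨Y, W, fun φ p hp => ?_, hb, fun p hp => ?_⟩
  · have h1 := K.starProjection_inner_eq_zero (WithLp.toLp 2 ((2 : ℂ) • φ, (0 : H)))
      (WithLp.toLp 2 p) (hgen p hp)
    have h2 : K.starProjection (WithLp.toLp 2 ((2 : ℂ) • φ, (0 : H))) =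
      WithLp.toLp 2 (Y φ, W φ) := by rw [← hYW, hQ]
    rw [h2, ← WithLp.toLp_sub, Prod.mk_sub_mk, show p = (p.1, p.2) from rfl, inner_toLp,
      ← inner_conj_symm, ← inner_conj_symm (0 - W φ), ← map_add, starRingEnd_apply,
      star_eq_zero] at h1
    have h3 := hb p.1 p.2 (hS p hp) φ
    rw [inner_sub_right, inner_smul_right, zero_sub, inner_neg_right] at h1
    rw [inner_sub_right]
    linear_combination (1 / 2) * h1 - (1 / 2) * h3
  · have h1 : P (WithLp.toLp 2 ((2 : ℂ) • p.1, (0 : H))) = WithLp.toLp 2 p := by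
      refine Submodule.eq_starProjection_of_mem_of_inner_eq_zero (hgen p hp) fun w hw => ?_
      refine horth _ (fun q hq => ?_) w hw
      rw [show p = (p.1, p.2) from rfl, show q = (q.1, q.2) from rfl, ← WithLp.toLp_sub,
        Prod.mk_sub_mk, inner_toLp, two_smul, add_sub_cancel_right, zero_sub, inner_neg_left,
        hS p hp q hq]
      ring
    have h2 := hYW p.1
    rw [hQ, h1] at h2
    have h3 := congrArg WithLp.ofLp h2
    exact ⟨(congrArg Prod.fst h3).symm, (congrArg Prod.snd h3).symm⟩

variable [CompleteSpace H₁] [CompleteSpace H₂]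

/-- A duality criterion for simultaneous approximation of the values of two operators. -/
lemma exists_mem_span_approx (T : H →L[ℂ] H₁) (L : H →L[ℂ] H₂) (A : Set H) (φ₀ : H)
    (h : ∀ θ : H, (∀ p, T p = 0 → L p = 0 → ⟪θ, p⟫_ℂ = 0) → (∀ φ ∈ A, ⟪θ, φ⟫_ℂ = 0) →
      ⟪θ, φ₀⟫_ℂ = 0) {ε : ℝ} (hε : 0 < ε) :
    ∃ a ∈ Submodule.span ℂ A, ‖T (a - φ₀)‖ < ε ∧ ‖L (a - φ₀)‖ < ε := by
  let M := pairL T L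
  let K : Submodule ℂ (WithLp 2 (H₁ × H₂)) := (Submodule.span ℂ A).map M.toLinearMap
  have hmem : M φ₀ ∈ K.topologicalClosure := by
    rw [← Submodule.orthogonal_orthogonal_eq_closure, Submodule.mem_orthogonal]
    intro l hl
    rw [← ContinuousLinearMap.adjoint_inner_left]
    refine h _ (fun p h1 h2 => ?_) fun φ hφ => ?_
    · rw [ContinuousLinearMap.adjoint_inner_left]
      have : M p = 0 := by rw [pairL_apply, h1, h2]; rfl
      rw [this, inner_zero_right]
    · rw [ContinuousLinearMap.adjoint_inner_left]
      exact (Submodule.mem_orthogonal' K l).1 hl _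
        (Submodule.mem_map_of_mem (f := M.toLinearMap) (Submodule.subset_span hφ))
  obtain ⟨_, ⟨a, ha, rfl⟩, hd⟩ := Metric.mem_closure_iff.1 hmem ε hε
  have hn : ‖M (a - φ₀)‖ < ε := by
    rw [map_sub, ← dist_eq_norm, dist_comm]; exact hd
  exact ⟨a, ha, (WithLp.norm_fst_le _ (M (a - φ₀))).trans_lt hn,
    (WithLp.norm_snd_le _ (M (a - φ₀))).trans_lt hn⟩

end hilbert

section dirichlet
open scoped InnerProductSpace

/-- Square integrable functions on `D`. -/
abbrev L2On (D : Set ℂ) := Lp ℂ 2 (volume.restrict D)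

variable {D : Set ℂ}

lemma inner_eq_setIntegral {F G : L2On D} {f g : ℂ → ℂ} (hF : F =ᵐ[volume.restrict D] f)
    (hG : G =ᵐ[volume.restrict D] g) : ⟪F, G⟫_ℂ = ∫ z in D, g z * conj (f z) := by
  rw [L2.inner_def]
  refine integral_congr_ae ?_
  filter_upwards [hF, hG] with z h1 h2
  rw [h1, h2, RCLike.inner_apply]

/-- A compactly supported continuous function as an element of `L²`. -/
lemma exists_L2_ae_eq {g : ℂ → ℂ} (hg : Continuous g) (hc : HasCompactSupport g) (D : Set ℂ) :
    ∃ p : L2On D, p =ᵐ[volume.restrict D] g :=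
  ⟨_, (hg.memLp_of_hasCompactSupport hc).coeFn_toLp⟩

/-- Pairs `(∂u, ∂̄u)` with `u` a test function on `D`. -/
def gradPairs (D : Set ℂ) : Set (L2On D × L2On D) :=
  {p | ∃ u, ContDiff ℝ ∞ u ∧ HasCompactSupport u ∧ tsupport u ⊆ D ∧
    p.1 =ᵐ[volume.restrict D] dz u ∧ p.2 =ᵐ[volume.restrict D] dbar u}

lemma tsupport_conj (u : ℂ → ℂ) : tsupport (fun z => conj (u z)) = tsupport u := by
  have : Function.support (fun z => conj (u z)) = Function.support u := by
    ext z; simp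
  rw [tsupport, this, tsupport]

lemma contDiff_conj' {u : ℂ → ℂ} (hu : ContDiff ℝ ∞ u) : ContDiff ℝ ∞ fun z => conj (u z) :=
  conjCLE.contDiff.comp hu

lemma hasCompactSupport_conj {u : ℂ → ℂ} (hu : HasCompactSupport u) :
    HasCompactSupport fun z => conj (u z) := by
  rw [HasCompactSupport, tsupport_conj]; exact hu

/-- The orthogonal decomposition with respect to gradients of test functions. -/
lemma exists_dirichlet (D : Set ℂ) : ∃ Y W : L2On D →L[ℂ] L2On D,
    (∀ φ, WeakHolo (φ - Y φ : L2On D) D) ∧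
    (∀ φ, ∀ G : L2On D, WeakHolo G D → ⟪G, Y φ⟫_ℂ = 0) ∧
    (∀ φ Ψ, ContDiff ℝ ∞ Ψ → HasCompactSupport Ψ →
      ∫ z in D, Y φ z * dbar Ψ z = ∫ z in D, W φ z * dz Ψ z) ∧
    ∀ p ∈ gradPairs D, Y p.1 = p.1 ∧ W p.1 = p.2 := by
  have key : ∀ u v : ℂ → ℂ, ContDiff ℝ ∞ u → ContDiff ℝ ∞ v → HasCompactSupport u →
      ∫ z, dz u z * dbar v z = ∫ z, dbar u z * dz v z := fun u v hu hv hc => by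
    have := integral_dbar_mul_dz hv hu hc
    simp only [mul_comm] at this ⊢
    exact this
  obtain ⟨Y, W, h1, h2, h3⟩ := exists_graph_projection (gradPairs D) (by
    rintro p ⟨u, u1, u2, u3, u4, u5⟩ q ⟨v, v1, v2, v3, v4, v5⟩
    rw [inner_eq_setIntegral u4 v4, inner_eq_setIntegral u5 v5]
    have := key v (fun z => conj (u z)) v1 (contDiff_conj' u1) v2
    rw [← setIntegral_mul_dbar (D := D) (by rw [tsupport_conj]; exact u3),
      ← setIntegral_mul_dz (D := D) (by rw [tsupport_conj]; exact u3)] at this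
    simpa only [dbar_conj (u1.diffAt _), dz_conj (u1.diffAt _)] using this)
  refine ⟨Y, W, fun φ ψ s1 s2 s3 => ?_, fun φ G hG => ?_, fun φ Ψ s1 s2 => ?_, h3⟩
  · have c1 := contDiff_conj' s1
    have c2 := hasCompactSupport_conj s2
    obtain ⟨p, hp⟩ := exists_L2_ae_eq c1.dz.continuous c2.dz D
    obtain ⟨q, hq⟩ := exists_L2_ae_eq c1.dbar.continuous c2.dbar D
    have := h1 φ (p, q) ⟨_, c1, c2, by rw [tsupport_conj]; exact s3, hp, hq⟩
    rw [inner_eq_setIntegral hp Filter.EventuallyEq.rfl] at this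
    rw [← setIntegral_mul_dbar s3, ← this]
    simp only [dz_conj (s1.diffAt _), conj_conj]
  · have := h2 G 0 (by
      rintro p ⟨u, u1, u2, u3, u4, u5⟩
      rw [inner_zero_left, inner_eq_setIntegral Filter.EventuallyEq.rfl u4]
      have := hG _ (contDiff_conj' u1) (hasCompactSupport_conj u2)
        (by rw [tsupport_conj]; exact u3)
      rw [← setIntegral_mul_dbar (D := D) (by rw [tsupport_conj]; exact u3)] at this
      have h' := congrArg conj this
      rw [← integral_conj, map_zero] at h'
      rw [← h']
      refine integral_congr_ae (Filter.Eventually.of_forall fun z => ?_)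
      simp only [dbar_conj (u1.diffAt _), map_mul, conj_conj]; ring) φ
    rw [this, inner_zero_left]
  · have c1 := contDiff_conj' s1
    have c2 := hasCompactSupport_conj s2
    obtain ⟨A, hA⟩ := exists_L2_ae_eq c1.dz.continuous c2.dz D
    obtain ⟨B, hB⟩ := exists_L2_ae_eq c1.dbar.continuous c2.dbar D
    have := h2 A B (by
      rintro p ⟨u, u1, u2, u3, u4, u5⟩
      rw [inner_eq_setIntegral hA u4, inner_eq_setIntegral hB u5]
      have := key u Ψ u1 s1 u2
      have e1 : ∫ z, dz u z * dbar Ψ z = ∫ z in D, dz u z * dbar Ψ z := by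
        simp only [mul_comm (dz u _)]; exact (setIntegral_mul_dz u3).symm
      have e2 : ∫ z, dbar u z * dz Ψ z = ∫ z in D, dbar u z * dz Ψ z := by
        simp only [mul_comm (dbar u _)]; exact (setIntegral_mul_dbar u3).symm
      rw [e1, e2] at this
      simpa only [dz_conj (s1.diffAt _), dbar_conj (s1.diffAt _), conj_conj] using this) φ
    rw [inner_eq_setIntegral hA Filter.EventuallyEq.rfl,
      inner_eq_setIntegral hB Filter.EventuallyEq.rfl] at this
    simpa only [dz_conj (s1.diffAt _), dbar_conj (s1.diffAt _), conj_conj] using this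

end dirichlet

section reflection
variable {f w y : ℂ → ℂ} {D N : Set ℂ} {R : ℂ → ℂ}

lemma SchwarzDomain.isOpen_inner (h : SchwarzDomain D N R) : IsOpen (N ∩ D) :=
  h.isOpen_N.inter h.isOpen

lemma SchwarzDomain.isOpen_outer (h : SchwarzDomain D N R) : IsOpen (N \ closure D) :=
  h.isOpen_N.sdiff isClosed_closure

lemma SchwarzDomain.image_inner (h : SchwarzDomain D N R) : R '' (N ∩ D) = N \ closure D := by
  ext z
  constructor
  · rintro ⟨ζ, ⟨h1, h2⟩, rfl⟩
    exact ⟨h.maps ζ h1, h.swap_in ζ h1 h2⟩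
  · rintro ⟨h1, h2⟩
    exact ⟨R z, ⟨h.maps z h1, h.swap_out z h1 h2⟩, h.invol z h1⟩

lemma SchwarzDomain.injOn (h : SchwarzDomain D N R) : InjOn R N := fun a ha b hb hab => by
  rw [← h.invol a ha, hab, h.invol b hb]

lemma SchwarzDomain.hasFDerivAt (h : SchwarzDomain D N R) {z : ℂ} (hz : z ∈ N ∩ D) :
    HasFDerivAt R (wirt 0 (dbar R z)) z := by
  have h1 := (h.smooth.diffAt h.isOpen_N hz.1).hasWirt
  rwa [h.dz_eq_zero z hz.1 fun hf => (h.isOpen.inter_frontier_eq ▸ ⟨hz.2, hf⟩ : z ∈ (∅ : Set ℂ))]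
    at h1

lemma SchwarzDomain.dbar_mul_conj (h : SchwarzDomain D N R) {z : ℂ} (hz : z ∈ N ∩ D) :
    dbar R (R z) * conj (dbar R z) = 1 := by
  have h1 := h.hasFDerivAt hz
  have h2 : HasFDerivAt R (wirt (dz R (R z)) (dbar R (R z))) (R z) :=
    (h.smooth.diffAt h.isOpen_N (h.maps z hz.1)).hasWirt
  have h3 := h2.wirt_comp h1
  have h4 : (fun z => R (R z)) =ᶠ[𝓝 z] fun z => z := by
    filter_upwards [h.isOpen_N.mem_nhds hz.1] with v hv using h.invol v hv
  have h5 := h3.wirt_eq.1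
  rw [dz_congr h4] at h5
  rw [(hasFDerivAt_id' z).wirt_eq.1] at h5
  simpa using h5.symm

lemma abs_det_wirt_zero {z : ℂ} :
    |(wirt 0 (dbar R z)).det| = ‖dbar R z‖ ^ 2 := by
  rw [det_wirt, norm_zero, abs_sub_comm]
  simp

/-- The reflected function outside the domain. -/
def reflect (R w : ℂ → ℂ) (z : ℂ) : ℂ := w (R z) * conj (dbar R z)

lemma SchwarzDomain.setIntegral_outer (h : SchwarzDomain D N R) (G : ℂ → ℂ) :
    ∫ z in N \ closure D, reflect R w z * G z =
      ∫ z in N ∩ D, w z * (G (R z) * conj (dbar R z)) := by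
  rw [← h.image_inner, integral_image_eq_integral_abs_det_fderiv_smul volume
    h.isOpen_inner.measurableSet (fun z hz => (h.hasFDerivAt hz).hasFDerivWithinAt)
    (h.injOn.mono inter_subset_left)]
  refine setIntegral_congr_fun h.isOpen_inner.measurableSet fun z hz => ?_
  have h1 := congrArg conj (h.dbar_mul_conj hz)
  simp only [map_mul, conj_conj, map_one] at h1
  have h2 : (((‖dbar R z‖ ^ 2 : ℝ)) : ℂ) = conj (dbar R z) * dbar R z := by
    rw [← normSq_eq_norm_sq, normSq_eq_conj_mul_self]
  simp only [abs_det_wirt_zero, reflect, h.invol z hz.1, real_smul]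
  rw [h2]
  linear_combination (w z * G (R z) * conj (dbar R z)) * h1

lemma SchwarzDomain.setLIntegral_outer (h : SchwarzDomain D N R) :
    ∫⁻ z in N \ closure D, ‖reflect R w z‖ₑ ^ 2 = ∫⁻ z in N ∩ D, ‖w z‖ₑ ^ 2 := by
  rw [← h.image_inner, lintegral_image_eq_lintegral_abs_det_fderiv_mul volume
    h.isOpen_inner.measurableSet (fun z hz => (h.hasFDerivAt hz).hasFDerivWithinAt)
    (h.injOn.mono inter_subset_left)]
  refine setLIntegral_congr_fun h.isOpen_inner.measurableSet fun z hz => ?_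
  have h1 := congrArg (‖·‖) (h.dbar_mul_conj hz)
  simp only [norm_mul, RCLike.norm_conj, norm_one] at h1
  simp only [abs_det_wirt_zero, reflect, h.invol z hz.1]
  rw [enorm_mul, mul_pow, ← ofReal_norm (conj (dbar R (R z))), RCLike.norm_conj,
    ← ENNReal.ofReal_pow (norm_nonneg _), mul_left_comm, ← ENNReal.ofReal_mul (by positivity),
    ← mul_pow, mul_comm ‖dbar R z‖, h1]
  simp

lemma SchwarzDomain.aestronglyMeasurable_reflect (h : SchwarzDomain D N R) (hw : Measurable w) :
    AEStronglyMeasurable (reflect R w) (volume.restrict (N \ closure D)) := by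
  have hO := h.isOpen_outer.measurableSet
  have h1 : AEMeasurable R (volume.restrict (N \ closure D)) :=
    (h.smooth.continuousOn.mono sdiff_subset).aemeasurable hO
  have h2 : AEMeasurable (dbar R) (volume.restrict (N \ closure D)) :=
    ((h.smooth.dbar h.isOpen_N).continuousOn.mono sdiff_subset).aemeasurable hO
  exact ((hw.comp_aemeasurable h1).mul
    (continuous_conj.measurable.comp_aemeasurable h2)).aestronglyMeasurable

/-- Gluing of a function on the domain with a reflected function outside. -/
def reflExt (D N : Set ℂ) (R f w : ℂ → ℂ) (z : ℂ) : ℂ :=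
  D.indicator f z + (N \ closure D).indicator (reflect R w) z

lemma reflExt_of_mem {z : ℂ} (hz : z ∈ D) : reflExt D N R f w z = f z := by
  rw [reflExt, indicator_of_mem hz, indicator_of_notMem fun h => h.2 (subset_closure hz), add_zero]

lemma SchwarzDomain.lintegral_reflExt (h : SchwarzDomain D N R) :
    ∫⁻ z, ‖reflExt D N R f w z‖ₑ ^ 2 =
      (∫⁻ z in D, ‖f z‖ₑ ^ 2) + ∫⁻ z in N ∩ D, ‖w z‖ₑ ^ 2 := by
  have hO := h.isOpen_outer.measurableSet
  rw [← h.setLIntegral_outer]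
  have hd : Disjoint D (N \ closure D) :=
    disjoint_left.2 fun z h1 h2 => h2.2 (subset_closure h1)
  rw [← lintegral_indicator h.isOpen.measurableSet, ← lintegral_indicator hO]
  have : ∀ z, ‖reflExt D N R f w z‖ₑ ^ 2 = (D ∪ (N \ closure D)).indicator
      (fun z => ‖reflExt D N R f w z‖ₑ ^ 2) z := by
    intro z
    by_cases h1 : z ∈ D ∪ (N \ closure D)
    · rw [indicator_of_mem h1]
    · rw [indicator_of_notMem h1]
      rw [mem_union, not_or] at h1
      simp [reflExt, indicator_of_notMem h1.1, indicator_of_notMem h1.2]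
  rw [lintegral_congr this, lintegral_indicator (h.isOpen.measurableSet.union hO), lintegral_union hO hd,
    ← lintegral_indicator h.isOpen.measurableSet, ← lintegral_indicator hO]
  congr 1
  · refine lintegral_congr fun z => ?_
    by_cases hz : z ∈ D
    · simp only [indicator_of_mem hz, reflExt_of_mem hz]
    · simp [hz]
  · refine lintegral_congr fun z => ?_
    by_cases hz : z ∈ N \ closure D
    · have hzD : z ∉ D := fun h1 => hz.2 (subset_closure h1)
      simp only [indicator_of_mem hz, reflExt, indicator_of_notMem hzD, zero_add]
    · simp only [indicator_of_notMem hz]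

lemma SchwarzDomain.aestronglyMeasurable_reflExt (h : SchwarzDomain D N R)
    (hf : AEStronglyMeasurable f (volume.restrict D)) (hw : Measurable w) :
    AEStronglyMeasurable (reflExt D N R f w) volume :=
  ((aestronglyMeasurable_indicator_iff h.isOpen.measurableSet).2 hf).add
    ((aestronglyMeasurable_indicator_iff h.isOpen_outer.measurableSet).2
      (h.aestronglyMeasurable_reflect hw))

lemma eLpNorm_two_sq {μ : Measure ℂ} (g : ℂ → ℂ) : eLpNorm g 2 μ ^ 2 = ∫⁻ z, ‖g z‖ₑ ^ 2 ∂μ := by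
  have := eLpNorm_nnreal_pow_eq_lintegral (f := g) (μ := μ) (p := 2) (by norm_num)
  simpa using this

lemma SchwarzDomain.eLpNorm_reflExt (h : SchwarzDomain D N R) :
    eLpNorm (reflExt D N R f w) 2 volume ^ 2 =
      eLpNorm f 2 (volume.restrict D) ^ 2 + eLpNorm w 2 (volume.restrict (N ∩ D)) ^ 2 := by
  simp only [eLpNorm_two_sq, h.lintegral_reflExt]

lemma SchwarzDomain.memLp_reflExt (h : SchwarzDomain D N R)
    (hf : MemLp f 2 (volume.restrict D)) (hw : Measurable w)
    (hw2 : MemLp w 2 (volume.restrict (N ∩ D))) : MemLp (reflExt D N R f w) 2 volume := by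
  refine ⟨h.aestronglyMeasurable_reflExt hf.1 hw, ?_⟩
  have h1 := h.eLpNorm_reflExt (f := f) (w := w)
  have h2 : eLpNorm f 2 (volume.restrict D) ^ 2 +
      eLpNorm w 2 (volume.restrict (N ∩ D)) ^ 2 < ⊤ :=
    ENNReal.add_lt_top.2 ⟨ENNReal.pow_lt_top hf.2, ENNReal.pow_lt_top hw2.2⟩
  rw [← h1] at h2
  exact (ENNReal.pow_lt_top_iff.1 h2).resolve_right (by norm_num)

/-- Pull back of a test function supported near the boundary by the reflection. -/
lemma SchwarzDomain.exists_pullback (h : SchwarzDomain D N R) {ψ : ℂ → ℂ} (hψ : ContDiff ℝ ∞ ψ)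
    (hc : HasCompactSupport ψ) (hs : tsupport ψ ⊆ N) :
    ∃ Ψ : ℂ → ℂ, ContDiff ℝ ∞ Ψ ∧ HasCompactSupport Ψ ∧ tsupport Ψ ⊆ N ∧
      ∀ z ∈ N, Ψ z = ψ (R z) := by
  classical
  have hK : IsCompact (R '' tsupport ψ) := IsCompact.image_of_continuousOn hc
    (h.smooth.continuousOn.mono hs)
  have hKN : R '' tsupport ψ ⊆ N := by
    rintro _ ⟨z, hz, rfl⟩; exact h.maps z (hs hz)
  have hsup : tsupport (N.indicator fun z => ψ (R z)) ⊆ R '' tsupport ψ := by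
    refine closure_minimal ?_ hK.isClosed
    intro z hz
    rw [Function.mem_support, indicator_apply_ne_zero] at hz
    exact ⟨R z, subset_tsupport _ hz.2, h.invol z hz.1⟩
  refine ⟨N.indicator fun z => ψ (R z), ?_, hK.of_isClosed_subset (isClosed_tsupport _) hsup,
    hsup.trans hKN, fun z hz => indicator_of_mem hz _⟩
  rw [contDiff_iff_contDiffAt]
  intro z
  by_cases hz : z ∈ N
  · refine ((hψ.comp_contDiffOn h.smooth).contDiffAt
      (h.isOpen_N.mem_nhds hz)).congr_of_eventuallyEq ?_
    filter_upwards [h.isOpen_N.mem_nhds hz] with v hv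
    exact indicator_of_mem hv _
  · refine (contDiffAt_const (c := (0 : ℂ))).congr_of_eventuallyEq ?_
    exact notMem_tsupport_iff_eventuallyEq.1 fun h1 => hz (hKN (hsup h1))

/-- Reflection principle. -/
lemma SchwarzDomain.weakHolo_reflExt (h : SchwarzDomain D N R)
    (hf : WeakHolo f D) (hf2 : MemLp f 2 (volume.restrict D)) (hw : Measurable w)
    (hw2 : MemLp w 2 (volume.restrict (N ∩ D)))
    (hyw : ∀ Ψ : ℂ → ℂ, ContDiff ℝ ∞ Ψ → HasCompactSupport Ψ →
      ∫ z in D, y z * dbar Ψ z = ∫ z in D, w z * dz Ψ z)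
    (hy : ∀ᵐ z ∂volume.restrict D, z ∈ N → y z = - f z) :
    WeakHolo (reflExt D N R f w) (D ∪ N) := by
  have hDm := h.isOpen.measurableSet
  have hIm := h.isOpen_inner.measurableSet
  have hOm := h.isOpen_outer.measurableSet
  have hext := h.memLp_reflExt hf2 hw hw2
  have hDfin : IsFiniteMeasure (volume.restrict D) :=
    ⟨by simpa using h.bounded.measure_lt_top⟩
  have hfi : IntegrableOn f D := hf2.integrable (by norm_num)
  -- pairing with compactly supported continuous functions
  have hintg : ∀ G : ℂ → ℂ, Continuous G → HasCompactSupport G →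
      Integrable fun z => reflExt D N R f w z * G z := fun G hG hGc =>
    hext.integrable_mul (q := 2) (hG.memLp_of_hasCompactSupport hGc)
  have hsplit : ∀ G : ℂ → ℂ, Continuous G → HasCompactSupport G →
      ∫ z, reflExt D N R f w z * G z =
        (∫ z in D, f z * G z) + ∫ z in N \ closure D, reflect R w z * G z := by
    intro G hG hGc
    have hi := hintg G hG hGc
    have e1 : D.indicator (fun z => reflExt D N R f w z * G z) =
        D.indicator fun z => f z * G z := by
      refine funext fun z => ?_
      by_cases hz : z ∈ D
      · simp only [indicator_of_mem hz, reflExt_of_mem hz]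
      · simp only [indicator_of_notMem hz]
    have e2 : (N \ closure D).indicator (fun z => reflExt D N R f w z * G z) =
        (N \ closure D).indicator fun z => reflect R w z * G z := by
      refine funext fun z => ?_
      by_cases hz : z ∈ N \ closure D
      · have hzD : z ∉ D := fun h1 => hz.2 (subset_closure h1)
        simp only [indicator_of_mem hz, reflExt, indicator_of_notMem hzD, zero_add]
      · simp only [indicator_of_notMem hz]
    rw [← integral_indicator hDm, ← integral_indicator hOm, ← e1, ← e2,
      ← integral_add (hi.indicator hDm) (hi.indicator hOm)]
    refine integral_congr_ae (Filter.Eventually.of_forall fun z => ?_)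
    by_cases hz : z ∈ D
    · have : z ∉ N \ closure D := fun h1 => h1.2 (subset_closure hz)
      simp [indicator_of_mem hz, indicator_of_notMem this]
    · by_cases hz2 : z ∈ N \ closure D
      · simp only [indicator_of_mem hz2, indicator_of_notMem hz, zero_add]
      · simp [reflExt, indicator_of_notMem hz, indicator_of_notMem hz2]
  intro ψ hψ hψc hψs
  obtain ⟨χ, hχ, hχc, hχs, W, hWo, hKW, -, hχ1⟩ :=
    exists_cutoff (K := tsupport ψ \ D) (U := N) (hψc.diff h.isOpen) h.isOpen_N
      fun z hz => (hψs hz.1).resolve_left hz.2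
  have hχ' : ContDiff ℝ ∞ fun z => (χ z : ℂ) := ofRealCLM.contDiff.comp hχ
  let ψ₂ : ℂ → ℂ := fun z => χ z * ψ z
  let ψ₁ : ℂ → ℂ := fun z => ψ z - ψ₂ z
  have h2 : ContDiff ℝ ∞ ψ₂ := hχ'.mul hψ
  have h1 : ContDiff ℝ ∞ ψ₁ := hψ.sub h2
  have h2c : HasCompactSupport ψ₂ := hψc.mul_left
  have h1c : HasCompactSupport ψ₁ := hψc.sub h2c
  have h2s : tsupport ψ₂ ⊆ N := by
    refine (tsupport_mul_subset_left).trans (subset_trans ?_ hχs)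
    refine closure_mono fun z hz => ?_
    simpa using hz
  have h1s : tsupport ψ₁ ⊆ D := by
    intro z hz
    by_contra hzD
    refine notMem_tsupport_iff_eventuallyEq.2 ?_ hz
    by_cases hzs : z ∈ tsupport ψ
    · filter_upwards [hWo.mem_nhds (hKW ⟨hzs, hzD⟩)] with v hv
      simp [ψ₁, ψ₂, hχ1 v hv]
    · filter_upwards [notMem_tsupport_iff_eventuallyEq.1 hzs] with v hv
      simp [ψ₁, ψ₂, hv]
  obtain ⟨Ψ, hΨ, hΨc, hΨs, hΨe⟩ := h.exists_pullback h2 h2c h2s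
  have hθ0 : ∫ z in D, f z * dbar (fun z => Ψ z - ψ₂ z) z = 0 := by
    obtain ⟨C, hC⟩ := h2.lipschitzWith_of_hasCompactSupport h2c (by simp)
    refine h.setIntegral_eq_zero hf hfi (hΨ.sub h2) (hΨc.sub h2c)
      ((tsupport_sub _ _).trans (union_subset hΨs h2s)) (C := C) fun z hz => ?_
    rw [hΨe z hz, ← dist_eq_norm, ← dist_eq_norm, dist_comm z]
    exact hC.dist_le_mul _ _
  have hsum : ∀ z, dbar ψ z = dbar ψ₁ z + dbar ψ₂ z := fun z => by
    rw [← dbar_add (h1.diffAt z) (h2.diffAt z)]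
    congr 1
    funext v; simp [ψ₁]
  have A1 : ∫ z, reflExt D N R f w z * dbar ψ₁ z = 0 := by
    rw [← hf ψ₁ h1 h1c h1s]
    refine integral_congr_ae (Filter.Eventually.of_forall fun z => ?_)
    by_cases hz : z ∈ D
    · simp only [reflExt_of_mem hz]
    · simp only [dbar_eq_zero_of_notMem_tsupport fun h => hz (h1s h), mul_zero]
  have A2 : ∫ z in N \ closure D, reflect R w z * dbar ψ₂ z = ∫ z in D, w z * dz Ψ z := by
    rw [h.setIntegral_outer]
    have : ∫ z in D, w z * dz Ψ z = ∫ z in N ∩ D, w z * dz Ψ z := by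
      rw [← integral_indicator hDm, ← integral_indicator hIm]
      refine integral_congr_ae (Filter.Eventually.of_forall fun z => ?_)
      by_cases hzD : z ∈ D
      · by_cases hzN : z ∈ N
        · simp [indicator, hzD, hzN]
        · simp only [indicator, hzD, hzN, mem_inter_iff, false_and, if_true, if_false,
            dz_eq_zero_of_notMem_tsupport fun h => hzN (hΨs h), mul_zero]
      · simp [indicator, hzD]
    rw [this]
    refine setIntegral_congr_fun hIm fun z hz => ?_
    have e1 : Ψ =ᶠ[𝓝 z] fun v => ψ₂ (R v) := by
      filter_upwards [h.isOpen_N.mem_nhds hz.1] with v hv using hΨe v hv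
    have e2 := ((h2.diffAt (R z)).hasWirt.wirt_comp (h.hasFDerivAt hz)).wirt_eq.1
    simp only [dz_congr e1]
    rw [e2]
    simp
  have A3 : ∫ z in D, y z * dbar Ψ z = - ∫ z in D, f z * dbar Ψ z := by
    rw [← integral_neg]
    refine integral_congr_ae ?_
    filter_upwards [hy] with z hz
    by_cases hzN : z ∈ N
    · rw [hz hzN, neg_mul]
    · simp only [dbar_eq_zero_of_notMem_tsupport fun h => hzN (hΨs h), mul_zero, neg_zero]
  have hfG : ∀ G : ℂ → ℂ, Continuous G → HasCompactSupport G →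
      Integrable (fun z => f z * G z) (volume.restrict D) := fun G hG hGc =>
    hf2.integrable_mul (q := 2) ((hG.memLp_of_hasCompactSupport hGc).restrict D)
  have A4 : ∫ z in D, f z * dbar Ψ z = ∫ z in D, f z * dbar ψ₂ z := by
    rw [← sub_eq_zero, ← integral_sub (hfG _ hΨ.dbar.continuous hΨc.dbar)
      (hfG _ h2.dbar.continuous h2c.dbar), ← hθ0]
    refine integral_congr_ae (Filter.Eventually.of_forall fun z => ?_)
    simp only
    rw [dbar_sub (hΨ.diffAt z) (h2.diffAt z)]
    ring
  simp_rw [hsum, mul_add]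
  rw [integral_add (hintg _ h1.dbar.continuous h1c.dbar) (hintg _ h2.dbar.continuous h2c.dbar), A1,
    hsplit _ h2.dbar.continuous h2c.dbar, A2, ← hyw Ψ hΨ hΨc, A3, A4]
  ring

end reflection

section approx
open scoped InnerProductSpace
variable {f g : ℂ → ℂ} {D N U : Set ℂ} {R : ℂ → ℂ} {a : ℂ}

lemma WeakHolo.congr_ae (hf : WeakHolo f D) (hfg : f =ᵐ[volume.restrict D] g) : WeakHolo g D := by
  intro ψ h1 h2 h3
  rw [← hf ψ h1 h2 h3, ← setIntegral_mul_dbar h3, ← setIntegral_mul_dbar h3]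
  refine integral_congr_ae ?_
  filter_upwards [hfg] with z hz
  rw [hz]

/-- Integration of holomorphic functions is represented by a compactly supported function. -/
lemma SchwarzDomain.exists_representer (h : SchwarzDomain D N R) :
    ∃ q : ℂ → ℂ, Continuous q ∧ HasCompactSupport q ∧ (∃ K, IsCompact K ∧ K ⊆ D ∧
      ∀ z ∈ D, z ∉ K → q z = 0) ∧ ∀ G, WeakHolo G D → IntegrableOn G D →
        ∫ z in D, G z = ∫ z in D, G z * conj (q z) := by
  have hfc : IsCompact (frontier D) := h.bounded.isCompact_closure.of_isClosed_subset
    isClosed_frontier frontier_subset_closure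
  obtain ⟨χ, hχ, hχc, hχs, W, hWo, hKW, hWN, hχ1⟩ :=
    exists_cutoff hfc h.isOpen_N h.frontier_subset
  have hχ' : ContDiff ℝ ∞ fun z => (χ z : ℂ) := ofRealCLM.contDiff.comp hχ
  have hχc' : HasCompactSupport fun z => (χ z : ℂ) := hχc.comp_left (g := fun x : ℝ => (x : ℂ)) rfl
  let Q : ℂ → ℂ := fun z => χ z • R z
  have hQ : ContDiff ℝ ∞ Q := contDiff_mul_of_contDiffOn h.isOpen_N hχ hχs h.smooth
  have hQc : HasCompactSupport Q := hχc.smul_right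
  have hQs : tsupport Q ⊆ N := (tsupport_smul_subset_left _ _).trans hχs
  have hmem : ∀ {z}, z ∈ D → z ∉ frontier D := fun hz hf => by
    rw [h.isOpen.frontier_eq] at hf
    exact hf.2 hz
  refine ⟨dz Q, hQ.dz.continuous, hQc.dz, ⟨closure D \ W, h.bounded.isCompact_closure.diff hWo,
    ?_, ?_⟩, ?_⟩
  · rintro z ⟨h1, h2⟩
    by_contra h3
    exact h2 (hKW ⟨h1, by rwa [h.isOpen.interior_eq]⟩)
  · intro z hz hzK
    have hzW : z ∈ W := by
      by_contra h1; exact hzK ⟨subset_closure hz, h1⟩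
    have : Q =ᶠ[𝓝 z] R := by
      filter_upwards [hWo.mem_nhds hzW] with v hv
      simp [Q, hχ1 v hv]
    rw [dz_congr this, h.dz_eq_zero z (hWN hzW) (hmem hz)]
  · intro G hG hGi
    have hcont : ∀ u : ℂ → ℂ, ContDiff ℝ ∞ u → IntegrableOn (fun z => G z * dbar u z) D := by
      intro u hu
      obtain ⟨C, hC⟩ := h.bounded.isCompact_closure.exists_bound_of_continuousOn
        hu.dbar.continuous.continuousOn
      refine hGi.mul_bdd (c := C) hu.dbar.continuous.aestronglyMeasurable ?_
      exact (ae_restrict_iff' h.isOpen.measurableSet).2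
        (Filter.Eventually.of_forall fun z hz => hC z (subset_closure hz))
    let θ₁ : ℂ → ℂ := fun z => (1 - χ z) * conj z
    let θ₂ : ℂ → ℂ := fun z => χ z * conj z - conj (Q z)
    have hconj : ContDiff ℝ ∞ fun z : ℂ => conj z := contDiff_conj' contDiff_id
    have s1 : ContDiff ℝ ∞ θ₁ := (contDiff_const.sub hχ').mul hconj
    have s2 : ContDiff ℝ ∞ θ₂ := (hχ'.mul hconj).sub (contDiff_conj' hQ)
    have I1 : ∫ z in D, G z * dbar θ₁ z = 0 := by
      refine hG.setIntegral_eq_zero h.isOpen h.bounded s1 fun z hz => ?_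
      filter_upwards [hWo.mem_nhds (hKW hz)] with v hv
      simp [θ₁, hχ1 v hv]
    have I2 : ∫ z in D, G z * dbar θ₂ z = 0 := by
      obtain ⟨C, hC⟩ := hχc'.exists_bound_of_continuous hχ'.continuous
      refine h.setIntegral_eq_zero hG hGi s2
        (hχc'.mul_right.sub (hasCompactSupport_conj hQc)) ?_ (C := C) ?_
      · refine (tsupport_sub _ _).trans (union_subset ?_ ?_)
        · refine tsupport_mul_subset_left.trans (subset_trans (closure_mono ?_) hχs)
          intro z hz
          simpa using hz
        · rw [tsupport_conj]; exact hQs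
      · intro z _
        have : θ₂ z = χ z * conj (z - R z) := by
          simp only [θ₂, Q, real_smul, map_mul, conj_ofReal, map_sub]; ring
        rw [this, norm_mul, RCLike.norm_conj]
        exact mul_le_mul_of_nonneg_right (hC z) (norm_nonneg _)
    have hd : ∀ z, dbar θ₁ z + dbar θ₂ z = 1 - conj (dz Q z) := by
      intro z
      rw [← dbar_add (s1.diffAt z) (s2.diffAt z), ← dbar_conj (hQ.diffAt z)]
      have e1 : (fun z => θ₁ z + θ₂ z) = fun z => conj z - conj (Q z) := by
        funext v; simp only [θ₁, θ₂]; ring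
      rw [e1, dbar_sub (hconj.diffAt z) ((contDiff_conj' hQ).diffAt z),
        (hasFDerivAt_conj z).wirt_eq.2]
    have := integral_add (hcont θ₁ s1) (hcont θ₂ s2)
    rw [I1, I2, add_zero] at this
    have hc : Integrable (fun z => G z * conj (dz Q z)) (volume.restrict D) := by
      refine (hcont _ (contDiff_conj' hQ)).congr (Filter.Eventually.of_forall fun z => ?_)
      simp only [dbar_conj (hQ.diffAt z)]
    rw [← sub_eq_zero, ← integral_sub hGi hc, ← this]
    refine integral_congr_ae (Filter.Eventually.of_forall fun z => ?_)
    simp only [← mul_add, hd]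
    ring

/-- Functions vanishing on gradients of test functions and on derivative kernels. -/
lemma ae_eq_zero_of_orthogonal {D' : Set ℂ} {r : ℝ} (hD : IsOpen D) (hD' : IsOpen D')
    (hc : IsConnected D') (hDD : D' ⊆ D) (hDb : Bornology.IsBounded D) (ha : a ∈ D')
    (hr : ball a r ⊆ D') {κ : ℕ → ℂ → ℂ}
    (hκs : ∀ k, tsupport (κ k) ⊆ ball a r)
    (hκ : ∀ k G, DifferentiableOn ℂ G (ball a r) → ∫ z, G z * κ k z = iteratedDeriv k G a)
    (θ : L2On D) (h1 : ∀ p ∈ gradPairs D, (∀ᵐ z ∂volume.restrict D, z ∉ D' → p.2 z = 0) →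
      ⟪θ, p.1⟫_ℂ = 0) (h2 : ∀ k, ∫ z in D, θ z * κ k z = 0) :
    ∀ᵐ z ∂volume.restrict D, z ∈ D' → θ z = 0 := by
  have hDm := hD.measurableSet
  have hw : WeakHolo (D.indicator θ) D' := by
    intro ψ u1 u2 u3
    have v1 := contDiff_conj' u1
    have v2 := hasCompactSupport_conj u2
    obtain ⟨p, hp⟩ := exists_L2_ae_eq v1.dz.continuous v2.dz D
    obtain ⟨q, hq⟩ := exists_L2_ae_eq v1.dbar.continuous v2.dbar D
    have := h1 (p, q) ⟨_, v1, v2, by rw [tsupport_conj]; exact u3.trans hDD, hp, hq⟩ (by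
      filter_upwards [hq] with z hz hzD
      rw [hz]
      exact dbar_eq_zero_of_notMem_tsupport fun h => hzD (u3 (by rwa [tsupport_conj] at h)))
    rw [inner_eq_setIntegral (Filter.EventuallyEq.refl _ _) hp] at this
    have e : ∫ z, D.indicator θ z * dbar ψ z = ∫ z in D, θ z * dbar ψ z := by
      rw [← integral_indicator hDm]
      refine integral_congr_ae (Filter.Eventually.of_forall fun z => ?_)
      by_cases hz : z ∈ D <;> simp [hz]
    rw [e, ← (starRingEnd ℂ).injective.eq_iff, map_zero, ← integral_conj, ← this]
    refine integral_congr_ae (Filter.Eventually.of_forall fun z => ?_)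
    simp only [map_mul, dz_conj (u1.diffAt z)]
    ring
  have hfin : IsFiniteMeasure (volume.restrict D) := ⟨by simpa using hDb.measure_lt_top⟩
  have hθi : Integrable (D.indicator θ) volume :=
    (integrable_indicator_iff hDm).2 ((Lp.memLp θ).integrable (by norm_num))
  obtain ⟨G, hG, hGe⟩ := hw.exists_holo hD' hθi
  have hG0 : ∀ z ∈ D', G z = 0 := by
    refine eq_zero_of_iteratedDeriv_eq_zero hD' hc.isPreconnected ha hG fun k => ?_
    rw [← hκ k G (hG.mono hr), ← h2 k, ← integral_indicator hDm]
    refine integral_congr_ae ?_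
    filter_upwards [hGe] with z hz
    by_cases hzD : z ∈ D'
    · simp only [indicator_of_mem (hDD hzD), ← hz hzD]
    · have : κ k z = 0 := image_eq_zero_of_notMem_tsupport fun h => hzD (hr (hκs k h))
      simp [this, indicator]
  rw [ae_restrict_iff' hDm]
  filter_upwards [hGe] with z hz hzD hzD'
  have := hz hzD'
  rwa [indicator_of_mem hzD, hG0 z hzD'] at this

end approx

section quad
open scoped InnerProductSpace
variable {f g : ℂ → ℂ} {D N U : Set ℂ} {R : ℂ → ℂ} {a : ℂ}

/-- Pairing with `H` is a combination of derivatives at `a` on the Bergman space. -/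
def Quad (D : Set ℂ) (a : ℂ) (H : ℂ → ℂ) : Prop :=
  ∃ c : ℕ →₀ ℂ, ∀ G, BergmanFun D G →
    ∫ z in D, G z * conj (H z) = c.sum fun k x => x * iteratedDeriv k G a

lemma BergmanFun.memLp (hG : BergmanFun D g) (hD : IsOpen D) : MemLp g 2 (volume.restrict D) := by
  rw [memLp_two_iff_integrable_sq_norm
    (hG.1.continuousOn.aestronglyMeasurable hD.measurableSet)]
  exact hG.2

lemma eq_one_of_ae {V : Set ℂ} {H : ℂ → ℂ} (hV : IsOpen V) (hVc : IsPreconnected V)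
    (hD : IsOpen D) (hDV : D ⊆ V) (ha : a ∈ D) (hH : DifferentiableOn ℂ H V)
    (h : H =ᵐ[volume.restrict D] fun _ => 1) : ∀ z ∈ V, H z = 1 := by
  have h1 : EqOn H (fun _ => 1) D := Measure.eqOn_open_of_ae_eq h hD
    (hH.continuousOn.mono hDV) continuousOn_const
  have h2 := (hH.analyticOnNhd hV).eqOn_of_preconnected_of_eventuallyEq
    (analyticOnNhd_const (v := (1 : ℂ))) hVc (hDV ha) (by
      filter_upwards [hD.mem_nhds ha] with z hz using h1 hz)
  exact h2

lemma WeakHolo.sub (hf : WeakHolo f D) (hg : WeakHolo g D) (hf2 : MemLp f 2 (volume.restrict D))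
    (hg2 : MemLp g 2 (volume.restrict D)) : WeakHolo (fun z => f z - g z) D := by
  intro ψ h1 h2 h3
  have hi : ∀ {u : ℂ → ℂ}, MemLp u 2 (volume.restrict D) →
      Integrable (fun z => u z * dbar ψ z) (volume.restrict D) := fun hu =>
    hu.integrable_mul (q := 2) ((h1.dbar.continuous.memLp_of_hasCompactSupport h2.dbar).restrict D)
  have e1 := hf ψ h1 h2 h3
  have e2 := hg ψ h1 h2 h3
  rw [← setIntegral_mul_dbar h3] at e1 e2 ⊢
  simp only [sub_mul]
  rw [integral_sub (hi hf2) (hi hg2), e1, e2, sub_zero]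

lemma reflExt_sub {f₁ f₂ w₁ w₂ : ℂ → ℂ} (z : ℂ) : reflExt D N R f₁ w₁ z - reflExt D N R f₂ w₂ z =
    reflExt D N R (f₁ - f₂) (w₁ - w₂) z := by
  simp only [reflExt, indicator, reflect, Pi.sub_apply]
  split_ifs <;> ring

/-- Approximation of the constant one by functions with the quadrature property. -/
theorem SchwarzDomain.exists_quad_approx_L2 (h : SchwarzDomain D N R) (ha : a ∈ D) :
    ∃ V, IsOpen V ∧ IsConnected V ∧ closure D ⊆ V ∧ ∀ ε : ℝ, 0 < ε → ∃ H, DifferentiableOn ℂ H V ∧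
      Quad D a H ∧ MemLp (fun z => H z - 1) 2 (volume.restrict V) ∧
      eLpNorm (fun z => H z - 1) 2 (volume.restrict V) ^ 2 ≤ ENNReal.ofReal ε := by
  have hDm := h.isOpen.measurableSet
  have hfin : IsFiniteMeasure (volume.restrict D) := ⟨by simpa using h.bounded.measure_lt_top⟩
  obtain ⟨q, hq, hqc, ⟨K, hK, hKD, hqK⟩, hrep⟩ := h.exists_representer
  obtain ⟨D', hD', hD'c, haD', hKD', hDsup⟩ :=
    exists_isConnected_between h.isOpen h.connected ha hK hKD
  obtain ⟨ρ, hρ⟩ := h.bounded.subset_ball 0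
  obtain ⟨ρ', hρ'⟩ := h.bounded.closure.subset_ball 0
  let U : Set ℂ := (closure D')ᶜ ∩ ball 0 ρ'
  have hUo : IsOpen U := isClosed_closure.isOpen_compl.inter isOpen_ball
  have hfU : frontier D ⊆ U := fun z hz => by
    refine ⟨fun h1 => ?_, hρ' (frontier_subset_closure hz)⟩
    rw [h.isOpen.frontier_eq] at hz
    exact hz.2 (hDsup h1)
  have hS := h.shrink hUo hfU
  set N' := N ∩ U ∩ {z | z ∈ N ∧ R z ∈ U} with hN'
  have hN'U : N' ⊆ U := fun z hz => hz.1.2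
  have hdisj : ∀ z ∈ D', z ∉ N' := fun z hz hz' => (hN'U hz').1 (subset_closure hz)
  have hDsub : D' ⊆ D := subset_closure.trans hDsup
  obtain ⟨r, hr0, hr⟩ := Metric.isOpen_iff.1 hD' a haD'
  obtain ⟨κ, hκ⟩ := exists_derivative_kernel a hr0
  obtain ⟨Y, W, hY1, hY2, hYW, hgrad⟩ := exists_dirichlet D
  have hκL : ∀ k, ∃ p : L2On D, p =ᵐ[volume.restrict D] fun z => conj (κ k z) := fun k =>
    exists_L2_ae_eq (contDiff_conj' (hκ k).1).continuous (hasCompactSupport_conj (hκ k).2.1) D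
  choose φ hφ using hκL
  obtain ⟨φβ, hφβ⟩ := exists_L2_ae_eq hq hqc D
  let T : L2On D →L[ℂ] L2On D := ContinuousLinearMap.id ℂ _ - Y
  let L := (LpToLpRestrictCLM ℂ ℂ ℂ (volume.restrict D) 2 N').comp W
  have hTapp : ∀ p, T p = p - Y p := fun p => rfl
  have hLapp : ∀ p, L p =ᵐ[(volume.restrict D).restrict N'] W p := fun p =>
    LpToLpRestrictCLM_coeFn ℂ N' (W p)
  have hN'm := hS.isOpen_N.measurableSet
  have hdense : ∀ θ : L2On D, (∀ p, T p = 0 → L p = 0 → ⟪θ, p⟫_ℂ = 0) →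
      (∀ p ∈ range φ, ⟪θ, p⟫_ℂ = 0) → ⟪θ, φβ⟫_ℂ = 0 := by
    intro θ t1 t2
    have h0 := ae_eq_zero_of_orthogonal h.isOpen hD' hD'c hDsub h.bounded haD' hr
      (fun k => (hκ k).2.2.1) (fun k => (hκ k).2.2.2) θ (by
        intro p hp hp0
        obtain ⟨g1, g2⟩ := hgrad p hp
        refine t1 p.1 (by rw [hTapp, g1, sub_self]) ?_
        rw [Lp.eq_zero_iff_ae_eq_zero]
        refine (hLapp p.1).trans ?_
        rw [g2, Filter.EventuallyEq, ae_restrict_iff' hN'm]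
        filter_upwards [hp0] with z hz hzN
        exact hz fun hzD => hdisj z hzD hzN) (by
        intro k
        have := t2 (φ k) ⟨k, rfl⟩
        rw [inner_eq_setIntegral (Filter.EventuallyEq.refl _ _) (hφ k)] at this
        rw [← (starRingEnd ℂ).injective.eq_iff, map_zero, ← integral_conj, ← this]
        refine integral_congr_ae (Filter.Eventually.of_forall fun z => ?_)
        simp only [map_mul]
        ring)
    rw [inner_eq_setIntegral (Filter.EventuallyEq.refl _ _) hφβ]
    refine integral_eq_zero_of_ae ?_
    filter_upwards [h0, ae_restrict_mem hDm] with z hz hzD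
    by_cases hzD' : z ∈ D'
    · simp [hz hzD']
    · simp [hqK z hzD fun hzK => hzD' (hKD' hzK)]
  -- the reflected extension
  have hext : ∀ p : L2On D, (∀ᵐ z ∂volume.restrict D, z ∈ N' → p z = 0) →
      ∃ H, DifferentiableOn ℂ H (D ∪ N') ∧
        ∀ᵐ z, z ∈ D ∪ N' → reflExt D N' R (T p) (W p) z = H z := by
    intro p hp
    have hw := hS.weakHolo_reflExt (f := T p) (w := W p) (y := Y p) (hY1 p) (Lp.memLp _)
      (Lp.stronglyMeasurable _).measurable
      (by rw [← Measure.restrict_restrict hN'm]; exact (Lp.memLp _).restrict _) (hYW p) (by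
        filter_upwards [hp, Lp.coeFn_sub p (Y p)] with z h1 h2 hz
        rw [hTapp, h2, Pi.sub_apply, h1 hz]; ring)
    have hm := hS.memLp_reflExt (f := T p) (w := W p) (Lp.memLp _)
      (Lp.stronglyMeasurable _).measurable
      (by rw [← Measure.restrict_restrict hN'm]; exact (Lp.memLp _).restrict _)
    refine hw.exists_holo (h.isOpen.union hS.isOpen_N) ?_
    have hb : volume (ball (0 : ℂ) ρ') < ⊤ := measure_ball_lt_top
    have hfb : IsFiniteMeasure (volume.restrict (ball (0 : ℂ) ρ')) := ⟨by simpa using hb⟩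
    have hi : IntegrableOn (reflExt D N' R (T p) (W p)) (ball 0 ρ') :=
      (hm.restrict _).integrable (by norm_num)
    refine (integrableOn_iff_integrable_of_support_subset ?_).1 hi
    intro z hz
    by_contra hzb
    refine hz ?_
    have z1 : z ∉ D := fun h1 => hzb (hρ' (subset_closure h1))
    have z2 : z ∉ N' \ closure D := fun h1 => hzb (hN'U h1.1).2
    simp [reflExt, indicator_of_notMem z1, indicator_of_notMem z2]
  -- the projection of the representer is constant
  let one : L2On D := (memLp_const (1 : ℂ)).toLp
  have hone : one =ᵐ[volume.restrict D] fun _ => (1 : ℂ) := (memLp_const (1 : ℂ)).coeFn_toLp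
  have hTβ : one = T φβ := by
    have hw : WeakHolo (one - T φβ : L2On D) D := by
      have w1 : WeakHolo (fun z => 1 - (T φβ) z) D :=
        ((differentiableOn_const (1 : ℂ)).weakHolo h.isOpen).sub (hY1 φβ) (memLp_const _)
          (Lp.memLp _)
      refine w1.congr_ae ?_
      filter_upwards [hone, Lp.coeFn_sub one (T φβ)] with z h1 h2
      rw [h2, Pi.sub_apply, h1]
    have hi : IntegrableOn (one - T φβ : L2On D) D := (Lp.memLp _).integrable (by norm_num)
    have h1 := congrArg conj (hrep _ hw hi)
    rw [← integral_conj, ← integral_conj] at h1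
    have h2 : ⟪one - T φβ, one⟫_ℂ = ⟪one - T φβ, φβ⟫_ℂ := by
      rw [inner_eq_setIntegral (Filter.EventuallyEq.refl _ _) hone,
        inner_eq_setIntegral (Filter.EventuallyEq.refl _ _) hφβ]
      simp only [map_mul, conj_conj] at h1
      simp only [one_mul]
      rw [h1]
      refine integral_congr_ae (Filter.Eventually.of_forall fun z => ?_)
      simp only
      ring
    rw [← sub_eq_zero, ← inner_self_eq_zero (𝕜 := ℂ)]
    nth_rw 2 [hTapp]
    rw [inner_sub_right, inner_sub_right, h2, hY2 _ _ hw]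
    ring
  obtain ⟨Hβ, hHβ, hHβe⟩ := hext φβ (by
    filter_upwards [hφβ, ae_restrict_mem hDm] with z h1 h2 h3
    rw [h1, hqK z h2 fun hzK => hdisj z (hKD' hzK) h3])
  have hVo : IsOpen (D ∪ N') := h.isOpen.union hS.isOpen_N
  have hclV : closure D ⊆ D ∪ N' := by
    intro z hz
    by_cases hzD : z ∈ D
    · exact Or.inl hzD
    · exact Or.inr (hS.frontier_subset (by rw [h.isOpen.frontier_eq]; exact ⟨hz, hzD⟩))
  let V := connectedComponentIn (D ∪ N') a
  have hVV : V ⊆ D ∪ N' := connectedComponentIn_subset _ _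
  have hVo' : IsOpen V := hVo.connectedComponentIn
  have hVc : IsConnected V := isConnected_connectedComponentIn_iff.2 (Or.inl ha)
  have hclV' : closure D ⊆ V :=
    h.connected.isPreconnected.closure.subset_connectedComponentIn (subset_closure ha) hclV
  have hDV : D ⊆ V := subset_closure.trans hclV'
  have hTD : ∀ {p : L2On D} {H : ℂ → ℂ},
      (∀ᵐ z, z ∈ D ∪ N' → reflExt D N' R (T p) (W p) z = H z) →
      H =ᵐ[volume.restrict D] T p := by
    intro p H hH
    rw [Filter.EventuallyEq, ae_restrict_iff' hDm]
    filter_upwards [hH] with z hz hzD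
    rw [← hz (Or.inl hzD), reflExt_of_mem hzD]
  have hHβ1 : ∀ z ∈ V, Hβ z = 1 :=
    eq_one_of_ae hVo' hVc.isPreconnected h.isOpen hDV ha (hHβ.mono hVV) (by
      refine (hTD hHβe).trans ?_
      rw [← hTβ]; exact hone)
  refine ⟨V, hVo', hVc, hclV', fun ε hε => ?_⟩
  obtain ⟨p, hp, hpT, hpL⟩ := exists_mem_span_approx T L (range φ) φβ hdense
    (ε := Real.sqrt (ε / 2)) (by positivity)
  have hp0 : ∀ᵐ z ∂volume.restrict D, z ∈ N' → p z = 0 := by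
    refine Submodule.span_induction (p := fun p _ => ∀ᵐ z ∂volume.restrict D, z ∈ N' → p z = 0)
      ?_ ?_ ?_ ?_ hp
    · rintro _ ⟨k, rfl⟩
      filter_upwards [hφ k] with z hz hzN
      rw [hz, image_eq_zero_of_notMem_tsupport fun h1 => hdisj z (hr ((hκ k).2.2.1 h1)) hzN,
        map_zero]
    · filter_upwards [Lp.coeFn_zero ℂ 2 (volume.restrict D)] with z hz _
      rw [hz]; rfl
    · intro x y _ _ hx hy
      filter_upwards [hx, hy, Lp.coeFn_add x y] with z h1 h2 h3 h4
      rw [h3, Pi.add_apply, h1 h4, h2 h4, add_zero]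
    · intro c x _ hx
      filter_upwards [hx, Lp.coeFn_smul c x] with z h1 h2 h4
      rw [h2, Pi.smul_apply, h1 h4, smul_zero]
  obtain ⟨H, hH, hHe⟩ := hext p hp0
  have hquad : ∃ c : ℕ →₀ ℂ, ∀ G, ∀ hG : BergmanFun D G,
      ⟪p, (hG.memLp h.isOpen).toLp⟫_ℂ = c.sum fun k x => x * iteratedDeriv k G a := by
    refine Submodule.span_induction (p := fun p _ => ∃ c : ℕ →₀ ℂ, ∀ G, ∀ hG : BergmanFun D G,
      ⟪p, (hG.memLp h.isOpen).toLp⟫_ℂ = c.sum fun k x => x * iteratedDeriv k G a) ?_ ?_ ?_ ?_ hp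
    · rintro _ ⟨k, rfl⟩
      refine ⟨Finsupp.single k 1, fun G hG => ?_⟩
      rw [Finsupp.sum_single_index (by simp), one_mul,
        inner_eq_setIntegral (hφ k) (hG.memLp h.isOpen).coeFn_toLp,
        ← (hκ k).2.2.2 G (hG.1.mono (hr.trans hDsub))]
      simp only [conj_conj]
      refine setIntegral_eq_integral_of_forall_compl_eq_zero fun z hz => ?_
      rw [image_eq_zero_of_notMem_tsupport fun h1 => hz (hDsub (hr ((hκ k).2.2.1 h1))), mul_zero]
    · exact ⟨0, fun G hG => by simp⟩
    · rintro x y _ _ ⟨c, hc⟩ ⟨d, hd⟩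
      refine ⟨c + d, fun G hG => ?_⟩
      rw [inner_add_left, hc G hG, hd G hG,
        Finsupp.sum_add_index' (fun _ => zero_mul _) fun _ _ _ => add_mul _ _ _]
    · rintro b x _ ⟨c, hc⟩
      refine ⟨conj b • c, fun G hG => ?_⟩
      rw [inner_smul_left, hc G hG, Finsupp.sum_smul_index fun _ => zero_mul _, Finsupp.mul_sum]
      simp only [mul_assoc]
  have hdiff : ∀ᵐ z ∂volume.restrict V, H z - 1 =
      reflExt D N' R (⇑(T p) - ⇑(T φβ)) (⇑(W p) - ⇑(W φβ)) z := by
    rw [ae_restrict_iff' hVo'.measurableSet]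
    filter_upwards [hHe, hHβe] with z h1 h2 hz
    rw [← reflExt_sub, h1 (hVV hz), h2 (hVV hz), hHβ1 z hz]
  have hmT : MemLp (⇑(T p) - ⇑(T φβ)) 2 (volume.restrict D) := (Lp.memLp _).sub (Lp.memLp _)
  have hmW : MemLp (⇑(W p) - ⇑(W φβ)) 2 (volume.restrict (N' ∩ D)) := by
    rw [← Measure.restrict_restrict hN'm]
    exact ((Lp.memLp _).sub (Lp.memLp _)).restrict _
  have hml : MemLp (reflExt D N' R (⇑(T p) - ⇑(T φβ)) (⇑(W p) - ⇑(W φβ))) 2 volume :=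
    hS.memLp_reflExt hmT
      ((Lp.stronglyMeasurable _).measurable.sub (Lp.stronglyMeasurable _).measurable) hmW
  refine ⟨H, hH.mono hVV, ?_, (memLp_congr_ae hdiff).2 (hml.restrict _), ?_⟩
  · obtain ⟨c, hc⟩ := hquad
    refine ⟨c, fun G hG => ?_⟩
    have hGL := (hG.memLp h.isOpen).coeFn_toLp
    rw [← hc G hG, ← inner_eq_setIntegral (hTD hHe).symm hGL, hTapp, inner_sub_left,
      ← inner_conj_symm (Y p), hY2 p _ ((hG.1.weakHolo h.isOpen).congr_ae hGL.symm), map_zero,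
      sub_zero]
  · rw [eLpNorm_congr_ae hdiff]
    have hη : ENNReal.ofReal (Real.sqrt (ε / 2)) ^ 2 = ENNReal.ofReal (ε / 2) := by
      rw [← ENNReal.ofReal_pow (Real.sqrt_nonneg _), Real.sq_sqrt (by positivity)]
    have b1 : eLpNorm (⇑(T p) - ⇑(T φβ)) 2 (volume.restrict D) ≤
        ENNReal.ofReal (Real.sqrt (ε / 2)) := by
      rw [← eLpNorm_congr_ae (Lp.coeFn_sub (T p) (T φβ)), ← Lp.enorm_def, ← map_sub, ← ofReal_norm]
      exact ENNReal.ofReal_le_ofReal hpT.le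
    have b2 : eLpNorm (⇑(W p) - ⇑(W φβ)) 2 (volume.restrict (N' ∩ D)) ≤
        ENNReal.ofReal (Real.sqrt (ε / 2)) := by
      rw [← Measure.restrict_restrict hN'm,
        ← eLpNorm_congr_ae ((Lp.coeFn_sub (W p) (W φβ)).restrict), ← map_sub,
        ← eLpNorm_congr_ae (hLapp (p - φβ)), ← Lp.enorm_def, ← ofReal_norm]
      exact ENNReal.ofReal_le_ofReal hpL.le
    calc _ ≤ eLpNorm (reflExt D N' R (⇑(T p) - ⇑(T φβ)) (⇑(W p) - ⇑(W φβ))) 2 volume ^ 2 := by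
          gcongr
          exact Measure.restrict_le_self
      _ ≤ ENNReal.ofReal (ε / 2) + ENNReal.ofReal (ε / 2) := by
          rw [hS.eLpNorm_reflExt, ← hη]
          gcongr
      _ = ENNReal.ofReal ε := by
          rw [← ENNReal.ofReal_add (by positivity) (by positivity), add_halves]

end quad

/-- Approximation by elements of a subspace can be corrected to respect finitely many linear
constraints exactly. -/
lemma exists_approx_of_constraint {E X F : Type*} [AddCommGroup E] [Module ℂ E]
    [NormedAddCommGroup X] [NormedSpace ℂ X] [NormedAddCommGroup F] [NormedSpace ℂ F]
    [FiniteDimensional ℂ F] (A : Submodule ℂ E) (c : E →ₗ[ℂ] F) (ev : E →ₗ[ℂ] X) {C : ℝ}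
    (hC : ∀ h, ‖c h‖ ≤ C * ‖ev h‖) (e : E)
    (hA : ∀ ε : ℝ, 0 < ε → ∃ h ∈ A, ‖ev (h - e)‖ ≤ ε) {ε : ℝ} (hε : 0 < ε) :
    ∃ h ∈ A, c h = c e ∧ ‖ev (h - e)‖ ≤ ε := by
  let R : Submodule ℂ F := A.map c
  have hC' : ∀ h, ‖c h‖ ≤ |C| * ‖ev h‖ := fun h =>
    (hC h).trans (mul_le_mul_of_nonneg_right (le_abs_self C) (norm_nonneg _))
  have hmem : c e ∈ R := by
    have hcl : IsClosed (R : Set F) := R.closed_of_finiteDimensional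
    rw [← SetLike.mem_coe, ← hcl.closure_eq, Metric.mem_closure_iff]
    intro η hη
    obtain ⟨h, hh, hle⟩ := hA (η / (2 * (|C| + 1))) (by positivity)
    refine ⟨c h, ⟨h, hh, rfl⟩, ?_⟩
    rw [dist_comm, dist_eq_norm, ← map_sub]
    calc _ ≤ |C| * (η / (2 * (|C| + 1))) := (hC' _).trans (by gcongr)
      _ ≤ (|C| + 1) * (η / (2 * (|C| + 1))) := by gcongr; linarith
      _ = η / 2 := by field_simp
      _ < η := by linarith
  let cA : A →ₗ[ℂ] R := (c.comp A.subtype).codRestrict R fun x => ⟨x, x.2, rfl⟩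
  have hsurj : LinearMap.range cA = ⊤ := by
    rw [LinearMap.range_eq_top]
    rintro ⟨_, x, hx, rfl⟩
    exact ⟨⟨x, hx⟩, rfl⟩
  obtain ⟨σ, hσ⟩ := cA.exists_rightInverse_of_surjective hsurj
  have hσ' : ∀ v : R, c (σ v) = v := fun v => by
    have := LinearMap.congr_fun hσ v
    exact congrArg Subtype.val this
  let B : R →L[ℂ] X := LinearMap.toContinuousLinearMap (ev.comp (A.subtype.comp σ))
  obtain ⟨h, hh, hle⟩ := hA (ε / (1 + ‖B‖ * |C|)) (by positivity)
  let v : R := ⟨c e - c h, R.sub_mem hmem ⟨h, hh, rfl⟩⟩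
  have hv : ‖v‖ ≤ |C| * ‖ev (h - e)‖ := by
    have : ‖v‖ = ‖c (h - e)‖ := by
      rw [map_sub, norm_sub_rev]; rfl
    rw [this]; exact hC' _
  refine ⟨h + σ v, A.add_mem hh (σ v).2, by rw [map_add, hσ']; simp [v], ?_⟩
  have h1 : ev (h + σ v - e) = ev (h - e) + B v := by
    rw [show h + (σ v : E) - e = (h - e) + σ v by abel, map_add]; rfl
  rw [h1]
  calc _ ≤ ‖ev (h - e)‖ + ‖B‖ * (|C| * ‖ev (h - e)‖) :=
        (norm_add_le _ _).trans (by gcongr; exact (B.le_opNorm v).trans (by gcongr))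
    _ = (1 + ‖B‖ * |C|) * ‖ev (h - e)‖ := by ring
    _ ≤ (1 + ‖B‖ * |C|) * (ε / (1 + ‖B‖ * |C|)) := by gcongr
    _ = ε := by field_simp

section quad
variable {f g : ℂ → ℂ} {D N U V : Set ℂ} {R : ℂ → ℂ} {a : ℂ}

lemma BergmanFun.integrable_mul_conj (hG : BergmanFun D g) (hD : IsOpen D)
    (hb : Bornology.IsBounded D) (hV : closure D ⊆ V) {H : ℂ → ℂ} (hH : ContinuousOn H V) :
    IntegrableOn (fun z => g z * conj (H z)) D := by
  have hfin : IsFiniteMeasure (volume.restrict D) := ⟨by simpa using hb.measure_lt_top⟩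
  have h1 : IntegrableOn g D := (hG.memLp hD).integrable (by norm_num)
  obtain ⟨C, hC⟩ := hb.isCompact_closure.exists_bound_of_continuousOn (hH.mono hV)
  refine h1.mul_bdd (c := C) ?_ ?_
  · exact (continuous_conj.comp_continuousOn
      (hH.mono (subset_closure.trans hV))).aestronglyMeasurable hD.measurableSet
  · refine (ae_restrict_iff' hD.measurableSet).2 (Filter.Eventually.of_forall fun z hz => ?_)
    rw [RCLike.norm_conj]
    exact hC z (subset_closure hz)

lemma Quad.congr {H H' : ℂ → ℂ} (hq : Quad D a H) (hD : IsOpen D) (h : ∀ z ∈ D, H z = H' z) :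
    Quad D a H' := by
  obtain ⟨c, hc⟩ := hq
  refine ⟨c, fun G hG => ?_⟩
  rw [← hc G hG]
  exact setIntegral_congr_fun hD.measurableSet fun z hz => by simp only [h z hz]

/-- Holomorphic functions on `V`. -/
def holoOn (V : Set ℂ) : Submodule ℂ (ℂ → ℂ) where
  carrier := {H | DifferentiableOn ℂ H V}
  add_mem' h1 h2 := h1.add h2
  zero_mem' := differentiableOn_const 0
  smul_mem' c _ h := h.const_smul c

/-- Holomorphic functions on `V` with the quadrature property on `D`. -/
def quadOn (hD : IsOpen D) (hb : Bornology.IsBounded D) (hV : closure D ⊆ V) (a : ℂ) :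
    Submodule ℂ (holoOn V) where
  carrier := {H | Quad D a H}
  add_mem' := by
    rintro H₁ H₂ ⟨c, hc⟩ ⟨d, hd⟩
    refine ⟨c + d, fun G hG => ?_⟩
    rw [Finsupp.sum_add_index' (fun _ => zero_mul _) fun _ _ _ => add_mul _ _ _, ← hc G hG,
      ← hd G hG, ← integral_add (hG.integrable_mul_conj hD hb hV H₁.2.continuousOn)
        (hG.integrable_mul_conj hD hb hV H₂.2.continuousOn)]
    refine integral_congr_ae (Filter.Eventually.of_forall fun z => ?_)
    simp [mul_add]
  zero_mem' := ⟨0, fun G _ => by simp⟩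
  smul_mem' := by
    rintro b H ⟨c, hc⟩
    refine ⟨conj b • c, fun G hG => ?_⟩
    rw [Finsupp.sum_smul_index fun _ => zero_mul _]
    simp only [mul_assoc]
    rw [← Finsupp.mul_sum, ← hc G hG, ← integral_const_mul]
    refine integral_congr_ae (Filter.Eventually.of_forall fun z => ?_)
    simp only [SetLike.val_smul, Pi.smul_apply, smul_eq_mul, map_mul]
    ring

/-- Uniform approximation of the constant one by functions with the quadrature property. -/
lemma SchwarzDomain.exists_quad_approx (h : SchwarzDomain D N R) (ha : a ∈ D) :
    ∃ V, IsOpen V ∧ closure D ⊆ V ∧ ∀ K, IsCompact K → K ⊆ V → ∀ ε : ℝ, 0 < ε →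
      ∃ H, DifferentiableOn ℂ H V ∧ Quad D a H ∧ ∀ z ∈ K, ‖H z - 1‖ ≤ ε := by
  obtain ⟨V, hV, -, hDV, happ⟩ := h.exists_quad_approx_L2 ha
  refine ⟨V, hV, hDV, fun K hK hKV ε hε => ?_⟩
  obtain ⟨r, hr, hrV⟩ := hK.exists_thickening_subset_open hV hKV
  obtain ⟨C, hC, hle⟩ := exists_norm_sq_le_integral hr
  obtain ⟨H, hH, hq, hm, hn⟩ := happ (ε ^ 2 / C) (by positivity)
  refine ⟨H, hH, hq, fun z hz => ?_⟩
  have hb : ball z r ⊆ V := (ball_subset_thickening hz r).trans hrV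
  have hi : IntegrableOn (fun z => ‖H z - 1‖ ^ 2) V :=
    (memLp_two_iff_integrable_sq_norm hm.1).1 hm
  have h1 := hle (fun z => H z - 1) z ((hH.mono hb).sub_const 1) (hi.mono_set hb)
  have h2 : ∫ w in V, ‖H w - 1‖ ^ 2 ≤ ε ^ 2 / C := by
    rw [eLpNorm_two_sq] at hn
    rw [integral_eq_lintegral_of_nonneg_ae (Filter.Eventually.of_forall fun _ => by positivity)
      hi.aestronglyMeasurable]
    refine ENNReal.toReal_le_of_le_ofReal (by positivity) ?_
    refine le_trans (le_of_eq (lintegral_congr fun z => ?_)) hn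
    rw [ENNReal.ofReal_pow (norm_nonneg _), ofReal_norm]
  have h3 : ∫ w in ball z r, ‖H w - 1‖ ^ 2 ≤ ∫ w in V, ‖H w - 1‖ ^ 2 :=
    setIntegral_mono_set hi (Filter.Eventually.of_forall fun _ => by positivity)
      hb.eventuallyLE
  have h4 : ‖H z - 1‖ ^ 2 ≤ ε ^ 2 := by
    calc _ ≤ C * (ε ^ 2 / C) := h1.trans (by gcongr; exact h3.trans h2)
      _ = ε ^ 2 := by field_simp
  exact le_of_sq_le_sq h4 hε.le

end quad

section primitive
variable {D N V : Set ℂ} {R : ℂ → ℂ} {a : ℂ}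

lemma eqOn_of_hasDerivAt {f g q : ℂ → ℂ} {S : Set ℂ} (hS : IsOpen S) (hc : Convex ℝ S)
    (hf : ∀ z ∈ S, HasDerivAt f (q z) z) (hg : ∀ z ∈ S, HasDerivAt g (q z) z) {x : ℂ} (hx : x ∈ S)
    (h : f x = g x) : EqOn f g S :=
  hS.eqOn_of_deriv_eq hc.isPreconnected
    (fun z hz => (hf z hz).differentiableAt.differentiableWithinAt)
    (fun z hz => (hg z hz).differentiableAt.differentiableWithinAt)
    (fun z hz => by rw [(hf z hz).deriv, (hg z hz).deriv]) hx h

/-- The normalized primitives of holomorphic functions on a disc. -/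
lemma exists_primitive {x : ℂ} {r : ℝ} (hr : 0 < r) (hV : ball x r ⊆ V) :
    ∃ P : ℂ → holoOn V →ₗ[ℂ] ℂ, (∀ H, P x H = 0) ∧
      (∀ H : holoOn V, ∀ z ∈ ball x r, HasDerivAt (fun w => P w H) ((H : ℂ → ℂ) z) z) ∧
      ∀ (H : holoOn V) (C : ℝ), (∀ z ∈ ball x r, ‖(H : ℂ → ℂ) z‖ ≤ C) →
        ∀ z ∈ ball x r, ‖P z H‖ ≤ C * r := by
  have h1 : ∀ H : holoOn V, ∃ g : ℂ → ℂ, g x = 0 ∧ ∀ z ∈ ball x r, HasDerivAt g ((H : ℂ → ℂ) z) z :=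
    fun H => (DifferentiableOn.isExactOn_ball (H.2.mono hV)).with_val_at x 0
  choose p hp0 hp using h1
  have hx : x ∈ ball x r := mem_ball_self hr
  classical
  let P : ℂ → holoOn V →ₗ[ℂ] ℂ := fun z => if hz : z ∈ ball x r then
    { toFun := fun H => p H z
      map_add' := fun H₁ H₂ => eqOn_of_hasDerivAt (g := fun w => p H₁ w + p H₂ w) isOpen_ball (convex_ball x r) (hp _)
        (fun w hw => (hp H₁ w hw).add (hp H₂ w hw)) hx (by simp [hp0]) hz
      map_smul' := fun c H => eqOn_of_hasDerivAt (g := fun w => c * p H w) isOpen_ball (convex_ball x r) (hp _)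
        (fun w hw => (hp H w hw).const_mul c) hx (by simp [hp0]) hz } else 0
  have hP : ∀ z ∈ ball x r, ∀ H, P z H = p H z := fun z hz H => by
    simp only [P, dif_pos hz]; rfl
  refine ⟨P, fun H => by rw [hP x hx, hp0], fun H z hz => ?_, fun H C hC z hz => ?_⟩
  · refine (hp H z hz).congr_of_eventuallyEq ?_
    filter_upwards [isOpen_ball.mem_nhds hz] with w hw using hP w hw H
  · rw [hP z hz]
    have := (convex_ball x r).norm_image_sub_le_of_norm_hasDerivWithin_le
      (fun w hw => (hp H w hw).hasDerivWithinAt) hC hx hz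
    rw [hp0, sub_zero] at this
    refine this.trans ?_
    have h0 : 0 ≤ C := (norm_nonneg _).trans (hC x hx)
    gcongr
    exact (mem_ball_iff_norm.1 hz).le

/-- Small holomorphic perturbations of the identity with the quadrature property. -/
theorem SchwarzDomain.exists_quad_deriv (h : SchwarzDomain D N R) (ha : a ∈ D) :
    ∃ V, IsOpen V ∧ closure D ⊆ V ∧ ∀ ε : ℝ, 0 < ε → ∃ e, DifferentiableOn ℂ e V ∧
      Quad D a (fun z => 1 + deriv e z) ∧ ∀ z ∈ V, ‖e z‖ ≤ ε := by
  obtain ⟨V, hV, hDV, happ⟩ := h.exists_quad_approx ha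
  have hDc := h.bounded.isCompact_closure
  obtain ⟨r, hr, hrV⟩ := hDc.exists_cthickening_subset_open hV hDV
  set K := cthickening r (closure D) with hK
  have hKc : IsCompact K := hDc.cthickening
  obtain ⟨t, htD, htf, hcov⟩ := hDc.finite_cover_balls hr
  have hbK : ∀ x ∈ t, ball x r ⊆ K := fun x hx =>
    (ball_subset_thickening (htD hx) r).trans (thickening_subset_cthickening _ _)
  have hprim : ∀ x : t, _ := fun x => exists_primitive (x := x) hr ((hbK x x.2).trans hrV)
  choose P hP0 hPd hPn using hprim
  have : Fintype t := htf.fintype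
  have : CompactSpace K := isCompact_iff_compactSpace.1 hKc
  let ev : holoOn V →ₗ[ℂ] C(K, ℂ) :=
    { toFun := fun H => ⟨fun z : K => (H : ℂ → ℂ) z,
        continuousOn_iff_continuous_domRestrict.1 (H.2.continuousOn.mono hrV)⟩
      map_add' := fun _ _ => rfl
      map_smul' := fun _ _ => rfl }
  have hev : ∀ H : holoOn V, ∀ z ∈ K, ‖(H : ℂ → ℂ) z‖ ≤ ‖ev H‖ := fun H z hz =>
    (ev H).norm_coe_le_norm ⟨z, hz⟩
  classical
  let c : holoOn V →ₗ[ℂ] (t × t → ℂ) := LinearMap.pi fun ij =>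
    if dist (ij.1 : ℂ) ij.2 < 2 * r then
      P ij.1 (midpoint ℝ (ij.1 : ℂ) ij.2) - P ij.2 (midpoint ℝ (ij.1 : ℂ) ij.2) else 0
  have hmid : ∀ x y : ℂ, dist x y < 2 * r → midpoint ℝ x y ∈ ball x r ∩ ball y r := by
    intro x y hxy
    have h2 : ‖(2 : ℝ)‖ = 2 := by norm_num
    constructor
    · rw [mem_ball, dist_midpoint_left, h2]; linarith
    · rw [mem_ball, dist_midpoint_right, h2]; linarith
  have hc : ∀ H, ‖c H‖ ≤ (2 * r) * ‖ev H‖ := by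
    intro H
    rw [pi_norm_le_iff_of_nonneg (by positivity)]
    rintro ⟨i, j⟩
    simp only [c, LinearMap.pi_apply]
    split_ifs with hij
    · have hm := hmid _ _ hij
      have b1 := hPn i H ‖ev H‖ (fun z hz => hev H z (hbK i i.2 hz)) _ hm.1
      have b2 := hPn j H ‖ev H‖ (fun z hz => hev H z (hbK j j.2 hz)) _ hm.2
      rw [LinearMap.sub_apply]
      refine (norm_sub_le _ _).trans ?_
      linarith
    · simp only [LinearMap.zero_apply, norm_zero]; positivity
  let one : holoOn V := ⟨fun _ => 1, differentiableOn_const 1⟩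
  let W : Set ℂ := ⋃ x ∈ t, ball x r
  have hWo : IsOpen W := isOpen_biUnion fun _ _ => isOpen_ball
  refine ⟨W, hWo, hcov, fun ε hε => ?_⟩
  obtain ⟨p, hp, hcp, hpn⟩ := exists_approx_of_constraint (quadOn h.isOpen h.bounded hDV a) c ev hc
    one (fun δ hδ => by
      obtain ⟨H, h1, h2, h3⟩ := happ K hKc hrV δ hδ
      refine ⟨⟨H, h1⟩, h2, ?_⟩
      rw [ContinuousMap.norm_le _ hδ.le]
      exact fun z => h3 z z.2) (ε := ε / r) (by positivity)
  have hc0 : c (p - one) = 0 := by rw [map_sub, hcp, sub_self]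
  have hglue : ∀ i j : t, EqOn (fun z => P i z (p - one)) (fun z => P j z (p - one))
      (ball (i : ℂ) r ∩ ball (j : ℂ) r) := by
    intro i j
    by_cases hij : dist (i : ℂ) j < 2 * r
    · have e1 := congrFun hc0 (i, j)
      simp only [c, LinearMap.pi_apply, if_pos hij, LinearMap.sub_apply, Pi.zero_apply] at e1
      exact eqOn_of_hasDerivAt (isOpen_ball.inter isOpen_ball)
        ((convex_ball _ _).inter (convex_ball _ _)) (fun z hz => hPd i _ z hz.1)
        (fun z hz => hPd j _ z hz.2) (hmid _ _ hij) (sub_eq_zero.1 e1)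
    · rintro z ⟨z1, z2⟩
      refine absurd ?_ hij
      rw [mem_ball] at z1 z2
      have := dist_triangle_left (i : ℂ) j z
      linarith
  have hWm : ∀ z ∈ W, ∃ i : t, z ∈ ball (i : ℂ) r := fun z hz => by
    simp only [W, mem_iUnion] at hz
    obtain ⟨x, hx, hz⟩ := hz
    exact ⟨⟨x, hx⟩, hz⟩
  let e : ℂ → ℂ := fun z => if hz : z ∈ W then P (hWm z hz).choose z (p - one) else 0
  have he : ∀ i : t, ∀ z ∈ ball (i : ℂ) r, e z = P i z (p - one) := by
    intro i z hz
    have hzW : z ∈ W := mem_biUnion i.2 hz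
    simp only [e, dif_pos hzW]
    exact hglue _ _ ⟨(hWm z hzW).choose_spec, hz⟩
  have hed : ∀ z ∈ W, HasDerivAt e ((p : ℂ → ℂ) z - 1) z := by
    intro z hz
    obtain ⟨i, hi⟩ := hWm z hz
    refine (hPd i (p - one) z hi).congr_of_eventuallyEq ?_
    filter_upwards [isOpen_ball.mem_nhds hi] with w hw using he i w hw
  refine ⟨e, fun z hz => (hed z hz).differentiableAt.differentiableWithinAt, ?_, fun z hz => ?_⟩
  · have hq : Quad D a p := hp
    refine hq.congr h.isOpen fun z hz => ?_
    rw [(hed z (hcov (subset_closure hz))).deriv]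
    ring
  · obtain ⟨i, hi⟩ := hWm z hz
    rw [he i z hi]
    refine (hPn i (p - one) (ε / r) (fun w hw => ?_) z hi).trans (by field_simp; rfl)
    exact (hev _ w (hbK i i.2 hw)).trans hpn

end primitive

section assembly
variable {D V : Set ℂ} {g e : ℂ → ℂ} {a : ℂ}

lemma isOpen_image_of_injOn (hD : IsOpen D) (hg : DifferentiableOn ℂ g D) (hi : InjOn g D) :
    IsOpen (g '' D) := by
  rw [isOpen_iff_mem_nhds]
  rintro _ ⟨z, hz, rfl⟩
  rcases (hg.analyticAt (hD.mem_nhds hz)).eventually_constant_or_nhds_le_map_nhds with h | h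
  · exfalso
    have h' : ∀ᶠ w in 𝓝 z, w = z := by
      filter_upwards [h, hD.mem_nhds hz] with w hw hwD using hi hwD hz hw
    have h2 : ({z} : Set ℂ) ∈ 𝓝 z := h'
    exact (not_isOpen_singleton z) (isOpen_singleton_iff_nhds_eq_pure z |>.2
      (le_antisymm (by simpa using h2) (pure_le_nhds z)))
  · exact h (Filter.image_mem_map (hD.mem_nhds hz))

/-- Derivatives of `f ∘ g * q` at `a` are combinations of derivatives of `f` at `g a`. -/
lemma exists_iteratedDeriv_comp_mul (hD : IsOpen D) (hg : DifferentiableOn ℂ g D)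
    (ho : IsOpen (g '' D)) (ha : a ∈ D) (k : ℕ) : ∀ q : ℂ → ℂ, DifferentiableOn ℂ q D →
    ∃ d : ℕ →₀ ℂ, ∀ f, DifferentiableOn ℂ f (g '' D) →
      iteratedDeriv k (fun z => f (g z) * q z) a =
        Finsupp.linearCombination ℂ (fun j => iteratedDeriv j f (g a)) d := by
  induction k with
  | zero =>
    intro q _
    exact ⟨Finsupp.single 0 (q a), fun f _ => by simp [mul_comm]⟩
  | succ k ih =>
    intro q hq
    have hg' := hg.deriv hD
    obtain ⟨d₁, h₁⟩ := ih (fun z => deriv g z * q z) (hg'.mul hq)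
    obtain ⟨d₂, h₂⟩ := ih (deriv q) (hq.deriv hD)
    refine ⟨Finsupp.mapDomain Nat.succ d₁ + d₂, fun f hf => ?_⟩
    have hf' := hf.deriv ho
    have hm : MapsTo g D (g '' D) := mapsTo_image g D
    have key : deriv (fun z => f (g z) * q z) =ᶠ[𝓝 a]
        fun z => deriv f (g z) * (deriv g z * q z) + f (g z) * deriv q z := by
      filter_upwards [hD.mem_nhds ha] with z hz
      have e1 := (hf.differentiableAt (ho.mem_nhds (hm hz))).hasDerivAt
      have e2 := (hg.differentiableAt (hD.mem_nhds hz)).hasDerivAt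
      have e3 := (hq.differentiableAt (hD.mem_nhds hz)).hasDerivAt
      have e4 := (e1.comp z e2).mul e3
      have e5 := e4.deriv
      simp only [Function.comp_apply] at e5
      rw [← mul_assoc]
      exact e5
    have c1 : ContDiffAt ℂ k (fun z => deriv f (g z) * (deriv g z * q z)) a :=
      (((hf'.comp hg hm).mul (hg'.mul hq)).contDiffOn hD).contDiffAt (hD.mem_nhds ha)
    have c2 : ContDiffAt ℂ k (fun z => f (g z) * deriv q z) a :=
      (((hf.comp hg hm).mul (hq.deriv hD)).contDiffOn hD).contDiffAt (hD.mem_nhds ha)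
    rw [iteratedDeriv_succ', key.iteratedDeriv_eq, iteratedDeriv_fun_add c1 c2, h₁ _ hf', h₂ _ hf,
      map_add, Finsupp.linearCombination_mapDomain]
    congr 2
    simp only [iteratedDeriv_succ', Function.comp_def]

/-- Transport of the quadrature property by a conformal map. -/
theorem Quad.image (hD : IsOpen D) (hg : DifferentiableOn ℂ g D) (hi : InjOn g D) (ha : a ∈ D)
    (hq : Quad D a (deriv g)) : ∃ (M : ℕ) (c : ℕ → ℂ), ∀ f, BergmanFun (g '' D) f →
      (∫ z in g '' D, f z) =
        ∑ k ∈ Finset.range (M + 1), c k * iteratedDerivWithin k f (g '' D) (g a) := by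
  have ho := isOpen_image_of_injOn hD hg hi
  have hg' := hg.deriv hD
  obtain ⟨c, hc⟩ := hq
  choose d hd using fun k => exists_iteratedDeriv_comp_mul hD hg ho ha k (deriv g) hg'
  set b : ℕ →₀ ℂ := c.sum fun k x => x • d k with hb
  refine ⟨b.support.sup id, b, fun f hf => ?_⟩
  have hder : ∀ z ∈ D, HasFDerivWithinAt g (wirt (deriv g z) 0) D z := fun z hz =>
    (hg.differentiableAt (hD.mem_nhds hz)).hasDerivAt.hasWirt.hasFDerivWithinAt
  have hdet : ∀ z, |(wirt (deriv g z) 0).det| = ‖deriv g z‖ ^ 2 := fun z => by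
    rw [det_wirt]; simp
  have hG : BergmanFun D fun z => f (g z) * deriv g z := by
    refine ⟨(hf.1.comp hg (mapsTo_image g D)).mul hg', ?_⟩
    have h1 := (integrableOn_image_iff_integrableOn_abs_det_fderiv_smul volume hD.measurableSet hder
      hi (fun z => ‖f z‖ ^ 2)).1 hf.2
    refine h1.congr_fun (fun z _ => ?_) hD.measurableSet
    simp only [hdet, smul_eq_mul, norm_mul]
    ring
  rw [integral_image_eq_integral_abs_det_fderiv_smul volume hD.measurableSet hder hi f]
  have h2 : ∫ z in D, |(wirt (deriv g z) 0).det| • f (g z) =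
      ∫ z in D, (f (g z) * deriv g z) * conj (deriv g z) := by
    refine integral_congr_ae (Filter.Eventually.of_forall fun z => ?_)
    simp only [hdet, real_smul, ofReal_pow]
    rw [mul_assoc, mul_conj']
    ring
  have h3 : ∀ k, iteratedDerivWithin k f (g '' D) (g a) = iteratedDeriv k f (g a) := fun k =>
    iteratedDerivWithin_of_isOpen ho (mem_image_of_mem g ha)
  simp only [h3]
  rw [h2, hc _ hG]
  have h4 : Finsupp.linearCombination ℂ (fun j => iteratedDeriv j f (g a)) b =
      c.sum fun k x => x * iteratedDeriv k (fun z => f (g z) * deriv g z) a := by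
    rw [hb, Finsupp.sum, map_sum]
    refine Finset.sum_congr rfl fun k _ => ?_
    rw [map_smul, ← hd k f hf.1, smul_eq_mul]
  rw [← h4, Finsupp.linearCombination_apply]
  refine Finsupp.sum_of_support_subset _ (fun j hj => ?_) _ (by simp)
  rw [Finset.mem_range, Nat.lt_succ_iff]
  exact Finset.le_sup (f := id) hj

lemma norm_iteratedFDeriv_le_of_differentiableOn {z : ℂ} {r ε : ℝ} (hr : 0 < r)
    (he : DifferentiableOn ℂ e (closedBall z r)) (hb : ∀ w ∈ closedBall z r, ‖e w‖ ≤ ε) (k : ℕ) :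
    ‖iteratedFDeriv ℝ k e z‖ ≤ k.factorial * ε / r ^ k := by
  have hb' := he.mono ball_subset_closedBall
  have hc : ContDiffAt ℂ k e z :=
    (hb'.contDiffOn isOpen_ball).contDiffAt (ball_mem_nhds z hr)
  have h1 : ‖iteratedFDeriv ℝ k e z‖ = ‖iteratedFDeriv ℂ k e z‖ := by
    rw [← hc.restrictScalars_iteratedFDeriv (𝕜 := ℝ)]
    simp
  rw [h1, norm_iteratedFDeriv_eq_norm_iteratedDeriv]
  refine norm_iteratedDeriv_le_of_forall_mem_sphere_norm_le k hr ?_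
    fun w hw => hb w (sphere_subset_closedBall hw)
  exact he.diffContOnCl_ball subset_rfl

/-- A small holomorphic perturbation of the identity is injective. -/
lemma injOn_add_of_small {S : Set ℂ} {r ε : ℝ} (hr : 0 < r) (hεr : 4 * ε ≤ r)
    (he : ∀ z ∈ S, DifferentiableOn ℂ e (closedBall z (2 * r)))
    (hb : ∀ z ∈ S, ∀ w ∈ closedBall z (2 * r), ‖e w‖ ≤ ε) : InjOn (fun z => z + e z) S := by
  intro z hz w hw h
  by_contra hne
  have hpos : 0 < ‖w - z‖ := norm_pos_iff.2 (sub_ne_zero.2 (Ne.symm hne))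
  have heq : w - z = e z - e w := by
    simp only at h
    linear_combination -h
  have hself : ∀ x : ℂ, x ∈ closedBall x (2 * r) := fun x => mem_closedBall_self (by positivity)
  rcases lt_or_ge ‖w - z‖ r with h1 | h1
  · have hd : ∀ x ∈ ball z r, HasDerivWithinAt e (deriv e x) (ball z r) x := fun x hx =>
      (((he z hz).mono ball_subset_closedBall).differentiableAt (isOpen_ball.mem_nhds
        (ball_subset_ball (by linarith) hx))).hasDerivAt.hasDerivWithinAt
    have hsub : ∀ x ∈ ball z r, closedBall x r ⊆ closedBall z (2 * r) := fun x hx =>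
      closedBall_subset_closedBall' (by rw [mem_ball] at hx; linarith)
    have hn : ∀ x ∈ ball z r, ‖deriv e x‖ ≤ ε / r := fun x hx =>
      norm_deriv_le_of_forall_mem_sphere_norm_le hr
        ((he z hz).diffContOnCl_ball (hsub x hx))
        fun y hy => hb z hz y (hsub x hx (sphere_subset_closedBall hy))
    have h2 := (convex_ball z r).norm_image_sub_le_of_norm_hasDerivWithin_le hd hn
      (mem_ball_self hr) (mem_ball_iff_norm.2 h1)
    rw [← norm_neg, neg_sub, ← heq] at h2
    have h3 : ε / r ≤ 1 / 4 := by rw [div_le_iff₀ hr]; linarith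
    nlinarith
  · have h2 : ‖w - z‖ ≤ ε + ε := by
      rw [heq]
      exact (norm_sub_le _ _).trans (add_le_add (hb z hz z (hself z)) (hb w hw w (hself w)))
    linarith

end assembly

lemma exists_one_le_iteratedFDeriv_bound {F : ℂ → ℂ} (hF : ContDiff ℝ ∞ F) {K : Set ℂ}
    (hK : IsCompact K) (m : ℕ) :
    ∃ B, 1 ≤ B ∧ ∀ i ≤ m, ∀ z ∈ K, ‖iteratedFDeriv ℝ i F z‖ ≤ B := by
  choose C hC using fun i : ℕ => hK.exists_bound_of_continuousOn
    (hF.continuous_iteratedFDeriv (m := i) (by exact_mod_cast le_top)).continuousOn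
  refine ⟨1 + ∑ i ∈ Finset.range (m + 1), |C i|,
    le_add_of_nonneg_right (Finset.sum_nonneg fun _ _ => abs_nonneg _), fun i hi z hz => ?_⟩
  have h1 := Finset.single_le_sum (f := fun j => |C j|) (fun _ _ => abs_nonneg _)
    (Finset.mem_range.2 (Nat.lt_succ_of_le hi))
  have h2 := (hC i z hz).trans (le_abs_self _)
  linarith

lemma norm_iteratedFDeriv_const_le (c : ℂ) (k : ℕ) (z : ℂ) :
    ‖iteratedFDeriv ℝ k (fun _ : ℂ => c) z‖ ≤ ‖c‖ := by
  rcases Nat.eq_zero_or_pos k with rfl | hk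
  · simp
  · rw [iteratedFDeriv_const_of_ne hk.ne']
    simp

/-- Uniform bounds for the derivatives of `e ∘ F` in terms of the size of `e`. -/
lemma exists_iteratedFDeriv_comp_bound {F : ℂ → ℂ} (hF : ContDiff ℝ ∞ F) {K V : Set ℂ}
    (hK : IsCompact K) (hV : IsOpen V) {r : ℝ} (hr : 0 < r)
    (hKV : ∀ z ∈ K, closedBall (F z) r ⊆ V) (m : ℕ) :
    ∃ A, 0 ≤ A ∧ ∀ (e : ℂ → ℂ) (ε : ℝ), DifferentiableOn ℂ e V → (∀ z ∈ V, ‖e z‖ ≤ ε) →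
      ∀ k ≤ m, ∀ z ∈ K, ‖iteratedFDeriv ℝ k (fun w => e (F w)) z‖ ≤ A * ε := by
  obtain ⟨B, hB1, hB⟩ := exists_one_le_iteratedFDeriv_bound hF hK m
  set S := ∑ i ∈ Finset.range (m + 1), (i.factorial : ℝ) / r ^ i with hS
  have hS0 : 0 ≤ S := Finset.sum_nonneg fun i _ => by positivity
  refine ⟨m.factorial * S * B ^ m, by positivity, fun e ε he heε k hk z hz => ?_⟩
  have hzV : F z ∈ V := hKV z hz (mem_closedBall_self hr.le)
  have hε : 0 ≤ ε := (norm_nonneg _).trans (heε _ hzV)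
  have hFV : IsOpen (F ⁻¹' V) := hV.preimage hF.continuous
  have hes : ContDiffOn ℝ ∞ e V := (he.contDiffOn (n := ∞) hV).restrict_scalars ℝ
  have h1 := norm_iteratedFDerivWithin_comp_le hes hF.contDiffOn (n := k)
    (by exact_mod_cast le_top) hV.uniqueDiffOn hFV.uniqueDiffOn (mapsTo_preimage F V) hzV
    (C := S * ε) (D := B) (fun i hi => by
      rw [iteratedFDerivWithin_of_isOpen i hV hzV]
      refine (norm_iteratedFDeriv_le_of_differentiableOn hr (he.mono (hKV z hz))
        (fun w hw => heε w (hKV z hz hw)) i).trans ?_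
      rw [mul_div_right_comm]
      gcongr
      exact Finset.single_le_sum (f := fun i => (i.factorial : ℝ) / r ^ i)
        (fun j _ => by positivity) (Finset.mem_range.2 (Nat.lt_succ_of_le (hi.trans hk))))
    (fun i hi hik => by
      rw [iteratedFDerivWithin_of_isOpen i hFV hzV]
      exact (hB i (hik.trans hk) z hz).trans (le_self_pow₀ hB1 (by omega)))
  rw [iteratedFDerivWithin_of_isOpen k hFV hzV] at h1
  refine h1.trans ?_
  have h2 : (k.factorial : ℝ) ≤ m.factorial := by exact_mod_cast Nat.factorial_le hk
  have h3 : B ^ k ≤ B ^ m := pow_le_pow_right₀ hB1 hk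
  calc (k.factorial : ℝ) * (S * ε) * B ^ k ≤ m.factorial * (S * ε) * B ^ m := by gcongr
    _ = m.factorial * S * B ^ m * ε := by ring

/-- every smoothly bounded domain admits, for each `m` and `δ > 0`, a
holomorphic map `g`, smooth and injective on the closure and `(m, δ)`-close to the identity,
such that `g(Ω)` is a quadrature domain with a prescribed point `w₀` as its only node. -/
theorem stmt_13 (Ω : Set ℂ) (hΩo : IsOpen Ω) (hΩc : IsConnected Ω)
    (hsm : HasSmoothBoundary Ω) (w₀ : ℂ) (hw₀ : w₀ ∈ Ω)
    (m : ℕ) (δ : ℝ) (hδ : 0 < δ) :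
    ∃ g : ℂ → ℂ,
      (∃ U : Set ℂ, IsOpen U ∧ closure Ω ⊆ U ∧ ContDiffOn ℝ (⊤ : ℕ∞) g U) ∧
      DifferentiableOn ℂ g Ω ∧ InjOn g (closure Ω) ∧ CloseToId Ω m δ g ∧
      w₀ ∈ g '' Ω ∧
      ∃ (M : ℕ) (c : ℕ → ℂ),
        ∀ f : ℂ → ℂ, BergmanFun (g '' Ω) f →
          (∫ z in g '' Ω, f z) =
            ∑ k ∈ Finset.range (M + 1), c k * iteratedDerivWithin k f (g '' Ω) w₀ := by
  obtain ⟨F, N, R, hF, hFd, hFi, hFc, hFm, hD⟩ :=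
    exists_schwarzDomain hΩo hΩc hsm m (η := δ / 4) (by positivity)
  obtain ⟨V, hV, hDV, hquad⟩ := hD.exists_quad_deriv (mem_image_of_mem F hw₀)
  have hDc := hD.bounded.isCompact_closure
  have hΩk : IsCompact (closure Ω) := hsm.1.isCompact_closure
  obtain ⟨s, hs, hsV⟩ := hDc.exists_cthickening_subset_open hV hDV
  set r := s / 2 with hr
  have hr0 : 0 < r := by positivity
  have hball : ∀ z ∈ closure (F '' Ω), closedBall z (2 * r) ⊆ V := fun z hz =>
    (closedBall_subset_cthickening hz _).trans (by rwa [hr, mul_div_cancel₀ _ two_ne_zero])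
  have hFcl : ∀ z ∈ closure Ω, F z ∈ closure (F '' Ω) := fun z hz => by
    rw [hFc]; exact mem_image_of_mem F hz
  obtain ⟨A, hA, hAb⟩ := exists_iteratedFDeriv_comp_bound hF hΩk hV hr0
    (fun z hz => (closedBall_subset_closedBall (by linarith)).trans (hball _ (hFcl z hz))) m
  obtain ⟨e, he, heq, hes⟩ := hquad (min (r / 4) (δ / (4 * (A + 1)))) (by positivity)
  set ε := min (r / 4) (δ / (4 * (A + 1))) with hε
  have hε1 : 4 * ε ≤ r := by linarith [min_le_left (r / 4) (δ / (4 * (A + 1)))]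
  have hε2 : (A + 1) * ε ≤ δ / 4 := by
    have h1 : ε ≤ δ / (4 * (A + 1)) := min_le_right _ _
    calc (A + 1) * ε ≤ (A + 1) * (δ / (4 * (A + 1))) := by gcongr
      _ = δ / 4 := by field_simp
  set c₀ : ℂ := w₀ - F w₀ - e (F w₀) with hc₀
  set g₂ : ℂ → ℂ := fun z => z + e z + c₀ with hg₂
  have hDsub : F '' Ω ⊆ V := subset_closure.trans hDV
  have hg₂V : DifferentiableOn ℂ g₂ V := (differentiableOn_id.add he).add_const c₀
  have hinj : InjOn g₂ (closure (F '' Ω)) := by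
    have h1 := injOn_add_of_small hr0 hε1 (fun z hz => he.mono (hball z hz))
      fun z hz w hw => hes w (hball z hz hw)
    exact fun z hz w hw h => h1 hz hw (add_right_cancel h)
  have hg₂w : g₂ (F w₀) = w₀ := by simp only [hg₂, hc₀]; ring
  have hq : Quad (F '' Ω) (F w₀) (deriv g₂) := heq.congr hD.isOpen fun z hz => by
    have h1 := (he.differentiableAt (hV.mem_nhds (hDsub hz))).hasDerivAt
    exact (((hasDerivAt_id z).add h1).add_const c₀).deriv.symm
  obtain ⟨M, c, hMc⟩ := hq.image hD.isOpen (hg₂V.mono hDsub) (hinj.mono subset_closure)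
    (mem_image_of_mem F hw₀)
  rw [image_image, hg₂w] at hMc
  have heFs : ContDiffOn ℝ ∞ (fun z => e (F z)) (F ⁻¹' V) :=
    ((he.contDiffOn (n := ∞) hV).restrict_scalars ℝ).comp hF.contDiffOn (mapsTo_preimage F V)
  have hFV : IsOpen (F ⁻¹' V) := hV.preimage hF.continuous
  have hΩV : closure Ω ⊆ F ⁻¹' V := fun z hz => hDV (hFcl z hz)
  refine ⟨fun z => g₂ (F z), ⟨F ⁻¹' V, hFV, hΩV, ?_⟩, ?_, ?_, ?_, ⟨w₀, hw₀, hg₂w⟩, M, c, hMc⟩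
  · exact (hF.contDiffOn.add heFs).add contDiffOn_const
  · exact (hg₂V.mono hDsub).comp hFd (mapsTo_image F Ω)
  · exact fun z hz w hw h => hFi (hinj (hFcl z hz) (hFcl w hw) h)
  · intro k hk z hz
    have hkn : ((k : ℕ∞) : ℕ∞ω) ≤ ∞ := by exact_mod_cast le_top
    have d1 : ContDiffAt ℝ k (fun w => F w - w) z := (hF.sub contDiff_id).contDiffAt.of_le hkn
    have d2 : ContDiffAt ℝ k (fun w => e (F w)) z :=
      (heFs.contDiffAt (hFV.mem_nhds (hΩV hz))).of_le hkn
    have hfun : (fun w => g₂ (F w) - w) = fun w => (F w - w + e (F w)) + c₀ := by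
      funext w; simp only [hg₂]; ring
    rw [hfun, fun_iteratedFDeriv_add_apply (d1.add d2) contDiffAt_const, fun_iteratedFDeriv_add_apply d1 d2]
    have hc : ‖c₀‖ ≤ δ / 4 + ε := by
      have h1 := hFm 0 (Nat.zero_le m) w₀ (subset_closure hw₀)
      rw [norm_iteratedFDeriv_zero, norm_sub_rev] at h1
      exact (norm_sub_le _ _).trans (add_le_add h1 (hes _ (hDsub (mem_image_of_mem F hw₀))))
    have b1 := hFm k hk z hz
    have b2 := hAb e ε he hes k hk z hz
    have b3 := norm_iteratedFDeriv_const_le c₀ k z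
    refine (norm_add_le _ _).trans ((add_le_add_left (norm_add_le _ _) _).trans ?_)
    linarith
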